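/- arXiv:1905.13615 — 2 statements merged into one kernel-verified Lean document; each statement's English description precedes it below -/
import Mathlib

section
/- Let t > 0, let φ : ℝ^d → ℝ be bounded measurable, and let X_0, X_t be random vectors in ℝ^d defined on the same probability space such that ‖X_t − X_0‖ is (essentially) bounded. Then the sum Σ_{|α| > 0} (1/α!) E[|(X_t − X_0)^α ∂^α P_t φ(X_0)|] is finite and E[P_t φ(X_t) − P_t φ(X_0)] = Σ_{|α| > 0} (1/α!) E[ E[(X_t − X_0)^α | X_0] · ∂^α P_t φ(X_0) ], where the sum runs over all multi-indices α ∈ ℕ^d with |α| ≥ 1. -/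
open MeasureTheory ProbabilityTheory Real
open scoped ENNReal NNReal BigOperators Topology Classical

noncomputable section

/-- `ℝ^d` with the Euclidean norm. -/
abbrev Euc (d : ℕ) := EuclideanSpace ℝ (Fin d)

/-- The standard Gaussian measure on `ℝ^d`. -/
def stdGaussian (d : ℕ) : Measure (Euc d) :=
  volume.withDensity fun x =>
    ENNReal.ofReal ((2 * Real.pi) ^ (-(d : ℝ) / 2) * Real.exp (-‖x‖ ^ 2 / 2))

/-- The Wasserstein distance of order `p` between two measures, valued in `ℝ≥0∞`. -/
def wassersteinDist {E : Type*} [NormedAddCommGroup E] [MeasurableSpace E]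
    (p : ℝ) (μ ν : Measure E) : ℝ≥0∞ :=
  ⨅ (cpl : Measure (E × E)) (_ : IsProbabilityMeasure cpl)
    (_ : cpl.map Prod.fst = μ) (_ : cpl.map Prod.snd = ν),
    (∫⁻ q, ENNReal.ofReal (‖q.1 - q.2‖ ^ p) ∂cpl) ^ (1 / p)

/-- Degree `|α|` of a multi-index. -/
def mdeg {d : ℕ} (α : Fin d → ℕ) : ℕ := ∑ i, α i

/-- Factorial `α!` of a multi-index. -/
def mfact {d : ℕ} (α : Fin d → ℕ) : ℕ := ∏ i, (α i).factorial

/-- Monomial `x^α`. -/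
def monoE {d : ℕ} (α : Fin d → ℕ) (x : Euc d) : ℝ := ∏ i, x i ^ α i

/-- The family indexed by multi-indices of degree 2 associated with the identity matrix. -/
def idFam {d : ℕ} (α : Fin d → ℕ) : ℝ := if ∃ i : Fin d, α = Pi.single i 2 then 1 else 0

/-- Partial derivative in the `i`-th coordinate direction. -/
def pderivE {d : ℕ} (i : Fin d) (f : Euc d → ℝ) : Euc d → ℝ :=
  fun x => fderiv ℝ f x (EuclideanSpace.single i 1)

/-- Iterated partial derivative `∂^α`. -/
def mderivE {d : ℕ} (α : Fin d → ℕ) (f : Euc d → ℝ) : Euc d → ℝ :=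
  ((List.ofFn fun i : Fin d => (pderivE i)^[α i]).foldr (· ∘ ·) id) f

/-- `∂^α` applied componentwise to a vector field. -/
def mderivVec {d : ℕ} (α : Fin d → ℕ) (g : Euc d → Euc d) (x : Euc d) : Euc d :=
  (EuclideanSpace.equiv (Fin d) ℝ).symm fun i => mderivE α (fun y => g y i) x

/-- The Ornstein-Uhlenbeck semigroup `P_t`. -/
def OU {d : ℕ} (t : ℝ) (φ : Euc d → ℝ) (x : Euc d) : ℝ :=
  ∫ y, φ (Real.exp (-t) • x + Real.sqrt (1 - Real.exp (-2 * t)) • y) ∂(stdGaussian d)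

/-- The Ornstein-Uhlenbeck semigroup acting componentwise on a vector field. -/
def OUvec {d : ℕ} (t : ℝ) (g : Euc d → Euc d) (x : Euc d) : Euc d :=
  ∫ y, g (Real.exp (-t) • x + Real.sqrt (1 - Real.exp (-2 * t)) • y) ∂(stdGaussian d)

/-- The `k`-th probabilists' Hermite polynomial, as a function `ℝ → ℝ`. -/
def hermiteR (k : ℕ) (x : ℝ) : ℝ := Polynomial.aeval x (Polynomial.hermite k)

/-- The multivariate Hermite polynomial `H_α`. -/
def hermiteM {d : ℕ} (α : Fin d → ℕ) (x : Euc d) : ℝ := ∏ i, hermiteR (α i) (x i)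

/-- The Hilbert–Schmidt norm of the matrix `E[Y Yᵀ]`. -/
def covHS {Ω : Type*} [MeasurableSpace Ω] {d : ℕ} (P : Measure Ω) (Y : Ω → Euc d) : ℝ :=
  Real.sqrt (∑ k, ∑ l, (∫ ω, Y ω k * Y ω l ∂P) ^ 2)

/-- The Hilbert–Schmidt norm of the matrix `E[Y Yᵀ ‖Y‖^l]`. -/
def covHSw {Ω : Type*} [MeasurableSpace Ω] {d : ℕ} (P : Measure Ω) (Y : Ω → Euc d) (l : ℝ) : ℝ :=
  Real.sqrt (∑ k, ∑ k', (∫ ω, Y ω k * Y ω k' * ‖Y ω‖ ^ l ∂P) ^ 2)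


lemma hasSum_prod_pi {n : ℕ} (f : Fin n → ℕ → ℝ) (s : Fin n → ℝ)
    (hf : ∀ i, Summable fun k => ‖f i k‖) (hs : ∀ i, HasSum (f i) (s i)) :
    (Summable fun α : Fin n → ℕ => ‖∏ i, f i (α i)‖) ∧
      HasSum (fun α : Fin n → ℕ => ∏ i, f i (α i)) (∏ i, s i) := by
  induction n with
  | zero => exact ⟨(hasSum_fintype _).summable, by simp⟩
  | succ n ih =>
    obtain ⟨h1, h2⟩ := ih (fun i => f i.succ) (fun i => s i.succ) (fun i => hf _) (fun i => hs _)
    have hsum := summable_mul_of_summable_norm (hf 0) h1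
    have hsum' := Summable.mul_of_nonneg (hf 0) h1 (fun _ => norm_nonneg _) (fun _ => norm_nonneg _)
    have hmul := (hs 0).mul h2 hsum
    constructor
    · rw [← (Fin.consEquiv (fun _ : Fin (n + 1) => ℕ)).summable_iff]
      refine hsum'.congr fun x => ?_
      simp [Fin.consEquiv, Fin.prod_univ_succ]
    · rw [← (Fin.consEquiv (fun _ : Fin (n + 1) => ℕ)).hasSum_iff, Fin.prod_univ_succ]
      convert! hmul using 2 with x
      simp [Fin.consEquiv, Fin.prod_univ_succ]

/-- Power series coefficients of `w ↦ exp (c * w ^ 2)`. -/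
def expSqCoeff (c : ℝ) (k : ℕ) : ℝ := if Even k then c ^ (k / 2) / (k / 2).factorial else 0

lemma hasSum_expSqCoeff (c w : ℝ) :
    HasSum (fun k => expSqCoeff c k * w ^ k) (Real.exp (c * w ^ 2)) := by
  have he : HasSum (fun k : ℕ => (c * w ^ 2) ^ k / k.factorial) (Real.exp (c * w ^ 2)) := by
    rw [Real.exp_eq_exp_ℝ]
    exact NormedSpace.expSeries_div_hasSum_exp _
  have := HasSum.even_add_odd (f := fun k => expSqCoeff c k * w ^ k) (m := Real.exp (c * w ^ 2))
    (m' := 0) (by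
      convert! he using 2 with k
      simp [expSqCoeff, mul_pow, pow_mul]
      ring) (by simp [expSqCoeff])
  simpa using this

lemma abs_expSqCoeff (c : ℝ) (k : ℕ) : |expSqCoeff c k| = expSqCoeff |c| k := by
  unfold expSqCoeff
  split_ifs <;> simp [abs_div]

/-- Power series coefficients of `w ↦ exp (z * w + c * w ^ 2)`. -/
def expQuadCoeff (c z : ℝ) (k : ℕ) : ℝ :=
  ∑ kl ∈ Finset.HasAntidiagonal.antidiagonal k, z ^ kl.1 / kl.1.factorial * expSqCoeff c kl.2

lemma hasSum_expQuadCoeff (c z w : ℝ) :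
    HasSum (fun k => expQuadCoeff c z k * w ^ k) (Real.exp (z * w + c * w ^ 2)) := by
  have he : HasSum (fun k : ℕ => (z * w) ^ k / k.factorial) (Real.exp (z * w)) := by
    rw [Real.exp_eq_exp_ℝ]
    exact NormedSpace.expSeries_div_hasSum_exp _
  have hn := he.summable.norm
  have hn' := (hasSum_expSqCoeff c w).summable.norm
  have h1 := (summable_norm_sum_mul_antidiagonal_of_summable_norm hn hn').of_norm.hasSum
  rw [← tsum_mul_tsum_eq_tsum_sum_antidiagonal_of_summable_norm hn hn', he.tsum_eq,
    (hasSum_expSqCoeff c w).tsum_eq, ← Real.exp_add] at h1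
  convert! h1 using 2 with k
  rw [expQuadCoeff, Finset.sum_mul]
  refine Finset.sum_congr rfl fun kl hkl => ?_
  rw [← Finset.HasAntidiagonal.mem_antidiagonal.1 hkl, pow_add, mul_pow]
  ring

lemma abs_expQuadCoeff_le (c z : ℝ) (k : ℕ) : |expQuadCoeff c z k| ≤ expQuadCoeff |c| |z| k := by
  unfold expQuadCoeff
  refine (Finset.abs_sum_le_sum_abs _ _).trans (le_of_eq ?_)
  refine Finset.sum_congr rfl fun kl _ => ?_
  rw [abs_mul, abs_expSqCoeff, abs_div, abs_pow, Nat.abs_cast]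

lemma continuous_expQuadCoeff (c : ℝ) (k : ℕ) : Continuous fun z => expQuadCoeff c z k := by
  unfold expQuadCoeff
  fun_prop

/-- `f` is the sum of the everywhere absolutely convergent power series `∑ c_α h^α / α!`. -/
def HasExpSeries {d : ℕ} (c : (Fin d → ℕ) → ℝ) (f : Euc d → ℝ) : Prop :=
  (∀ R : ℝ, 0 ≤ R → Summable fun α => |c α / mfact α| * R ^ mdeg α) ∧
    ∀ h, HasSum (fun α => c α / mfact α * monoE α h) (f h)

lemma abs_coord_le {d : ℕ} (x : Euc d) (i : Fin d) : |x i| ≤ ‖x‖ := by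
  simpa using PiLp.norm_apply_le x i

lemma abs_monoE_le {d : ℕ} (α : Fin d → ℕ) (x : Euc d) {R : ℝ} (hx : ‖x‖ ≤ R) :
    |monoE α x| ≤ R ^ mdeg α := by
  unfold monoE mdeg
  rw [Finset.abs_prod, ← Finset.prod_pow_eq_pow_sum]
  refine Finset.prod_le_prod (fun _ _ => abs_nonneg _) fun i _ => ?_
  rw [abs_pow]
  exact pow_le_pow_left₀ (abs_nonneg _) ((abs_coord_le x i).trans hx) _

lemma mdeg_add_single {d : ℕ} (α : Fin d → ℕ) (i : Fin d) :
    mdeg (α + Pi.single i 1) = mdeg α + 1 := by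
  simp [mdeg, Finset.sum_add_distrib]

lemma mfact_add_single {d : ℕ} (α : Fin d → ℕ) (i : Fin d) :
    mfact (α + Pi.single i 1) = (α i + 1) * mfact α := by
  unfold mfact
  rw [← Finset.mul_prod_erase _ _ (Finset.mem_univ i),
    ← Finset.mul_prod_erase _ (fun j => (α j).factorial) (Finset.mem_univ i), ← mul_assoc]
  congr 1
  · simp [Nat.factorial_succ]
  · refine Finset.prod_congr rfl fun j hj => ?_
    simp [Finset.ne_of_mem_erase hj]

lemma mfact_pos {d : ℕ} (α : Fin d → ℕ) : 0 < mfact α :=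
  Finset.prod_pos fun _ _ => Nat.factorial_pos _

/-- The gradient of the monomial `x^α`, as a continuous linear form. -/
def gradMono {d : ℕ} (α : Fin d → ℕ) (x : Euc d) : Euc d →L[ℝ] ℝ :=
  ∑ i, (∏ j ∈ Finset.univ.erase i, x j ^ α j) •
    (((α i : ℝ) * x i ^ (α i - 1)) • EuclideanSpace.proj i)

lemma hasFDerivAt_monoE {d : ℕ} (α : Fin d → ℕ) (x : Euc d) :
    HasFDerivAt (monoE α) (gradMono α x) x := by
  have := HasFDerivAt.finsetProd (𝕜 := ℝ) (u := Finset.univ) (g := fun i (x : Euc d) => x i ^ α i)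
    (g' := fun i => ((α i : ℝ) * x i ^ (α i - 1)) • EuclideanSpace.proj i) (x := x)
    (fun i _ => by
      simpa using ((EuclideanSpace.proj i : Euc d →L[ℝ] ℝ).hasFDerivAt (x := x)).pow (α i))
  simpa [gradMono] using! this

lemma norm_gradMono_le {d : ℕ} (α : Fin d → ℕ) (x : Euc d) {R : ℝ} (hR : 1 ≤ R) (hx : ‖x‖ ≤ R) :
    ‖gradMono α x‖ ≤ (2 * R) ^ mdeg α := by
  have h0 : 0 ≤ R := by linarith
  have key : ∀ i, ‖(∏ j ∈ Finset.univ.erase i, x j ^ α j) •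
      (((α i : ℝ) * x i ^ (α i - 1)) • (EuclideanSpace.proj i : Euc d →L[ℝ] ℝ))‖ ≤ α i * R ^ mdeg α := by
    intro i
    have hp : ‖(EuclideanSpace.proj i : Euc d →L[ℝ] ℝ)‖ ≤ 1 :=
      ContinuousLinearMap.opNorm_le_bound _ zero_le_one fun y => by
        simpa using abs_coord_le y i
    have h1 : |∏ j ∈ Finset.univ.erase i, x j ^ α j| ≤ ∏ j ∈ Finset.univ.erase i, R ^ α j := by
      rw [Finset.abs_prod]
      refine Finset.prod_le_prod (fun _ _ => abs_nonneg _) fun j _ => ?_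
      rw [abs_pow]
      exact pow_le_pow_left₀ (abs_nonneg _) ((abs_coord_le x j).trans hx) _
    have h2 : |x i ^ (α i - 1)| ≤ R ^ α i := by
      rw [abs_pow]
      exact (pow_le_pow_left₀ (abs_nonneg _) ((abs_coord_le x i).trans hx) _).trans
        (pow_le_pow_right₀ hR (Nat.sub_le _ _))
    rw [norm_smul, norm_smul, norm_mul, Real.norm_eq_abs, Real.norm_eq_abs, Real.norm_eq_abs,
      Nat.abs_cast]
    calc _ ≤ (∏ j ∈ Finset.univ.erase i, R ^ α j) * ((α i * R ^ α i) * 1) := by gcongr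
      _ = α i * (R ^ α i * ∏ j ∈ Finset.univ.erase i, R ^ α j) := by ring
      _ = α i * R ^ mdeg α := by
        rw [Finset.mul_prod_erase _ (fun j => R ^ α j) (Finset.mem_univ i),
          Finset.prod_pow_eq_pow_sum, mdeg]
  calc ‖gradMono α x‖ ≤ ∑ i, (α i : ℝ) * R ^ mdeg α := norm_sum_le_of_le _ fun i _ => key i
    _ = (mdeg α : ℝ) * R ^ mdeg α := by rw [← Finset.sum_mul, mdeg]; push_cast; rfl
    _ ≤ 2 ^ mdeg α * R ^ mdeg α := by
      gcongr
      exact_mod_cast Nat.lt_two_pow_self.le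
    _ = (2 * R) ^ mdeg α := (mul_pow _ _ _).symm

lemma gradMono_single {d : ℕ} (α : Fin d → ℕ) (x : Euc d) (i : Fin d) :
    gradMono α x (EuclideanSpace.single i 1) =
      (∏ j ∈ Finset.univ.erase i, x j ^ α j) * ((α i : ℝ) * x i ^ (α i - 1)) := by
  simp only [gradMono, sum_apply, smul_apply]
  rw [Finset.sum_eq_single i]
  · simp
  · intro j _ hj
    simp [hj]
  · simp

lemma gradMono_add_single {d : ℕ} (α : Fin d → ℕ) (x : Euc d) (i : Fin d) :
    gradMono (α + Pi.single i 1) x (EuclideanSpace.single i 1) = (α i + 1) * monoE α x := by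
  rw [gradMono_single, monoE, ← Finset.mul_prod_erase _ _ (Finset.mem_univ i)]
  have : ∏ j ∈ Finset.univ.erase i, x j ^ ((α + Pi.single i 1 : Fin d → ℕ) j)
      = ∏ j ∈ Finset.univ.erase i, x j ^ α j :=
    Finset.prod_congr rfl fun j hj => by simp [Finset.ne_of_mem_erase hj]
  rw [this]
  simp
  ring

lemma HasExpSeries.pderivE {d : ℕ} {c : (Fin d → ℕ) → ℝ} {f : Euc d → ℝ} (hf : HasExpSeries c f)
    (i : Fin d) : HasExpSeries (fun α => c (α + Pi.single i 1)) (pderivE i f) := by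
  have hinj : Function.Injective fun α : Fin d → ℕ => α + Pi.single i 1 := add_left_injective _
  have hcoef : ∀ α, c (α + Pi.single i 1) / mfact α =
      c (α + Pi.single i 1) / mfact (α + Pi.single i 1) * (α i + 1) := by
    intro α
    have : (mfact α : ℝ) ≠ 0 := by exact_mod_cast (mfact_pos α).ne'
    have h' : (α i + 1 : ℝ) ≠ 0 := by positivity
    rw [mfact_add_single]
    push_cast
    field_simp
  refine ⟨fun R hR => ?_, fun h => ?_⟩
  · have h1 := (hf.1 (2 * (R + 1)) (by positivity)).comp_injective hinj
    refine h1.of_nonneg_of_le (fun α => by positivity) fun α => ?_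
    simp only [Function.comp_apply]
    rw [hcoef, abs_mul, mul_assoc]
    gcongr
    rw [abs_of_nonneg (by positivity), mul_pow]
    have hle : α i + 1 ≤ mdeg (α + Pi.single i 1) := by
      rw [mdeg_add_single]
      exact Nat.add_le_add_right
        (Finset.single_le_sum (f := α) (fun _ _ => Nat.zero_le _) (Finset.mem_univ i)) 1
    have h2 : (α i + 1 : ℝ) ≤ 2 ^ mdeg (α + Pi.single i 1) := by
      exact_mod_cast hle.trans Nat.lt_two_pow_self.le
    gcongr
    rw [mdeg_add_single]
    exact (pow_le_pow_left₀ hR (by linarith) _).trans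
      (pow_le_pow_right₀ (by linarith) (Nat.le_succ _))
  · have hder : HasFDerivAt (fun y => ∑' α, c α / mfact α * monoE α y)
        (∑' α, (c α / mfact α) • gradMono α h) h := by
      refine hasFDerivAt_tsum_of_isPreconnected (s := Metric.ball 0 (‖h‖ + 1))
        (hf.1 (2 * (‖h‖ + 1)) (by positivity)) Metric.isOpen_ball
        (convex_ball _ _).isPreconnected (x₀ := h)
        (fun α y _ => (hasFDerivAt_monoE α y).const_mul _) (fun α y hy => ?_) ?_ (hf.2 h).summable ?_
      · rw [norm_smul, Real.norm_eq_abs]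
        gcongr
        exact norm_gradMono_le _ _ (by linarith [norm_nonneg h])
          (by simpa using (mem_ball_zero_iff.1 hy).le)
      · simp
      · simp
    have hfe : f = fun y => ∑' α, c α / mfact α * monoE α y :=
      funext fun y => (hf.2 y).tsum_eq.symm
    have hsumm : Summable fun α => (c α / mfact α) • gradMono α h := by
      refine Summable.of_norm_bounded (hf.1 (2 * (‖h‖ + 1)) (by positivity)) fun α => ?_
      rw [norm_smul, Real.norm_eq_abs]
      gcongr
      exact norm_gradMono_le _ _ (by linarith [norm_nonneg h]) (by linarith)
    have h3 : HasSum (fun α => c α / mfact α * gradMono α h (EuclideanSpace.single i 1))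
        (_root_.pderivE i f h) := by
      unfold _root_.pderivE
      rw [hfe, hder.fderiv]
      simpa using! hsumm.hasSum.mapL (ContinuousLinearMap.apply ℝ ℝ (EuclideanSpace.single i (1 : ℝ)))
    rw [← hinj.hasSum_iff] at h3
    · convert! h3 using 2 with α
      simp only [Function.comp_apply]
      rw [hcoef, gradMono_add_single]
      ring
    · intro α hα
      have : α i = 0 := by
        by_contra hne
        refine hα ⟨α - Pi.single i 1, ?_⟩
        funext j
        rcases eq_or_ne j i with rfl | hj
        · simp; omega
        · simp [hj]
      simp [gradMono_single, this]

lemma HasExpSeries.iterate_pderivE {d : ℕ} {c : (Fin d → ℕ) → ℝ} {f : Euc d → ℝ}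
    (hf : HasExpSeries c f) (i : Fin d) (k : ℕ) :
    HasExpSeries (fun α => c (α + Pi.single i k)) ((_root_.pderivE i)^[k] f) := by
  induction k with
  | zero => simpa using hf
  | succ k ih =>
    rw [Function.iterate_succ_apply']
    convert! ih.pderivE i using 3 with α
    rw [add_assoc, ← Pi.single_add, add_comm 1 k]

lemma HasExpSeries.mderivE {d : ℕ} {c : (Fin d → ℕ) → ℝ} {f : Euc d → ℝ}
    (hf : HasExpSeries c f) (β : Fin d → ℕ) :
    HasExpSeries (fun α => c (α + β)) (mderivE β f) := by
  have key : ∀ l : List (Fin d), HasExpSeries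
      (fun α => c (α + (l.map fun i => Pi.single i (β i)).sum))
      ((l.map fun i => (_root_.pderivE i)^[β i]).foldr (· ∘ ·) id f) := by
    intro l
    induction l with
    | nil => simpa using hf
    | cons i l ih =>
      have := ih.iterate_pderivE i (β i)
      simpa [add_assoc] using this
  have h := key (List.finRange d)
  rw [← List.ofFn_eq_map, ← List.ofFn_eq_map, List.sum_ofFn, Finset.univ_sum_single] at h
  exact h

lemma HasExpSeries.apply_zero {d : ℕ} {c : (Fin d → ℕ) → ℝ} {f : Euc d → ℝ}
    (hf : HasExpSeries c f) : f 0 = c 0 := by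
  refine (hf.2 0).unique ?_
  convert! hasSum_single (f := fun α => c α / mfact α * monoE α (0 : Euc d)) 0 ?_ using 1
  · simp [mfact, monoE]
  · intro α hα
    obtain ⟨i, hi⟩ := Function.ne_iff.1 hα
    have : monoE α (0 : Euc d) = 0 := Finset.prod_eq_zero (Finset.mem_univ i) (by simpa using hi)
    simp [this]

lemma pderivE_comp_add {d : ℕ} (i : Fin d) (f : Euc d → ℝ) (x : Euc d) :
    pderivE i (fun h => f (x + h)) = fun h => pderivE i f (x + h) := by
  funext h
  simp only [pderivE, fderiv_comp_add_left]

lemma iterate_pderivE_comp_add {d : ℕ} (i : Fin d) (k : ℕ) (f : Euc d → ℝ) (x : Euc d) :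
    (pderivE i)^[k] (fun h => f (x + h)) = fun h => (pderivE i)^[k] f (x + h) := by
  induction k with
  | zero => rfl
  | succ k ih => rw [Function.iterate_succ_apply', Function.iterate_succ_apply', ih, pderivE_comp_add]

lemma mderivE_comp_add {d : ℕ} (β : Fin d → ℕ) (f : Euc d → ℝ) (x : Euc d) :
    mderivE β (fun h => f (x + h)) = fun h => mderivE β f (x + h) := by
  unfold mderivE
  rw [List.ofFn_eq_map]
  induction List.finRange d with
  | nil => rfl
  | cons i l ih =>
    simp only [List.map_cons, List.foldr_cons, Function.comp_apply]
    rw [ih, iterate_pderivE_comp_add]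


lemma HasExpSeries.mderivE_eq {d : ℕ} {c : (Fin d → ℕ) → ℝ} {f : Euc d → ℝ} {x : Euc d}
    (hf : HasExpSeries c fun h => f (x + h)) (β : Fin d → ℕ) : _root_.mderivE β f x = c β := by
  have h := (hf.mderivE β).apply_zero
  rw [mderivE_comp_add] at h
  simpa using h

/-- The density of the standard Gaussian measure on `ℝ^d`. -/
def gaussDensity (d : ℕ) (x : Euc d) : ℝ :=
  (2 * Real.pi) ^ (-(d : ℝ) / 2) * Real.exp (-‖x‖ ^ 2 / 2)

lemma gaussDensity_nonneg {d : ℕ} (x : Euc d) : 0 ≤ gaussDensity d x := by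
  unfold gaussDensity
  positivity

lemma continuous_gaussDensity (d : ℕ) : Continuous (gaussDensity d) := by
  unfold gaussDensity
  fun_prop

lemma integral_stdGaussian {d : ℕ} (g : Euc d → ℝ) :
    ∫ y, g y ∂(stdGaussian d) = ∫ y, gaussDensity d y * g y := by
  have hd : _root_.stdGaussian d =
      volume.withDensity fun x => ENNReal.ofReal (gaussDensity d x) := rfl
  rw [hd, integral_withDensity_eq_integral_toReal_smul
    (continuous_gaussDensity d).measurable.ennreal_ofReal
    (Filter.Eventually.of_forall fun _ => ENNReal.ofReal_lt_top)]
  refine integral_congr_ae (Filter.Eventually.of_forall fun y => ?_)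
  have := gaussDensity_nonneg y
  simp only [smul_eq_mul]
  rw [ENNReal.toReal_ofReal this]

lemma gaussDensity_sub {d : ℕ} (y w : Euc d) :
    gaussDensity d (y - w) = gaussDensity d y * ∏ i, Real.exp (y i * w i + -1 / 2 * w i ^ 2) := by
  unfold gaussDensity
  rw [← Real.exp_sum, mul_assoc, ← Real.exp_add]
  congr 2
  rw [EuclideanSpace.real_norm_sq_eq, EuclideanSpace.real_norm_sq_eq, ← Finset.sum_neg_distrib,
    ← Finset.sum_neg_distrib, Finset.sum_div, Finset.sum_div, ← Finset.sum_add_distrib]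
  refine Finset.sum_congr rfl fun i _ => ?_
  simp
  ring

lemma integrable_gaussDensity_mul_exp {d : ℕ} (R : ℝ) :
    Integrable fun y : Euc d =>
      gaussDensity d y * ∏ i, Real.exp (|y i| * R + 1 / 2 * R ^ 2) := by
  have h4 : Integrable fun y : Euc d => Real.exp (-(1 / 4) * ‖y‖ ^ 2) := by
    have := (GaussianFourier.integrable_cexp_neg_mul_sq_norm_add (V := Euc d) (b := 1 / 4)
      (by norm_num) 0 0).norm
    convert! this using 2 with y
    rw [Complex.norm_exp]
    congr 1
    have : (-(1 / 4) * (‖y‖ : ℂ) ^ 2 + 0 * ((inner ℝ (0 : Euc d) y : ℝ) : ℂ)) =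
        ((-(1 / 4) * ‖y‖ ^ 2 : ℝ) : ℂ) := by
      push_cast; ring
    rw [this, Complex.ofReal_re]
  refine (h4.const_mul ((2 * Real.pi) ^ (-(d : ℝ) / 2) * Real.exp (d * (3 / 2 * R ^ 2)))).mono' ?_ ?_
  · refine Continuous.aestronglyMeasurable ?_
    have := continuous_gaussDensity d
    fun_prop
  · refine Filter.Eventually.of_forall fun y => ?_
    have hp : 0 ≤ ∏ i, Real.exp (|y i| * R + 1 / 2 * R ^ 2) :=
      Finset.prod_nonneg fun _ _ => (Real.exp_pos _).le
    rw [Real.norm_of_nonneg (mul_nonneg (gaussDensity_nonneg y) hp), gaussDensity,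
      ← Real.exp_sum, mul_assoc, mul_assoc, ← Real.exp_add, ← Real.exp_add]
    refine mul_le_mul_of_nonneg_left (Real.exp_le_exp.2 ?_) (by positivity)
    have hs : ∑ i, (|y i| * R + 1 / 2 * R ^ 2) ≤ ∑ i : Fin d, (3 / 2 * R ^ 2 + y i ^ 2 / 4) := by
      refine Finset.sum_le_sum fun i _ => ?_
      nlinarith [sq_nonneg (|y i| / 2 - R), sq_abs (y i)]
    rw [Finset.sum_add_distrib (f := fun _ => 3 / 2 * R ^ 2), ← Finset.sum_div,
      ← EuclideanSpace.real_norm_sq_eq] at hs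
    simp at hs ⊢
    linarith

/-- The coefficient of `w^α` in the expansion of `gaussDensity d (y - w)`, divided by
`gaussDensity d y`. -/
def gaussCoeff {d : ℕ} (c : ℝ) (α : Fin d → ℕ) (y : Fin d → ℝ) : ℝ :=
  ∏ i, expQuadCoeff c (y i) (α i)

lemma continuous_gaussCoeff {d : ℕ} (c : ℝ) (α : Fin d → ℕ) : Continuous (gaussCoeff c α) := by
  unfold gaussCoeff
  exact continuous_finsetProd _ fun i _ => (continuous_expQuadCoeff c (α i)).comp (continuous_apply i)

lemma expQuadCoeff_nonneg {c z : ℝ} (hc : 0 ≤ c) (hz : 0 ≤ z) (k : ℕ) : 0 ≤ expQuadCoeff c z k := by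
  have := abs_expQuadCoeff_le c z k
  rw [abs_of_nonneg hc, abs_of_nonneg hz] at this
  exact (abs_nonneg _).trans this

lemma hasSum_gaussCoeff {d : ℕ} (c : ℝ) (y w : Fin d → ℝ) :
    HasSum (fun α => gaussCoeff c α y * ∏ i, w i ^ α i)
      (∏ i, Real.exp (y i * w i + c * w i ^ 2)) := by
  have h := (hasSum_prod_pi (fun i k => expQuadCoeff c (y i) k * w i ^ k)
    (fun i => Real.exp (y i * w i + c * w i ^ 2))
    (fun i => (hasSum_expQuadCoeff c (y i) (w i)).summable.norm)
    (fun i => hasSum_expQuadCoeff c (y i) (w i))).2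
  simpa only [gaussCoeff, Finset.prod_mul_distrib] using h

/-- A majorant of `|gaussDensity d y * gaussCoeff (-1 / 2) α y|`. -/
def gaussMajorant {d : ℕ} (α : Fin d → ℕ) (y : Euc d) : ℝ :=
  gaussDensity d y * gaussCoeff (1 / 2) α fun i => |y i|

lemma gaussMajorant_nonneg {d : ℕ} (α : Fin d → ℕ) (y : Euc d) : 0 ≤ gaussMajorant α y :=
  mul_nonneg (gaussDensity_nonneg y)
    (Finset.prod_nonneg fun _ _ => expQuadCoeff_nonneg (by norm_num) (abs_nonneg _) _)

lemma abs_gaussDensity_mul_gaussCoeff_le {d : ℕ} (α : Fin d → ℕ) (y : Euc d) :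
    |gaussDensity d y * gaussCoeff (-1 / 2) α y| ≤ gaussMajorant α y := by
  rw [abs_mul, abs_of_nonneg (gaussDensity_nonneg y), gaussMajorant, gaussCoeff, Finset.abs_prod]
  refine mul_le_mul_of_nonneg_left
    (Finset.prod_le_prod (fun _ _ => abs_nonneg _) fun i _ => ?_) (gaussDensity_nonneg y)
  have h : |(-1 / 2 : ℝ)| = 1 / 2 := by norm_num [abs_div]
  simpa only [h] using abs_expQuadCoeff_le (-1 / 2) (y i) (α i)

lemma hasSum_gaussMajorant {d : ℕ} (R : ℝ) (y : Euc d) :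
    HasSum (fun α => gaussMajorant α y * R ^ mdeg α)
      (gaussDensity d y * ∏ i, Real.exp (|y i| * R + 1 / 2 * R ^ 2)) := by
  have := (hasSum_gaussCoeff (1 / 2) (fun i => |y i|) (fun _ : Fin d => R)).mul_left
    (gaussDensity d y)
  simpa only [gaussMajorant, mdeg, Finset.prod_pow_eq_pow_sum, mul_assoc] using this

lemma integrable_gaussMajorant {d : ℕ} (α : Fin d → ℕ) : Integrable (gaussMajorant α) := by
  refine (integrable_gaussDensity_mul_exp 1).mono' ?_ (Filter.Eventually.of_forall fun y => ?_)
  · refine Continuous.aestronglyMeasurable ((continuous_gaussDensity d).mul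
      ((continuous_gaussCoeff _ _).comp ?_))
    fun_prop
  · rw [Real.norm_of_nonneg (gaussMajorant_nonneg α y)]
    simpa using le_hasSum (hasSum_gaussMajorant 1 y) α fun β _ => by
      simpa using gaussMajorant_nonneg β y

lemma summable_integral_gaussMajorant {d : ℕ} {R : ℝ} (hR : 0 ≤ R) :
    Summable fun α : Fin d → ℕ => (∫ y, gaussMajorant α y) * R ^ mdeg α := by
  refine summable_of_sum_le (c := ∫ y : Euc d,
    gaussDensity d y * ∏ i, Real.exp (|y i| * R + 1 / 2 * R ^ 2))
    (fun α => mul_nonneg (integral_nonneg (gaussMajorant_nonneg α)) (by positivity)) fun u => ?_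
  simp_rw [← integral_mul_const]
  rw [← integral_finsetSum _ fun α _ => (integrable_gaussMajorant α).mul_const _]
  refine integral_mono (integrable_finsetSum _ fun α _ => (integrable_gaussMajorant α).mul_const _)
    (integrable_gaussDensity_mul_exp R) fun y => ?_
  exact sum_le_hasSum u (fun α _ => mul_nonneg (gaussMajorant_nonneg α y) (by positivity))
    (hasSum_gaussMajorant R y)

lemma monoE_smul {d : ℕ} (α : Fin d → ℕ) (a : ℝ) (h : Euc d) :
    monoE α (a • h) = a ^ mdeg α * monoE α h := by
  simp [monoE, mdeg, mul_pow, Finset.prod_mul_distrib, Finset.prod_pow_eq_pow_sum]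

/-- Expansion of a Gaussian smoothing in the translation parameter. -/
lemma hasSum_integral_gaussCoeff {d : ℕ} {g : Euc d → ℝ} (hg : Measurable g) {C : ℝ}
    (hC : ∀ y, |g y| ≤ C) (w : Euc d) :
    HasSum (fun α => (∫ y : Euc d, gaussDensity d y * gaussCoeff (-1 / 2) α y * g y) * monoE α w)
      (∫ y, gaussDensity d y * g (y + w)) := by
  have hC0 : 0 ≤ C := (abs_nonneg _).trans (hC 0)
  have hb : ∀ α y, ‖gaussDensity d y * gaussCoeff (-1 / 2) α y * g y‖ ≤ gaussMajorant α y * C := by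
    intro α y
    rw [norm_mul]
    exact mul_le_mul (abs_gaussDensity_mul_gaussCoeff_le α y) (hC y) (norm_nonneg _)
      (gaussMajorant_nonneg α y)
  have hint : ∀ α, Integrable fun y : Euc d => gaussDensity d y * gaussCoeff (-1 / 2) α y * g y := by
    intro α
    refine ((integrable_gaussMajorant α).mul_const C).mono' ?_ (Filter.Eventually.of_forall (hb α))
    refine AEStronglyMeasurable.mul (Continuous.aestronglyMeasurable ?_) hg.aestronglyMeasurable
    exact (continuous_gaussDensity d).mul ((continuous_gaussCoeff _ _).comp (by fun_prop))
  have hsum : Summable fun α : Fin d → ℕ => ∫ y : Euc d,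
      ‖gaussDensity d y * gaussCoeff (-1 / 2) α y * g y * monoE α w‖ := by
    refine ((summable_integral_gaussMajorant (d := d) (norm_nonneg w)).mul_left C).of_nonneg_of_le
      (fun α => integral_nonneg fun _ => norm_nonneg _) fun α => ?_
    rw [← integral_mul_const, ← integral_const_mul]
    refine integral_mono ((hint α).mul_const _).norm
      (((integrable_gaussMajorant α).mul_const _).const_mul _) fun y => ?_
    simp only
    rw [norm_mul]
    calc _ ≤ (gaussMajorant α y * C) * ‖w‖ ^ mdeg α :=
          mul_le_mul (hb α y) (abs_monoE_le α w le_rfl) (abs_nonneg _)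
            (mul_nonneg (gaussMajorant_nonneg α y) hC0)
      _ = _ := by ring
  have h := hasSum_integral_of_summable_integral_norm (fun α => (hint α).mul_const (monoE α w)) hsum
  simp_rw [integral_mul_const] at h
  convert! h using 1
  rw [← integral_sub_right_eq_self _ w]
  refine integral_congr_ae (Filter.Eventually.of_forall fun y => ?_)
  simp only [sub_add_cancel]
  rw [gaussDensity_sub, ← (hasSum_gaussCoeff (-1 / 2) y w).tsum_eq, ← tsum_mul_left, ← tsum_mul_right]
  exact tsum_congr fun α => by rw [monoE]; ring

/-- Around every point `P_t φ` is the sum of a power series, with coefficients that are measurable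
in, and bounded uniformly over, the base point. -/
lemma exists_hasExpSeries_OU {d : ℕ} {t : ℝ} (ht : 0 < t) {φ : Euc d → ℝ} (hφm : Measurable φ)
    (hφb : ∃ C : ℝ, ∀ x, |φ x| ≤ C) :
    ∃ (c : (Fin d → ℕ) → Euc d → ℝ) (M : (Fin d → ℕ) → ℝ), (∀ α, Measurable (c α)) ∧
      (∀ α x, |c α x / mfact α| ≤ M α) ∧
      (∀ R, 0 ≤ R → Summable fun α => M α * R ^ mdeg α) ∧
      ∀ x, HasExpSeries (fun α => c α x) fun h => OU t φ (x + h) := by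
  obtain ⟨C, hC⟩ := hφb
  set s := Real.sqrt (1 - Real.exp (-2 * t))
  have hs0 : 0 < s := Real.sqrt_pos.2 (by simp [ht])
  set a := Real.exp (-t) / s with ha
  have ha0 : 0 < a := by positivity
  have hmeas : Measurable fun p : Euc d × Euc d => φ (Real.exp (-t) • p.1 + s • p.2) :=
    hφm.comp (by fun_prop)
  let b : (Fin d → ℕ) → Euc d → ℝ := fun α x => a ^ mdeg α *
    ∫ y : Euc d, gaussDensity d y * gaussCoeff (-1 / 2) α y * φ (Real.exp (-t) • x + s • y)
  have hbdiv : ∀ α x, mfact α * b α x / mfact α = b α x := fun α x =>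
    mul_div_cancel_left₀ _ (by exact_mod_cast (mfact_pos α).ne')
  have hM : ∀ α x, |b α x| ≤ C * a ^ mdeg α * ∫ y : Euc d, gaussMajorant α y := by
    intro α x
    rw [abs_mul, abs_of_nonneg (by positivity), mul_comm C, mul_assoc]
    gcongr
    rw [← integral_const_mul]
    rw [← Real.norm_eq_abs]
    refine norm_integral_le_of_norm_le ((integrable_gaussMajorant α).const_mul C)
      (Filter.Eventually.of_forall fun y => ?_)
    rw [norm_mul, mul_comm C]
    exact mul_le_mul (abs_gaussDensity_mul_gaussCoeff_le α y) (hC _) (norm_nonneg _)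
      (gaussMajorant_nonneg α y)
  have hMs : ∀ R, 0 ≤ R → Summable fun α : Fin d → ℕ =>
      C * a ^ mdeg α * (∫ y : Euc d, gaussMajorant α y) * R ^ mdeg α := by
    intro R hR
    refine ((summable_integral_gaussMajorant (d := d) (R := a * R) (by positivity)).mul_left C).congr
      fun α => ?_
    rw [mul_pow]
    ring
  refine ⟨fun α x => mfact α * b α x, fun α => C * a ^ mdeg α * ∫ y : Euc d, gaussMajorant α y,
    fun α => ?_, fun α x => ?_, hMs, fun x => ⟨fun R hR => ?_, fun h => ?_⟩⟩
  · refine Measurable.const_mul (Measurable.const_mul ?_ _) _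
    refine StronglyMeasurable.measurable (StronglyMeasurable.integral_prod_right
      (f := fun (x y : Euc d) => gaussDensity d y * gaussCoeff (-1 / 2) α y *
        φ (Real.exp (-t) • x + s • y)) (Measurable.stronglyMeasurable ?_))
    refine Measurable.mul (Continuous.measurable ?_) hmeas
    exact ((continuous_gaussDensity d).comp continuous_snd).mul
      ((continuous_gaussCoeff _ _).comp (by fun_prop))
  · rw [hbdiv]
    exact hM α x
  · refine (hMs R hR).of_nonneg_of_le (fun α => by positivity) fun α => ?_
    rw [hbdiv]
    gcongr
    exact hM α x
  · have := hasSum_integral_gaussCoeff (g := fun y => φ (Real.exp (-t) • x + s • y))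
      (hmeas.comp (by fun_prop : Measurable fun y : Euc d => (x, y))) (fun y => hC _) (a • h)
    convert! this using 1
    · funext α
      rw [hbdiv, monoE_smul]
      ring
    · simp only [OU]
      rw [integral_stdGaussian]
      refine integral_congr_ae (Filter.Eventually.of_forall fun y => ?_)
      have hsa : s * a = Real.exp (-t) := by rw [ha]; field_simp
      simp only
      rw [smul_add, smul_add, smul_smul, hsa, add_assoc, add_comm (s • y)]

lemma mdeg_pos_iff {d : ℕ} (α : Fin d → ℕ) : 0 < mdeg α ↔ α ≠ 0 := by
  rw [Nat.pos_iff_ne_zero, mdeg, Ne, Finset.sum_eq_zero_iff, Function.ne_iff]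
  simp

lemma measurable_monoE {d : ℕ} (α : Fin d → ℕ) : Measurable (monoE α) := by
  unfold monoE
  fun_prop

theorem taylor_expansion_OU
    {d : ℕ} {Ω : Type*} [MeasurableSpace Ω] (P : Measure Ω) [IsProbabilityMeasure P]
    (t : ℝ) (ht : 0 < t)
    (φ : Euc d → ℝ) (hφm : Measurable φ) (hφb : ∃ C : ℝ, ∀ x, |φ x| ≤ C)
    (X0 Xt : Ω → Euc d) (hX0 : Measurable X0) (hXt : Measurable Xt)
    (hbdd : ∃ B : ℝ, ∀ᵐ ω ∂P, ‖Xt ω - X0 ω‖ ≤ B) :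
    (∑' α : Fin d → ℕ, (if 0 < mdeg α then
        ENNReal.ofReal (1 / (mfact α : ℝ)) *
          ∫⁻ ω, ENNReal.ofReal |monoE α (Xt ω - X0 ω) * mderivE α (OU t φ) (X0 ω)| ∂P
      else 0)) < ⊤ ∧
    ∫ ω, (OU t φ (Xt ω) - OU t φ (X0 ω)) ∂P =
      ∑' α : Fin d → ℕ, if 0 < mdeg α then
        (1 / (mfact α : ℝ)) *
          ∫ ω, ((P[fun ω' => monoE α (Xt ω' - X0 ω') |
              MeasurableSpace.comap X0 inferInstance]) ω) *
            mderivE α (OU t φ) (X0 ω) ∂P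
      else 0 := by
  obtain ⟨c, M, hcm, hcM, hMs, hser⟩ := exists_hasExpSeries_OU ht hφm hφb
  have hder : ∀ α x, mderivE α (OU t φ) x = c α x := fun α x => (hser x).mderivE_eq α
  obtain ⟨B, hB⟩ : ∃ B : ℝ, 0 ≤ B ∧ ∀ᵐ ω ∂P, ‖Xt ω - X0 ω‖ ≤ B := by
    obtain ⟨B, hB⟩ := hbdd
    exact ⟨max B 0, le_max_right _ _, hB.mono fun ω h => h.trans (le_max_left _ _)⟩
  obtain ⟨hB0, hB⟩ := hB
  have hM0 : ∀ α, 0 ≤ M α := fun α => (abs_nonneg _).trans (hcM α 0)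
  have hf0 : ∀ α : Fin d → ℕ, (0 : ℝ) < mfact α := fun α => by exact_mod_cast mfact_pos α
  have hterm : ∀ α, ∀ᵐ ω ∂P, 1 / (mfact α : ℝ) *
      |monoE α (Xt ω - X0 ω) * c α (X0 ω)| ≤ M α * B ^ mdeg α := by
    intro α
    filter_upwards [hB] with ω hω
    rw [abs_mul]
    calc _ = |c α (X0 ω) / mfact α| * |monoE α (Xt ω - X0 ω)| := by
          rw [abs_div, abs_of_pos (hf0 α)]; ring
      _ ≤ M α * B ^ mdeg α :=
          mul_le_mul (hcM _ _) (abs_monoE_le α _ hω) (abs_nonneg _) (hM0 α)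
  have hmono : ∀ α : Fin d → ℕ, Integrable (fun ω => monoE α (Xt ω - X0 ω)) P := fun α =>
    Integrable.of_bound ((measurable_monoE α).comp (hXt.sub hX0)).aestronglyMeasurable
      (B ^ mdeg α) (hB.mono fun ω hω => abs_monoE_le α _ hω)
  have hprod : ∀ α : Fin d → ℕ, Integrable (fun ω => monoE α (Xt ω - X0 ω) * c α (X0 ω)) P := by
    intro α
    refine Integrable.of_bound (((measurable_monoE α).comp (hXt.sub hX0)).mul
      ((hcm α).comp hX0)).aestronglyMeasurable (mfact α * (M α * B ^ mdeg α)) ?_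
    filter_upwards [hterm α] with ω hω
    rw [one_div, inv_mul_le_iff₀ (hf0 α)] at hω
    exact hω
  simp only [hder]
  constructor
  · have hle : ∀ α : Fin d → ℕ, (if 0 < mdeg α then ENNReal.ofReal (1 / (mfact α : ℝ)) *
        ∫⁻ ω, ENNReal.ofReal |monoE α (Xt ω - X0 ω) * c α (X0 ω)| ∂P else 0) ≤
        ENNReal.ofReal (M α * B ^ mdeg α) := by
      intro α
      split_ifs
      · rw [← lintegral_const_mul' _ _ ENNReal.ofReal_ne_top]
        calc _ ≤ ∫⁻ _, ENNReal.ofReal (M α * B ^ mdeg α) ∂P := by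
              refine lintegral_mono_ae ((hterm α).mono fun ω hω => ?_)
              rw [← ENNReal.ofReal_mul (by positivity)]
              exact ENNReal.ofReal_le_ofReal hω
          _ = _ := by simp
      · exact zero_le
    refine (ENNReal.tsum_le_tsum hle).trans_lt ?_
    rw [← ENNReal.ofReal_tsum_of_nonneg (fun α => mul_nonneg (hM0 α) (by positivity)) (hMs B hB0)]
    exact ENNReal.ofReal_lt_top
  · let G : (Fin d → ℕ) → Ω → ℝ := fun α ω =>
      if 0 < mdeg α then 1 / (mfact α : ℝ) * (monoE α (Xt ω - X0 ω) * c α (X0 ω)) else 0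
    have hGint : ∀ α, Integrable (G α) P := by
      intro α
      by_cases h : 0 < mdeg α
      · simpa [G, h] using (hprod α).const_mul _
      · simp [G, h]
    have hGsum : Summable fun α => ∫ ω, ‖G α ω‖ ∂P := by
      refine (hMs B hB0).of_nonneg_of_le (fun α => integral_nonneg fun _ => norm_nonneg _) fun α => ?_
      have hb : ∀ᵐ ω ∂P, ‖G α ω‖ ≤ M α * B ^ mdeg α := by
        filter_upwards [hterm α] with ω hω
        by_cases h : 0 < mdeg α
        · simp only [G, h, if_true]
          rwa [norm_mul, Real.norm_of_nonneg (one_div_pos.2 (hf0 α)).le]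
        · simp only [G, h, if_false, norm_zero]
          exact mul_nonneg (hM0 α) (by positivity)
      simpa using integral_mono_ae (hGint α).norm (integrable_const _) hb
    have hpt : ∀ ω, ∑' α, G α ω = OU t φ (Xt ω) - OU t φ (X0 ω) := by
      intro ω
      have h1 := (hser (X0 ω)).2 (Xt ω - X0 ω)
      have h0 := (hser (X0 ω)).apply_zero
      simp only [add_sub_cancel, add_zero] at h1 h0
      have h2 := h1.sub (hasSum_ite_eq (0 : Fin d → ℕ) (OU t φ (X0 ω)))
      rw [← h2.tsum_eq]
      refine tsum_congr fun α => ?_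
      by_cases h : α = 0
      · subst h
        simp [G, h0, mdeg, mfact, monoE]
      · simp only [G, (mdeg_pos_iff α).2 h, h, if_true, if_false]
        ring
    have h := (hasSum_integral_of_summable_integral_norm hGint hGsum).tsum_eq
    simp only [hpt] at h
    rw [← h]
    refine tsum_congr fun α => ?_
    by_cases hα : 0 < mdeg α
    · simp only [G, hα, if_true]
      rw [integral_const_mul]
      congr 1
      have hm := hX0.comap_le
      rw [← integral_condExp hm]
      refine integral_congr_ae (condExp_mul_of_stronglyMeasurable_right
        (g := fun ω => c α (X0 ω)) ?_ (hprod α) (hmono α))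
      exact ((hcm α).comp (comap_measurable X0)).stronglyMeasurable
    · simp [G, hα]

end
end

section
/- Let p ≥ 1 and let ν be a probability measure on ℝ with finite moment of order p. Let (X_t)_{t ≥ 0} be a stochastic process such that X_t has law ν for every t ≥ 0. Assume that for every ε > 0 there exist ξ, M > 0 such that for all t ∈ [ε, ε^{-1}], E[exp(p(1+ξ)max(1, p−1)|X_t − X_0|²/(2(e^{2t} − 1)))] ≤ M. Then for every s > 0, W_p(ν, γ₁) ≤ ∫_0^∞ e^{-t} E[S_p(t)^{p/2}]^{1/p} dt, where S_p(t) = E[(X_t − X_0)/s + X_0 | X_0]² + (max(1, p−1)/(e^{2t} − 1)) · E[(X_t − X_0)²/(2s) − 1 | X_0]² + Σ_{k ≥ 3} (max(1, p−1)^{k−1}/(s² k · k! (e^{2t} − 1)^{k−1})) · E[(X_t − X_0)^k | X_0]². -/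
open MeasureTheory ProbabilityTheory Real
open scoped ENNReal NNReal BigOperators Topology Classical

noncomputable section

lemma derivative_hermite_succ (n : ℕ) :
    Polynomial.derivative (Polynomial.hermite (n + 1)) =
      ((n : Polynomial ℤ) + 1) * Polynomial.hermite n := by
  induction n with
  | zero => simp
  | succ n ih =>
    rw [Polynomial.hermite_succ (n + 1), Polynomial.derivative_sub, Polynomial.derivative_mul, ih,
      Polynomial.derivative_mul, Polynomial.hermite_succ n]
    simp
    ring

lemma hermiteR_zero (x : ℝ) : hermiteR 0 x = 1 := by simp [hermiteR]

lemma continuous_hermiteR (n : ℕ) : Continuous (hermiteR n) :=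
  (Polynomial.hermite n).continuous_aeval

lemma hasDerivAt_hermiteR_succ (n : ℕ) (x : ℝ) :
    HasDerivAt (hermiteR (n + 1)) (((n : ℝ) + 1) * hermiteR n x) x := by
  have := (Polynomial.hermite (n + 1)).hasDerivAt_aeval x
  rw [derivative_hermite_succ] at this
  convert! this using 1
  simp [hermiteR]

lemma hermiteR_succ_succ (n : ℕ) (x : ℝ) :
    hermiteR (n + 2) x = x * hermiteR (n + 1) x - ((n : ℝ) + 1) * hermiteR n x := by
  simp only [hermiteR]
  rw [Polynomial.hermite_succ (n + 1), derivative_hermite_succ]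
  simp

lemma hermiteR_one (x : ℝ) : hermiteR 1 x = x := by simp [hermiteR]

/-- Functions of at most exponential growth. -/
def ExpBdd (f : ℝ → ℝ) : Prop := ∃ C κ : ℝ, 0 ≤ C ∧ 0 ≤ κ ∧ ∀ z, |f z| ≤ C * exp (κ * |z|)

namespace ExpBdd

variable {f g : ℝ → ℝ}

lemma const (c : ℝ) : ExpBdd fun _ => c :=
  ⟨|c|, 0, abs_nonneg _, le_rfl, fun z => by simp⟩

lemma mul (hf : ExpBdd f) (hg : ExpBdd g) : ExpBdd fun z => f z * g z := by
  obtain ⟨C, κ, hC, hκ, h⟩ := hf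
  obtain ⟨C', κ', hC', hκ', h'⟩ := hg
  refine ⟨C * C', κ + κ', by positivity, by positivity, fun z => ?_⟩
  rw [abs_mul, add_mul, exp_add, mul_mul_mul_comm]
  exact mul_le_mul (h z) (h' z) (abs_nonneg _) (by positivity)

lemma add (hf : ExpBdd f) (hg : ExpBdd g) : ExpBdd fun z => f z + g z := by
  obtain ⟨C, κ, hC, hκ, h⟩ := hf
  obtain ⟨C', κ', hC', hκ', h'⟩ := hg
  refine ⟨C + C', κ + κ', by positivity, by positivity, fun z => ?_⟩
  refine (abs_add_le _ _).trans ?_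
  have h1 : exp (κ * |z|) ≤ exp ((κ + κ') * |z|) := by
    gcongr; linarith
  have h2 : exp (κ' * |z|) ≤ exp ((κ + κ') * |z|) := by
    gcongr; linarith
  nlinarith [h z, h' z, mul_le_mul_of_nonneg_left h1 hC, mul_le_mul_of_nonneg_left h2 hC']

lemma of_le (hf : ExpBdd f) (h : ∀ z, |g z| ≤ |f z|) : ExpBdd g := by
  obtain ⟨C, κ, hC, hκ, h'⟩ := hf
  exact ⟨C, κ, hC, hκ, fun z => (h z).trans (h' z)⟩

lemma abs (hf : ExpBdd f) : ExpBdd fun z => |f z| := hf.of_le fun z => by simp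

lemma rpow (hf : ExpBdd f) {p : ℝ} (hp : 0 ≤ p) : ExpBdd fun z => |f z| ^ p := by
  obtain ⟨C, κ, hC, hκ, h⟩ := hf
  refine ⟨C ^ p, κ * p, by positivity, by positivity, fun z => ?_⟩
  rw [abs_of_nonneg (by positivity)]
  calc |f z| ^ p ≤ (C * exp (κ * |z|)) ^ p := by gcongr; exact h z
    _ = C ^ p * exp (κ * p * |z|) := by
      rw [mul_rpow hC (exp_pos _).le, ← exp_mul]; ring_nf

lemma sum {ι : Type*} (s : Finset ι) {F : ι → ℝ → ℝ} (h : ∀ i ∈ s, ExpBdd (F i)) :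
    ExpBdd fun z => ∑ i ∈ s, F i z := by
  induction s using Finset.induction_on with
  | empty => simpa using const 0
  | insert a s ha ih =>
    simp only [Finset.sum_insert ha]
    exact (h a (by simp)).add (ih fun i hi => h i (by simp [hi]))

lemma ident : ExpBdd fun z => z :=
  ⟨1, 1, zero_le_one, zero_le_one, fun z => by
    have := add_one_le_exp |z|
    simp only [one_mul]; linarith⟩

lemma hermite (n : ℕ) : ExpBdd (hermiteR n) := by
  suffices ExpBdd (hermiteR n) ∧ ExpBdd (hermiteR (n + 1)) from this.1
  induction n with
  | zero =>
    refine ⟨?_, ?_⟩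
    · simpa only [funext hermiteR_zero] using const 1
    · simpa only [zero_add, funext hermiteR_one] using ident
  | succ n ih =>
    refine ⟨ih.2, ?_⟩
    have := (ident.mul ih.2).add ((const (-((n : ℝ) + 1))).mul ih.1)
    refine this.of_le fun z => le_of_eq ?_
    rw [hermiteR_succ_succ]
    ring_nf

lemma integrable (hf : ExpBdd f) (hc : AEStronglyMeasurable f (gaussianReal 0 1)) :
    Integrable f (gaussianReal 0 1) := by
  obtain ⟨C, κ, hC, hκ, h⟩ := hf
  have := (integrable_exp_mul_abs (X := id) (t := κ) (μ := gaussianReal 0 1)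
    (integrable_exp_mul_gaussianReal _) (integrable_exp_mul_gaussianReal _)).const_mul C
  exact this.mono' hc (Filter.Eventually.of_forall h)

end ExpBdd

lemma gaussianPDFReal_std (x : ℝ) :
    gaussianPDFReal 0 1 x = (√(2 * π))⁻¹ * exp (-x ^ 2 / 2) := by
  simp [gaussianPDFReal]

lemma hasDerivAt_gaussianPDFReal_std (x : ℝ) :
    HasDerivAt (gaussianPDFReal 0 1) (-x * gaussianPDFReal 0 1 x) x := by
  rw [funext gaussianPDFReal_std]
  have h1 : HasDerivAt (fun x : ℝ => -x ^ 2 / 2) (-x) x := by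
    have := ((hasDerivAt_pow 2 x).neg.div_const 2)
    convert! this using 1
    ring
  convert! (h1.exp.const_mul (√(2 * π))⁻¹) using 1
  ring

lemma integrable_gaussianReal_iff {f : ℝ → ℝ} :
    Integrable f (gaussianReal 0 1) ↔ Integrable fun x => gaussianPDFReal 0 1 x * f x := by
  rw [gaussianReal_of_var_ne_zero _ one_ne_zero,
    integrable_withDensity_iff_integrable_smul' (measurable_gaussianPDF _ _)
      (by simp [gaussianPDF])]
  simp [toReal_gaussianPDF]

/-- Gaussian integration by parts. -/
lemma gaussian_integral_mul_eq_integral_deriv {h h' : ℝ → ℝ}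
    (hd : ∀ z, HasDerivAt h (h' z) z) (i0 : Integrable h (gaussianReal 0 1))
    (i1 : Integrable (fun z => z * h z) (gaussianReal 0 1))
    (i2 : Integrable h' (gaussianReal 0 1)) :
    ∫ z, z * h z ∂(gaussianReal 0 1) = ∫ z, h' z ∂(gaussianReal 0 1) := by
  have key := integral_eq_zero_of_hasDerivAt_of_integrable
    (f := fun z => gaussianPDFReal 0 1 z * h z)
    (fun z => (hasDerivAt_gaussianPDFReal_std z).mul (hd z)) ?_ (integrable_gaussianReal_iff.1 i0)
  · rw [integral_gaussianReal_eq_integral_smul one_ne_zero,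
      integral_gaussianReal_eq_integral_smul one_ne_zero]
    simp only [smul_eq_mul]
    rw [← sub_eq_zero, ← integral_sub (integrable_gaussianReal_iff.1 i1)
      (integrable_gaussianReal_iff.1 i2), ← neg_eq_zero, ← integral_neg]
    refine Eq.trans ?_ key
    congr 1; ext z; ring
  · convert! (integrable_gaussianReal_iff.1 i2).sub (integrable_gaussianReal_iff.1 i1) using 1
    ext z; simp; ring

lemma hasDerivAt_abs_rpow_sub_two_mul_self {m : ℝ} (hm : 2 ≤ m) (x : ℝ) :
    HasDerivAt (fun x : ℝ => |x| ^ (m - 2) * x) ((m - 1) * |x| ^ (m - 2)) x := by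
  rcases hm.eq_or_lt with rfl | hm
  · refine ((hasDerivAt_id x).congr_deriv (by norm_num)).congr_of_eventuallyEq ?_
    exact Filter.Eventually.of_forall fun y => by simp
  rcases eq_or_ne x 0 with rfl | hx
  · rw [abs_zero, zero_rpow (by linarith), mul_zero, hasDerivAt_iff_tendsto_slope]
    have : Filter.Tendsto (fun y : ℝ => |y| ^ (m - 2)) (𝓝[≠] 0) (𝓝 0) := by
      have h : Continuous fun y : ℝ => |y| ^ (m - 2) :=
        continuous_abs.rpow_const fun _ => Or.inr (by linarith)
      have := h.tendsto 0
      rw [abs_zero, zero_rpow (by linarith)] at this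
      exact this.mono_left nhdsWithin_le_nhds
    refine this.congr' ?_
    filter_upwards [self_mem_nhdsWithin] with y hy
    have hy : y ≠ 0 := hy
    simp [slope_def_field, hy]
  · have h1 := (hasDerivAt_abs hx).rpow_const (p := m - 2) (Or.inl (abs_ne_zero.2 hx))
    refine (h1.mul (hasDerivAt_id x)).congr_deriv ?_
    have h2 : |x| ^ (m - 2) = |x| ^ (m - 2 - 1) * |x| := by
      rw [rpow_sub_one (abs_ne_zero.2 hx)]; field_simp
    have h3 : ((SignType.sign x : SignType) : ℝ) * x = |x| := sign_mul_self x
    simp only [id, mul_one]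
    rw [show (SignType.sign x : ℝ) * (m - 2) * |x| ^ (m - 2 - 1) * x =
      (m - 2) * |x| ^ (m - 2 - 1) * ((SignType.sign x : ℝ) * x) by ring, h3, h2]
    ring

lemma integral_abs_rpow_mul_sq_le {m : ℝ} (hm : 2 ≤ m) {g g' : ℝ → ℝ}
    {μ : Measure ℝ} [IsProbabilityMeasure μ]
    (hg : AEStronglyMeasurable g μ) (hg' : AEStronglyMeasurable g' μ)
    (ig : Integrable (fun z => |g z| ^ m) μ) (hig : Integrable (fun z => |g' z| ^ m) μ) :
    ∫ z, |g z| ^ (m - 2) * g' z ^ 2 ∂μ ≤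
      (∫ z, |g z| ^ m ∂μ) ^ (1 - 2 / m) * (∫ z, |g' z| ^ m ∂μ) ^ (2 / m) := by
  rcases hm.eq_or_lt with rfl | hm
  · simp
  have hpq : (m / (m - 2)).HolderConjugate (m / 2) := by
    rw [Real.holderConjugate_iff]
    constructor
    · rw [lt_div_iff₀] <;> linarith
    · field_simp; ring
  have hm0 : 0 < m - 2 := by linarith
  have e1 : ∀ x : ℝ, (|x| ^ (m - 2)) ^ (m / (m - 2)) = |x| ^ m := fun x => by
    rw [← rpow_mul (abs_nonneg _)]; congr 1; field_simp
  have e2 : ∀ x : ℝ, (x ^ 2) ^ (m / 2) = |x| ^ m := fun x => by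
    rw [← sq_abs, ← rpow_natCast, ← rpow_mul (abs_nonneg _)]; congr 1; push_cast; field_simp
  have key := integral_mul_le_Lp_mul_Lq_of_nonneg (μ := μ) hpq (f := fun z => |g z| ^ (m - 2))
    (g := fun z => g' z ^ 2) (Filter.Eventually.of_forall fun z => by positivity)
    (Filter.Eventually.of_forall fun z => by positivity) ?_ ?_
  · simp only [e1, e2] at key
    convert! key using 3
    · field_simp
    · field_simp
  · have hmeas : AEStronglyMeasurable (fun z => |g z| ^ (m - 2)) μ :=
      (continuous_abs.rpow_const fun _ => Or.inr (by linarith)).comp_aestronglyMeasurable hg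
    rw [← integrable_norm_rpow_iff hmeas (by simp; positivity) (by simp)]
    rw [ENNReal.toReal_ofReal (by positivity)]
    simpa [e1, abs_of_nonneg (rpow_nonneg (abs_nonneg _) _)] using ig
  · have hmeas : AEStronglyMeasurable (fun z => g' z ^ 2) μ := hg'.pow 2
    rw [← integrable_norm_rpow_iff hmeas (by simp; positivity) (by simp)]
    rw [ENNReal.toReal_ofReal (by positivity)]
    simpa [e2] using hig

/-- The partial sum of a Hermite series, regularised by the Mehler parameter `r`. -/
def hermiteSum (N : ℕ) (c : ℕ → ℝ) (r z : ℝ) : ℝ :=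
  ∑ j ∈ Finset.range N, c j * r ^ j * hermiteR j z

lemma continuous_hermiteSum (N : ℕ) (c : ℕ → ℝ) (r : ℝ) : Continuous (hermiteSum N c r) :=
  continuous_finsetSum _ fun j _ => (continuous_hermiteR j).const_mul _

lemma expBdd_hermiteSum (N : ℕ) (c : ℕ → ℝ) (r : ℝ) : ExpBdd (hermiteSum N c r) :=
  ExpBdd.sum _ fun j _ => (ExpBdd.const _).mul (ExpBdd.hermite j)

lemma hasDerivAt_hermiteSum (N : ℕ) (c : ℕ → ℝ) (r z : ℝ) :
    HasDerivAt (hermiteSum N c r)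
      (hermiteSum (N - 1) (fun j => c (j + 1) * (j + 1) * r) r z) z := by
  rcases N with _ | N
  · have h0 : ∀ c', hermiteSum 0 c' r = fun _ => 0 := fun c' => by ext; simp [hermiteSum]
    rw [Nat.zero_sub, h0, h0]
    exact hasDerivAt_const z (0 : ℝ)
  have h : hermiteSum (N + 1) c r = fun z => (∑ j ∈ Finset.range N,
      c (j + 1) * r ^ (j + 1) * hermiteR (j + 1) z) + c 0 * r ^ 0 * hermiteR 0 z := by
    ext z
    rw [hermiteSum, Finset.sum_range_succ']
  rw [h]
  simp only [hermiteR_zero]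
  refine ((HasDerivAt.fun_sum fun j _ => (hasDerivAt_hermiteR_succ j z).const_mul _).add_const
    _).congr_deriv ?_
  refine Finset.sum_congr rfl fun j _ => ?_
  ring

lemma hasDerivAt_hermiteSum_param (N : ℕ) (c : ℕ → ℝ) (r z : ℝ) :
    HasDerivAt (fun r => hermiteSum N c r z)
      (∑ j ∈ Finset.range N, c j * (j * r ^ (j - 1)) * hermiteR j z) r :=
  HasDerivAt.fun_sum fun j _ => ((hasDerivAt_pow j r).const_mul _).mul_const _

/-- The Ornstein-Uhlenbeck generator acts diagonally on Hermite sums. -/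
lemma hermiteSum_number (N : ℕ) (c : ℕ → ℝ) (r z : ℝ) :
    r * ∑ j ∈ Finset.range N, c j * (j * r ^ (j - 1)) * hermiteR j z =
      z * hermiteSum (N - 1) (fun j => c (j + 1) * (j + 1) * r) r z -
      hermiteSum (N - 1 - 1)
        (fun j => c (j + 1 + 1) * ((j + 1 : ℕ) + 1) * r * (j + 1) * r) r z := by
  simp only [hermiteSum]
  rcases N with _ | _ | N
  · simp
  · simp
  simp only [Nat.add_sub_cancel]
  rw [Finset.sum_range_succ', Finset.sum_range_succ', Finset.sum_range_succ' _ N,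
    add_assoc, mul_add, Finset.mul_sum, mul_add z, Finset.mul_sum _ _ z,
    add_sub_right_comm, ← Finset.sum_sub_distrib]
  congr 1
  · refine Finset.sum_congr rfl fun j _ => ?_
    simp only [Nat.add_sub_cancel]
    rw [show j + 1 + 1 = j + 2 from rfl, hermiteR_succ_succ]
    push_cast
    ring
  · simp [hermiteR_zero, hermiteR_one]
    ring

lemma hasDerivAt_integral_hermiteSum {m : ℝ} (hm : 2 ≤ m) (N : ℕ) (c : ℕ → ℝ) (r₀ : ℝ) :
    HasDerivAt (fun r => ∫ z, |hermiteSum N c r z| ^ m ∂(gaussianReal 0 1))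
      (∫ z, m * |hermiteSum N c r₀ z| ^ (m - 2) * hermiteSum N c r₀ z *
        (∑ j ∈ Finset.range N, c j * (j * r₀ ^ (j - 1)) * hermiteR j z) ∂(gaussianReal 0 1))
      r₀ := by
  have hm0 : 0 ≤ m := by linarith
  have hm1 : 0 ≤ m - 2 := by linarith
  set R : ℝ := |r₀| + 1
  have hR : 0 ≤ R := by positivity
  set G : ℝ → ℝ := fun z => ∑ j ∈ Finset.range N, |c j| * R ^ j * |hermiteR j z| with hG
  set G₁ : ℝ → ℝ := fun z => ∑ j ∈ Finset.range N, |c j| * (j * R ^ (j - 1)) * |hermiteR j z|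
    with hG₁
  have hcG : Continuous G :=
    continuous_finsetSum _ fun j _ => (continuous_hermiteR j).abs.const_mul _
  have hcG₁ : Continuous G₁ :=
    continuous_finsetSum _ fun j _ => (continuous_hermiteR j).abs.const_mul _
  have hbG : ExpBdd G := ExpBdd.sum _ fun j _ => (ExpBdd.const _).mul (ExpBdd.hermite j).abs
  have hbG₁ : ExpBdd G₁ := ExpBdd.sum _ fun j _ => (ExpBdd.const _).mul (ExpBdd.hermite j).abs
  have hcS : ∀ r, Continuous fun z => |hermiteSum N c r z| ^ m := fun r =>
    (continuous_hermiteSum N c r).abs.rpow_const fun _ => Or.inr hm0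
  have hrR : ∀ r ∈ Metric.ball r₀ 1, |r| ≤ R := fun r hr => by
    rw [Metric.mem_ball, Real.dist_eq] at hr
    have := abs_add_le r₀ (r - r₀)
    rw [add_sub_cancel] at this
    linarith
  refine (hasDerivAt_integral_of_dominated_loc_of_deriv_le (μ := gaussianReal 0 1)
    (s := Metric.ball r₀ 1) (F := fun r z => |hermiteSum N c r z| ^ m)
    (F' := fun r z => m * |hermiteSum N c r z| ^ (m - 2) * hermiteSum N c r z *
        (∑ j ∈ Finset.range N, c j * (j * r ^ (j - 1)) * hermiteR j z))
    (bound := fun z => m * |G z| ^ (m - 2) * G z * G₁ z)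
    (Metric.ball_mem_nhds _ one_pos) ?_ ?_ ?_ ?_ ?_ ?_).2
  · exact Filter.Eventually.of_forall fun r => (hcS r).aestronglyMeasurable
  · exact ((expBdd_hermiteSum N c r₀).rpow hm0).integrable (hcS r₀).aestronglyMeasurable
  · refine Continuous.aestronglyMeasurable ?_
    refine ((continuous_const.mul ((continuous_hermiteSum N c r₀).abs.rpow_const
      fun _ => Or.inr hm1)).mul (continuous_hermiteSum N c r₀)).mul ?_
    exact continuous_finsetSum _ fun j _ => (continuous_hermiteR j).const_mul _
  · refine Filter.Eventually.of_forall fun z r hr => ?_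
    have hr := hrR r hr
    have h1 : |hermiteSum N c r z| ≤ G z := by
      refine (Finset.abs_sum_le_sum_abs _ _).trans (Finset.sum_le_sum fun j _ => ?_)
      rw [abs_mul, abs_mul, abs_pow]
      gcongr
    have hG0 : 0 ≤ G z := (abs_nonneg _).trans h1
    have h2 : |∑ j ∈ Finset.range N, c j * (j * r ^ (j - 1)) * hermiteR j z| ≤ G₁ z := by
      refine (Finset.abs_sum_le_sum_abs _ _).trans (Finset.sum_le_sum fun j _ => ?_)
      rw [abs_mul, abs_mul, abs_mul, abs_pow, Nat.abs_cast]
      gcongr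
    rw [Real.norm_eq_abs, abs_mul, abs_mul, abs_mul, abs_of_nonneg hm0,
      abs_of_nonneg (rpow_nonneg (abs_nonneg _) _), abs_of_nonneg hG0]
    gcongr
  · refine ExpBdd.integrable ((((ExpBdd.const m).mul (hbG.rpow hm1)).mul hbG).mul hbG₁)
      (Continuous.aestronglyMeasurable ?_)
    exact ((continuous_const.mul (hcG.abs.rpow_const fun _ => Or.inr hm1)).mul hcG).mul hcG₁
  · refine Filter.Eventually.of_forall fun z r hr => ?_
    exact (hasDerivAt_abs_rpow _ (by linarith)).comp r (hasDerivAt_hermiteSum_param N c r z)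

/-- The dissipation identity for moments along the Ornstein-Uhlenbeck flow. -/
lemma integral_hermiteSum_dissipation {m : ℝ} (hm : 2 ≤ m) (N : ℕ) (c : ℕ → ℝ) (r : ℝ) :
    r * (∫ z, m * |hermiteSum N c r z| ^ (m - 2) * hermiteSum N c r z *
        (∑ j ∈ Finset.range N, c j * (j * r ^ (j - 1)) * hermiteR j z) ∂(gaussianReal 0 1)) =
      m * (m - 1) * ∫ z, |hermiteSum N c r z| ^ (m - 2) *
        hermiteSum (N - 1) (fun j => c (j + 1) * (j + 1) * r) r z ^ 2 ∂(gaussianReal 0 1) := by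
  have hm1 : 0 ≤ m - 2 := by linarith
  set S := hermiteSum N c r with hS
  set S₁ := hermiteSum (N - 1) (fun j => c (j + 1) * (j + 1) * r) r with hS₁
  set S₂ := hermiteSum (N - 1 - 1)
        (fun j => c (j + 1 + 1) * ((j + 1 : ℕ) + 1) * r * (j + 1) * r) r with hS₂
  have hd : ∀ z, HasDerivAt S (S₁ z) z := fun z => hasDerivAt_hermiteSum N c r z
  have hd₁ : ∀ z, HasDerivAt S₁ (S₂ z) z := fun z => hasDerivAt_hermiteSum _ _ r z
  have cS : Continuous S := continuous_hermiteSum _ _ _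
  have cS₁ : Continuous S₁ := continuous_hermiteSum _ _ _
  have cS₂ : Continuous S₂ := continuous_hermiteSum _ _ _
  have bS : ExpBdd S := expBdd_hermiteSum _ _ _
  have bS₁ : ExpBdd S₁ := expBdd_hermiteSum _ _ _
  have bS₂ : ExpBdd S₂ := expBdd_hermiteSum _ _ _
  have cP : Continuous fun z => |S z| ^ (m - 2) := cS.abs.rpow_const fun _ => Or.inr hm1
  have bP : ExpBdd fun z => |S z| ^ (m - 2) := bS.rpow hm1
  have iA : Integrable (fun z => (m - 1) * |S z| ^ (m - 2) * S₁ z * S₁ z) (gaussianReal 0 1) :=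
    ((((ExpBdd.const _).mul bP).mul bS₁).mul bS₁).integrable
      (((cP.const_mul _).mul cS₁).mul cS₁).aestronglyMeasurable
  have iB : Integrable (fun z => |S z| ^ (m - 2) * S z * S₂ z) (gaussianReal 0 1) :=
    ((bP.mul bS).mul bS₂).integrable ((cP.mul cS).mul cS₂).aestronglyMeasurable
  have i0 : Integrable (fun z => |S z| ^ (m - 2) * S z * S₁ z) (gaussianReal 0 1) :=
    ((bP.mul bS).mul bS₁).integrable ((cP.mul cS).mul cS₁).aestronglyMeasurable
  have i1 : Integrable (fun z => z * (|S z| ^ (m - 2) * S z * S₁ z)) (gaussianReal 0 1) :=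
    (ExpBdd.ident.mul ((bP.mul bS).mul bS₁)).integrable
      (continuous_id.mul ((cP.mul cS).mul cS₁)).aestronglyMeasurable
  have ibp := gaussian_integral_mul_eq_integral_deriv
    (fun z => ((hasDerivAt_abs_rpow_sub_two_mul_self hm (S z)).comp z (hd z)).mul (hd₁ z))
    i0 i1 (iA.add iB)
  simp only [Function.comp_def, Pi.mul_apply] at ibp
  rw [integral_add iA iB] at ibp
  calc _ = m * (∫ z, z * (|S z| ^ (m - 2) * S z * S₁ z) ∂(gaussianReal 0 1) -
        ∫ z, |S z| ^ (m - 2) * S z * S₂ z ∂(gaussianReal 0 1)) := by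
        rw [← integral_sub i1 iB, ← integral_const_mul, ← integral_const_mul]
        congr 1
        ext z
        have := hermiteSum_number N c r z
        rw [← hS₁, ← hS₂] at this
        linear_combination (m * |S z| ^ (m - 2) * S z) * this
    _ = _ := by
        rw [ibp, add_sub_cancel_right, mul_assoc, ← integral_const_mul (m - 1)]
        congr 2
        ext z
        ring

/-- Gaussian hypercontractivity for Hermite expansions. -/
theorem hermiteSum_hypercontractive {m : ℝ} (hm : 2 ≤ m) (N : ℕ) : ∀ c : ℕ → ℝ,
    (∫ z, |hermiteSum N c 1 z| ^ m ∂(gaussianReal 0 1)) ^ (2 / m) ≤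
      ∑ j ∈ Finset.range N, c j ^ 2 * j.factorial * (m - 1) ^ j := by
  have hm0 : 0 < m := by linarith
  induction N with
  | zero =>
    intro c
    have : m ≠ 0 := by linarith
    simp [hermiteSum, this]
  | succ N ih =>
    intro c
    set A : ℝ → ℝ := fun r => ∫ z, |hermiteSum (N + 1) c r z| ^ m ∂(gaussianReal 0 1) with hA
    have hA0 : ∀ r, 0 ≤ A r := fun r => integral_nonneg fun z => by positivity
    have hA00 : A 0 = |c 0| ^ m := by
      have : ∀ z, hermiteSum (N + 1) c 0 z = c 0 := fun z => by
        rw [hermiteSum, Finset.sum_range_succ']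
        simp [hermiteR_zero]
      simp [hA, this]
    set Q : ℝ → ℝ := fun r =>
      ∑ j ∈ Finset.range N, c (j + 1) ^ 2 * (j + 1).factorial * (m - 1) ^ (j + 1) *
        r ^ (2 * j + 2) with hQ
    have hQd : ∀ r, HasDerivAt Q (∑ j ∈ Finset.range N,
        c (j + 1) ^ 2 * (j + 1).factorial * (m - 1) ^ (j + 1) *
        (((2 * j + 2 : ℕ) : ℝ) * r ^ (2 * j + 1))) r := fun r =>
      HasDerivAt.fun_sum fun j _ => (hasDerivAt_pow (2 * j + 2) r).const_mul _
    have hQ0 : Q 0 = 0 := by simp [hQ]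
    have main : ∀ δ : ℝ, 0 < δ → (A 1 + δ) ^ (2 / m) ≤ (A 0 + δ) ^ (2 / m) + Q 1 := by
      intro δ hδ
      have hpos : ∀ r, 0 < A r + δ := fun r => by linarith [hA0 r]
      have hBd : ∀ r, HasDerivAt (fun r => (A r + δ) ^ (2 / m) - Q r) _ r := fun r =>
        (((hasDerivAt_integral_hermiteSum hm (N + 1) c r).add_const δ).rpow_const (p := 2 / m)
          (Or.inl (hpos r).ne')).sub (hQd r)
      have anti : AntitoneOn (fun r => (A r + δ) ^ (2 / m) - Q r) (Set.Icc 0 1) := by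
        refine antitoneOn_of_deriv_nonpos (convex_Icc 0 1)
          (fun r _ => (hBd r).continuousAt.continuousWithinAt)
          (fun r _ => (hBd r).differentiableAt.differentiableWithinAt) fun r hr => ?_
        rw [interior_Icc] at hr
        have hr0 : 0 < r := hr.1
        rw [(hBd r).deriv]
        set D := ∫ z, m * |hermiteSum (N + 1) c r z| ^ (m - 2) * hermiteSum (N + 1) c r z *
          (∑ j ∈ Finset.range (N + 1), c j * (j * r ^ (j - 1)) * hermiteR j z)
          ∂(gaussianReal 0 1) with hD
        have hdis := integral_hermiteSum_dissipation hm (N + 1) c r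
        rw [← hD, Nat.add_sub_cancel] at hdis
        have hle := integral_abs_rpow_mul_sq_le hm (μ := gaussianReal 0 1)
          (continuous_hermiteSum (N + 1) c r).aestronglyMeasurable
          (continuous_hermiteSum N (fun j => c (j + 1) * (j + 1) * r) r).aestronglyMeasurable
          (((expBdd_hermiteSum _ _ _).rpow hm0.le).integrable
            ((continuous_hermiteSum _ _ _).abs.rpow_const
              fun _ => Or.inr hm0.le).aestronglyMeasurable)
          (((expBdd_hermiteSum _ _ _).rpow hm0.le).integrable
            ((continuous_hermiteSum _ _ _).abs.rpow_const
              fun _ => Or.inr hm0.le).aestronglyMeasurable)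
        set K := (∫ z, |hermiteSum N (fun j => c (j + 1) * (j + 1) * r) r z| ^ m
          ∂(gaussianReal 0 1)) ^ (2 / m) with hK
        have hK0 : 0 ≤ K := rpow_nonneg (integral_nonneg fun z => by positivity) _
        have hKle : K ≤ ∑ j ∈ Finset.range N,
            c (j + 1) ^ 2 * (j + 1) ^ 2 * j.factorial * (m - 1) ^ j * r ^ (2 * j + 2) := by
          have h := ih (fun j => c (j + 1) * (j + 1) * r * r ^ j)
          have e : hermiteSum N (fun j => c (j + 1) * (j + 1) * r * r ^ j) 1 =
              hermiteSum N (fun j => c (j + 1) * (j + 1) * r) r := by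
            ext z; simp [hermiteSum]
          rw [e, ← hK] at h
          refine h.trans (le_of_eq (Finset.sum_congr rfl fun j _ => ?_))
          ring
        have hAle : (A r) ^ (1 - 2 / m) ≤ (A r + δ) ^ (1 - 2 / m) := by
          refine rpow_le_rpow (hA0 r) (by linarith) ?_
          rw [sub_nonneg, div_le_one hm0]; exact hm
        have h1 : r * D ≤ m * (m - 1) * ((A r + δ) ^ (1 - 2 / m) * K) := by
          rw [hdis]
          refine mul_le_mul_of_nonneg_left (hle.trans ?_) (by nlinarith)
          exact mul_le_mul_of_nonneg_right hAle hK0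
        have h2 : (A r + δ) ^ (2 / m - 1) * (A r + δ) ^ (1 - 2 / m) = 1 := by
          rw [← rpow_add (hpos r)]; simp
        have h3 : r * (D * (2 / m) * (A r + δ) ^ (2 / m - 1)) ≤ 2 * (m - 1) * K := by
          have h4 : 0 ≤ (2 / m) * (A r + δ) ^ (2 / m - 1) := by
            have := (hpos r).le; positivity
          calc _ = (r * D) * ((2 / m) * (A r + δ) ^ (2 / m - 1)) := by ring
            _ ≤ m * (m - 1) * ((A r + δ) ^ (1 - 2 / m) * K) *
                ((2 / m) * (A r + δ) ^ (2 / m - 1)) := mul_le_mul_of_nonneg_right h1 h4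
            _ = (m * (2 / m)) * (m - 1) * K *
                ((A r + δ) ^ (2 / m - 1) * (A r + δ) ^ (1 - 2 / m)) := by ring
            _ = 2 * (m - 1) * K := by rw [h2]; field_simp
        have h5 : 2 * (m - 1) * K ≤ r * ∑ j ∈ Finset.range N,
            c (j + 1) ^ 2 * (j + 1).factorial * (m - 1) ^ (j + 1) *
            (((2 * j + 2 : ℕ) : ℝ) * r ^ (2 * j + 1)) := by
          refine (mul_le_mul_of_nonneg_left hKle (by linarith)).trans (le_of_eq ?_)
          rw [Finset.mul_sum, Finset.mul_sum]
          refine Finset.sum_congr rfl fun j _ => ?_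
          rw [Nat.factorial_succ]
          push_cast
          ring
        have h6 := h3.trans h5
        have h7 := le_of_mul_le_mul_left h6 hr0
        linarith
      have := anti (Set.left_mem_Icc.2 zero_le_one) (Set.right_mem_Icc.2 zero_le_one) zero_le_one
      simp only [hQ0] at this
      linarith
    have lim : A 1 ^ (2 / m) ≤ A 0 ^ (2 / m) + Q 1 := by
      have hc : ∀ x : ℝ, Filter.Tendsto (fun δ : ℝ => (x + δ) ^ (2 / m)) (𝓝[>] 0)
          (𝓝 (x ^ (2 / m))) := fun x => by
        have : Continuous fun δ : ℝ => (x + δ) ^ (2 / m) :=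
          (continuous_const.add continuous_id).rpow_const fun _ => Or.inr (by positivity)
        simpa using (this.tendsto 0).mono_left nhdsWithin_le_nhds
      exact le_of_tendsto_of_tendsto (hc _) ((hc _).add_const _)
        (eventually_nhdsWithin_of_forall fun δ hδ => main δ hδ)
    refine lim.trans (le_of_eq ?_)
    rw [Finset.sum_range_succ', hA00, ← rpow_mul (abs_nonneg _), mul_div_cancel₀ _ hm0.ne',
      rpow_ofNat, sq_abs, add_comm]
    simp [hQ]

lemma iteratedDeriv_hermite_generating (z : ℂ) (n : ℕ) :
    iteratedDeriv n (fun w : ℂ => Complex.exp (z * w - w ^ 2 / 2)) =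
      fun w => Polynomial.aeval (z - w) (Polynomial.hermite n) *
        Complex.exp (z * w - w ^ 2 / 2) := by
  induction n with
  | zero => ext w; simp
  | succ n ih =>
    rw [iteratedDeriv_succ, ih]
    ext w
    have h1 : HasDerivAt (fun w : ℂ => z * w - w ^ 2 / 2) (z - w) w := by
      refine (((hasDerivAt_id w).const_mul z).sub ((hasDerivAt_pow 2 w).div_const 2)).congr_deriv ?_
      simp
    have h2 : HasDerivAt (fun w : ℂ => Polynomial.aeval (z - w) (Polynomial.hermite n))
        (-Polynomial.aeval (z - w) (Polynomial.derivative (Polynomial.hermite n))) w := by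
      refine (((Polynomial.hermite n).hasDerivAt_aeval (z - w)).comp w
        ((hasDerivAt_id w).const_sub z)).congr_deriv ?_
      simp
    rw [(h2.fun_mul h1.cexp).deriv, Polynomial.hermite_succ]
    simp
    ring

/-- The generating function of the Hermite polynomials. -/
lemma hasSum_hermiteR (z w : ℝ) :
    HasSum (fun j : ℕ => w ^ j / j.factorial * hermiteR j z) (exp (z * w - w ^ 2 / 2)) := by
  have hd : Differentiable ℂ fun w : ℂ => Complex.exp ((z : ℂ) * w - w ^ 2 / 2) := by fun_prop
  have h := Complex.hasSum_taylorSeries_of_entire hd 0 (w : ℂ)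
  have hr : ∀ n : ℕ, Polynomial.aeval (z : ℂ) (Polynomial.hermite n) = (hermiteR n z : ℂ) :=
    fun n => by
      rw [hermiteR, ← Complex.coe_algebraMap, Polynomial.aeval_algebraMap_apply]
  rw [← Complex.hasSum_ofReal]
  convert! h using 1
  · ext j
    rw [iteratedDeriv_hermite_generating]
    simp only [sub_zero, mul_zero, smul_eq_mul, hr]
    simp
    ring
  · simp

/-- The standard Gaussian density. -/
abbrev gpdf (x : ℝ) : ℝ := gaussianPDFReal 0 1 x

lemma continuous_gpdf : Continuous gpdf :=
  continuous_iff_continuousAt.2 fun x => (hasDerivAt_gaussianPDFReal_std x).continuousAt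

lemma gpdf_pos (x : ℝ) : 0 < gpdf x := gaussianPDFReal_pos _ _ _ one_ne_zero

lemma gpdf_le_exp (x : ℝ) : gpdf x ≤ exp (-x ^ 2 / 2) := by
  rw [gpdf, gaussianPDFReal_std]
  refine mul_le_of_le_one_left (exp_pos _).le (inv_le_one_of_one_le₀ ?_)
  rw [one_le_sqrt]
  linarith [pi_gt_three]

lemma gpdf_le_one (x : ℝ) : gpdf x ≤ 1 :=
  (gpdf_le_exp x).trans (exp_le_one_iff.2 (by nlinarith [sq_nonneg x]))

lemma abs_mul_gpdf_le_one (x : ℝ) : |x| * gpdf x ≤ 1 := by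
  refine (mul_le_mul_of_nonneg_left (gpdf_le_exp x) (abs_nonneg x)).trans ?_
  have h1 : |x| ≤ exp (x ^ 2 / 2) := by
    have := add_one_le_exp (x ^ 2 / 2)
    nlinarith [sq_nonneg (|x| - 1), sq_abs x]
  rw [show -x ^ 2 / 2 = -(x ^ 2 / 2) by ring, exp_neg, ← div_eq_mul_inv]
  exact (div_le_one (exp_pos _)).2 h1

lemma gpdf_sub (z w : ℝ) : gpdf (z - w) = gpdf z * exp (z * w - w ^ 2 / 2) := by
  rw [gpdf, gpdf, gaussianPDFReal_std, gaussianPDFReal_std, mul_assoc, ← exp_add]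
  ring_nf

/-- The standard Gaussian cumulative distribution function. -/
abbrev gcdf (x : ℝ) : ℝ := cdf (gaussianReal 0 1) x

lemma gcdf_eq_integral (x : ℝ) : gcdf x = ∫ y in Set.Iic x, gpdf y := by
  rw [gcdf, cdf_eq_real, measureReal_def, gaussianReal_apply_eq_integral _ one_ne_zero,
    ENNReal.toReal_ofReal (integral_nonneg fun y => (gpdf_pos y).le)]

lemma gcdf_sub_gcdf (a b : ℝ) : gcdf b - gcdf a = ∫ y in a..b, gpdf y := by
  rw [gcdf_eq_integral, gcdf_eq_integral]
  exact intervalIntegral.integral_Iic_sub_Iic (integrable_gaussianPDFReal _ _).integrableOn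
    (integrable_gaussianPDFReal _ _).integrableOn

lemma hasDerivAt_gcdf (x : ℝ) : HasDerivAt gcdf (gpdf x) x := by
  have h : gcdf = fun x => gcdf 0 + ∫ y in (0 : ℝ)..x, gpdf y := by
    ext x; rw [← gcdf_sub_gcdf]; ring
  rw [h]
  exact (continuous_gpdf.integral_hasStrictDerivAt 0 x).hasDerivAt.const_add _

lemma continuous_gcdf : Continuous gcdf :=
  continuous_iff_continuousAt.2 fun x => (hasDerivAt_gcdf x).continuousAt

/-- Expansion of Gaussian CDF increments in Hermite polynomials. -/
lemma hasSum_gcdf_sub (z w : ℝ) :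
    HasSum (fun j : ℕ => w ^ (j + 1) / (j + 1).factorial * hermiteR j z * gpdf z)
      (gcdf z - gcdf (z - w)) := by
  have h := intervalIntegral.hasSum_integral_of_dominated_convergence (μ := volume) (a := 0) (b := w)
    (F := fun j h => h ^ j / j.factorial * hermiteR j z * gpdf z)
    (f := fun h => gpdf (z - h))
    (fun j _ => |w| ^ j / j.factorial * |hermiteR j z| * gpdf z) ?_ ?_ ?_ ?_ ?_
  · convert! h using 1
    · ext j
      rw [intervalIntegral.integral_mul_const, intervalIntegral.integral_mul_const,
        intervalIntegral.integral_div, integral_pow, Nat.factorial_succ]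
      push_cast
      simp only [ne_eq, Nat.add_eq_zero_iff, one_ne_zero, and_false, not_false_eq_true, zero_pow,
        sub_zero]
      field_simp
    · rw [intervalIntegral.integral_comp_sub_left (fun x => gpdf x), sub_zero, gcdf_sub_gcdf]
  · intro j
    exact (by fun_prop : Continuous _).aestronglyMeasurable
  · intro j
    refine Filter.Eventually.of_forall fun h hh => ?_
    have : |h| ≤ |w| := by
      have := Set.abs_sub_left_of_mem_uIcc (Set.uIoc_subset_uIcc hh)
      simpa using this
    rw [Real.norm_eq_abs, abs_mul, abs_mul, abs_div, abs_pow, Nat.abs_cast,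
      abs_of_pos (gpdf_pos z)]
    have := gpdf_pos z
    gcongr
  · refine Filter.Eventually.of_forall fun h _ => ?_
    have := (hasSum_hermiteR z w).summable.abs.mul_right (gpdf z)
    simpa [abs_mul, abs_div] using this
  · exact intervalIntegrable_const
  · refine Filter.Eventually.of_forall fun h _ => ?_
    rw [gpdf_sub, mul_comm]
    exact (hasSum_hermiteR z h).mul_right _

/-- The standard deviation of the Gaussian noise in the Ornstein-Uhlenbeck flow at time `t`. -/
def ouSd (t : ℝ) : ℝ := √(1 - exp (-2 * t))

/-- The ratio of the signal and noise coefficients in the Ornstein-Uhlenbeck flow. -/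
def ouRatio (t : ℝ) : ℝ := exp (-t) / ouSd t

/-- The value of the noise that takes `y` to `x` along the Ornstein-Uhlenbeck flow. -/
def ouNoise (t x y : ℝ) : ℝ := (x - exp (-t) * y) / ouSd t

lemma ouSd_sq {t : ℝ} (ht : 0 ≤ t) : ouSd t ^ 2 = 1 - exp (-2 * t) := by
  rw [ouSd, sq_sqrt]
  have : exp (-2 * t) ≤ 1 := exp_le_one_iff.2 (by linarith)
  linarith

lemma ouSd_pos {t : ℝ} (ht : 0 < t) : 0 < ouSd t := by
  rw [ouSd, sqrt_pos]
  have : exp (-2 * t) < 1 := by rw [← exp_zero]; exact exp_lt_exp.2 (by linarith)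
  linarith

lemma ouSd_mono {t t' : ℝ} (h : t ≤ t') : ouSd t ≤ ouSd t' := by
  have := exp_le_exp.2 (show -2 * t' ≤ -2 * t by linarith)
  exact sqrt_le_sqrt (by linarith)

lemma ouRatio_pos {t : ℝ} (ht : 0 < t) : 0 < ouRatio t := div_pos (exp_pos _) (ouSd_pos ht)

lemma ouRatio_anti {t t' : ℝ} (ht : 0 < t) (h : t ≤ t') : ouRatio t' ≤ ouRatio t := by
  unfold ouRatio
  have := ouSd_pos ht
  have := ouSd_mono h
  gcongr

lemma ouRatio_sq {t : ℝ} (ht : 0 < t) : ouRatio t ^ 2 = 1 / (exp (2 * t) - 1) := by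
  have h1 : 1 < exp (2 * t) := one_lt_exp_iff.2 (by linarith)
  have h2 : exp (-t) ^ 2 = (exp (2 * t))⁻¹ := by
    rw [← exp_neg, ← exp_nat_mul]; congr 1; push_cast; ring
  rw [ouRatio, div_pow, ouSd_sq ht.le, h2, show -2 * t = -(2 * t) by ring, exp_neg]
  have h3 : exp (2 * t) - 1 ≠ 0 := by linarith
  have h4 : 1 - (exp (2 * t))⁻¹ ≠ 0 := by
    have := inv_lt_one_of_one_lt₀ h1
    linarith
  field_simp

lemma hasDerivAt_ouSd {t : ℝ} (ht : 0 < t) : HasDerivAt ouSd (exp (-t) * ouRatio t) t := by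
  have h0 : 0 < 1 - exp (-2 * t) := by
    have : exp (-2 * t) < 1 := by rw [← exp_zero]; exact exp_lt_exp.2 (by linarith)
    linarith
  have h1 : HasDerivAt (fun t : ℝ => 1 - exp (-2 * t)) (2 * exp (-2 * t)) t := by
    refine (((hasDerivAt_id t).const_mul (-2 : ℝ)).exp.const_sub 1).congr_deriv ?_
    simp; ring
  refine (h1.sqrt h0.ne').congr_deriv ?_
  rw [ouRatio, show -2 * t = -t + -t by ring, exp_add, ← exp_add, ← show -2 * t = -t + -t by ring,
    ← ouSd]
  have := (ouSd_pos ht).ne'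
  rw [show -2 * t = -t + -t by ring, exp_add]
  field_simp

/-- The time derivative of the noise. -/
def ouNoiseTime (t x y : ℝ) : ℝ := ouRatio t * (y - ouRatio t * ouNoise t x y)

open ContinuousLinearMap in
lemma hasFDerivAt_ouNoise {t : ℝ} (ht : 0 < t) (x y : ℝ) :
    HasFDerivAt (fun q : ℝ × ℝ => ouNoise q.1 q.2 y)
      (ouNoiseTime t x y • fst ℝ ℝ ℝ + (1 / ouSd t) • snd ℝ ℝ ℝ) (t, x) := by
  have hb := (ouSd_pos ht).ne'
  have h0 : HasFDerivAt (fun q : ℝ × ℝ => q.1) (fst ℝ ℝ ℝ) (t, x) := hasFDerivAt_fst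
  have h0' : HasFDerivAt (fun q : ℝ × ℝ => q.2) (snd ℝ ℝ ℝ) (t, x) := hasFDerivAt_snd
  have h1 : HasFDerivAt (fun q : ℝ × ℝ => exp (-q.1)) _ (t, x) :=
    HasDerivAt.comp_hasFDerivAt (h₂ := fun t => exp (-t)) (f := fun q : ℝ × ℝ => q.1) (t, x)
      (hasDerivAt_id t).neg.exp h0
  have h2 : HasFDerivAt (fun q : ℝ × ℝ => (ouSd q.1)⁻¹) _ (t, x) :=
    HasDerivAt.comp_hasFDerivAt (h₂ := fun t => (ouSd t)⁻¹) (f := fun q : ℝ × ℝ => q.1) (t, x)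
      ((hasDerivAt_ouSd ht).inv hb) h0
  have h3 : HasFDerivAt (fun q : ℝ × ℝ => (q.2 - exp (-q.1) * y) * (ouSd q.1)⁻¹) _ (t, x) :=
    (h0'.sub (h1.mul_const y)).mul h2
  have h4 : (fun q : ℝ × ℝ => ouNoise q.1 q.2 y) =
      fun q : ℝ × ℝ => (q.2 - exp (-q.1) * y) * (ouSd q.1)⁻¹ := by
    ext q; rw [ouNoise, div_eq_mul_inv]
  rw [h4]
  refine h3.congr_fderiv ?_
  apply ContinuousLinearMap.ext
  rintro ⟨τ, ξ⟩
  simp [ouNoiseTime, ouRatio, ouNoise]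
  field_simp
  ring

lemma continuous_ouNoise_right (t x : ℝ) : Continuous (ouNoise t x) := by
  unfold ouNoise; fun_prop

lemma abs_ouNoiseTime_mul_gpdf_le {t₁ t : ℝ} (h₁ : 0 < t₁) (h : t₁ ≤ t) (x y : ℝ) :
    |ouNoiseTime t x y * gpdf (ouNoise t x y)| ≤ ouRatio t₁ * (|y| + ouRatio t₁) := by
  have hc := ouRatio_anti h₁ h
  have hc0 := ouRatio_pos (h₁.trans_le h)
  set z := ouNoise t x y
  have hz := abs_mul_gpdf_le_one z
  have hg := gpdf_pos z
  have hg1 := gpdf_le_one z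
  rw [ouNoiseTime, mul_assoc, abs_mul, abs_of_pos hc0]
  refine mul_le_mul hc ?_ (abs_nonneg _) (hc0.le.trans hc)
  rw [sub_mul]
  refine (abs_sub _ _).trans ?_
  rw [abs_mul, abs_mul, abs_mul, abs_of_pos hg, abs_of_pos hc0]
  have h1 : |y| * gpdf z ≤ |y| := mul_le_of_le_one_right (abs_nonneg _) hg1
  have h2 : ouRatio t * |z| * gpdf z ≤ ouRatio t₁ := by
    rw [mul_assoc]
    exact (mul_le_of_le_one_right hc0.le hz).trans hc
  linarith

section Flow

variable (ν : Measure ℝ)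

/-- The cumulative distribution function of the Ornstein-Uhlenbeck flow started from `ν`. -/
def flowCDF (t x : ℝ) : ℝ := ∫ y, gcdf (ouNoise t x y) ∂ν

/-- The density of the Ornstein-Uhlenbeck flow started from `ν`. -/
def flowDens (t x : ℝ) : ℝ := ∫ y, gpdf (ouNoise t x y) * (1 / ouSd t) ∂ν

/-- The time derivative of the cumulative distribution function of the flow. -/
def flowTime (t x : ℝ) : ℝ := ∫ y, ouNoiseTime t x y * gpdf (ouNoise t x y) ∂ν

lemma continuous_ouNoiseTime_mul (t x : ℝ) :
    Continuous fun y => ouNoiseTime t x y * gpdf (ouNoise t x y) := by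
  have := continuous_ouNoise_right t x
  have := continuous_gpdf
  unfold ouNoiseTime
  fun_prop

variable [IsProbabilityMeasure ν]

lemma integrable_gpdf_ouNoise (t x : ℝ) :
    Integrable (fun y => gpdf (ouNoise t x y) * (1 / ouSd t)) ν := by
  refine Integrable.mul_const ?_ _
  refine Integrable.of_bound (C := 1)
    (continuous_gpdf.comp (continuous_ouNoise_right t x)).aestronglyMeasurable ?_
  refine Filter.Eventually.of_forall fun y => ?_
  rw [Real.norm_eq_abs, abs_of_pos (gpdf_pos _)]
  exact gpdf_le_one _

lemma integrable_gcdf_ouNoise (t x : ℝ) : Integrable (fun y => gcdf (ouNoise t x y)) ν := by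
  refine Integrable.of_bound (C := 1)
    (continuous_gcdf.comp (continuous_ouNoise_right t x)).aestronglyMeasurable ?_
  refine Filter.Eventually.of_forall fun y => ?_
  rw [Real.norm_eq_abs, abs_of_nonneg (cdf_nonneg _ _)]
  exact cdf_le_one _ _

lemma integrable_ouNoiseTime_mul (hν : Integrable (fun y => y) ν) {t : ℝ} (ht : 0 < t) (x : ℝ) :
    Integrable (fun y => ouNoiseTime t x y * gpdf (ouNoise t x y)) ν :=
  ((hν.abs.add (integrable_const _)).const_mul _).mono'
    (continuous_ouNoiseTime_mul t x).aestronglyMeasurable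
    (Filter.Eventually.of_forall fun y => abs_ouNoiseTime_mul_gpdf_le ht le_rfl x y)

lemma flowDens_pos {t : ℝ} (ht : 0 < t) (x : ℝ) : 0 < flowDens ν t x := by
  have hpos : ∀ y, 0 < gpdf (ouNoise t x y) * (1 / ouSd t) := fun y =>
    mul_pos (gpdf_pos _) (one_div_pos.2 (ouSd_pos ht))
  rw [flowDens, integral_pos_iff_support_of_nonneg (fun y => (hpos y).le)
    (integrable_gpdf_ouNoise ν t x)]
  have : Function.support (fun y => gpdf (ouNoise t x y) * (1 / ouSd t)) = Set.univ :=
    Set.eq_univ_of_forall fun y => (hpos y).ne'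
  rw [this]; simp

open ContinuousLinearMap in
lemma hasFDerivAt_flowCDF (hν : Integrable (fun y => y) ν) {t : ℝ} (ht : 0 < t) (x : ℝ) :
    HasFDerivAt (fun q : ℝ × ℝ => flowCDF ν q.1 q.2)
      (flowTime ν t x • fst ℝ ℝ ℝ + flowDens ν t x • snd ℝ ℝ ℝ) (t, x) := by
  have hs : {q : ℝ × ℝ | t / 2 < q.1} ∈ 𝓝 (t, x) :=
    (isOpen_lt continuous_const continuous_fst).mem_nhds (by simp; linarith)
  have ht2 : 0 < t / 2 := by linarith
  have e : ∀ q : ℝ × ℝ, ∀ y, gpdf (ouNoise q.1 q.2 y) •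
      (ouNoiseTime q.1 q.2 y • fst ℝ ℝ ℝ + (1 / ouSd q.1) • snd ℝ ℝ ℝ) =
      (ouNoiseTime q.1 q.2 y * gpdf (ouNoise q.1 q.2 y)) • fst ℝ ℝ ℝ +
        (gpdf (ouNoise q.1 q.2 y) * (1 / ouSd q.1)) • snd ℝ ℝ ℝ := fun q y => by
    rw [smul_add, smul_smul, smul_smul, mul_comm (ouNoiseTime _ _ _)]
  have i1 : Integrable (fun y => (ouNoiseTime t x y * gpdf (ouNoise t x y)) • fst ℝ ℝ ℝ) ν :=
    (integrable_ouNoiseTime_mul ν hν ht x).smul_const _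
  have i2 : Integrable (fun y => (gpdf (ouNoise t x y) * (1 / ouSd t)) • snd ℝ ℝ ℝ) ν :=
    (integrable_gpdf_ouNoise ν t x).smul_const _
  have key := hasFDerivAt_integral_of_dominated_of_fderiv_le (𝕜 := ℝ) (μ := ν) hs
    (F := fun q y => gcdf (ouNoise q.1 q.2 y))
    (F' := fun q y => (ouNoiseTime q.1 q.2 y * gpdf (ouNoise q.1 q.2 y)) • fst ℝ ℝ ℝ +
        (gpdf (ouNoise q.1 q.2 y) * (1 / ouSd q.1)) • snd ℝ ℝ ℝ)
    (bound := fun y => ouRatio (t / 2) * (|y| + ouRatio (t / 2)) + 1 / ouSd (t / 2))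
    ?_ ?_ ?_ ?_ ?_ ?_
  · refine key.congr_fderiv ?_
    rw [integral_add i1 i2, integral_smul_const, integral_smul_const]
    rfl
  · exact Filter.Eventually.of_forall fun q => (integrable_gcdf_ouNoise ν _ _).aestronglyMeasurable
  · exact integrable_gcdf_ouNoise ν _ _
  · exact i1.aestronglyMeasurable.add i2.aestronglyMeasurable
  · refine Filter.Eventually.of_forall fun y q hq => ?_
    have hq : t / 2 < q.1 := hq
    refine (norm_add_le _ _).trans ?_
    rw [norm_smul, norm_smul]
    have h1 := abs_ouNoiseTime_mul_gpdf_le ht2 hq.le q.2 y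
    have h2 : |gpdf (ouNoise q.1 q.2 y) * (1 / ouSd q.1)| ≤ 1 / ouSd (t / 2) := by
      have hp := ouSd_pos ht2
      have hp' := ouSd_pos (ht2.trans hq)
      rw [abs_of_nonneg (mul_nonneg (gpdf_pos _).le (by positivity))]
      refine (mul_le_of_le_one_left (by positivity) (gpdf_le_one _)).trans ?_
      exact one_div_le_one_div_of_le hp (ouSd_mono hq.le)
    refine add_le_add ?_ ?_
    · exact (mul_le_of_le_one_right (norm_nonneg _) (norm_fst_le ..)).trans h1
    · exact (mul_le_of_le_one_right (norm_nonneg _) (norm_snd_le ..)).trans h2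
  · exact ((hν.abs.add (integrable_const _)).const_mul _).add (integrable_const _)
  · refine Filter.Eventually.of_forall fun y q hq => ?_
    have hq : t / 2 < q.1 := hq
    rw [← e]
    exact (hasDerivAt_gcdf _).comp_hasFDerivAt q (hasFDerivAt_ouNoise (ht2.trans hq) q.2 y)

lemma continuousOn_flowDens :
    ContinuousOn (fun q : ℝ × ℝ => flowDens ν q.1 q.2) (Set.Ioi 0 ×ˢ Set.univ) := by
  rintro ⟨t, x⟩ ⟨ht, -⟩
  have ht : 0 < t := ht
  have ht2 : 0 < t / 2 := by linarith
  have hs : ∀ᶠ q in 𝓝 (t, x), t / 2 < q.1 :=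
    (isOpen_lt continuous_const continuous_fst).mem_nhds (by simp; linarith)
  refine ContinuousAt.continuousWithinAt ?_
  refine continuousAt_of_dominated (bound := fun _ => 1 / ouSd (t / 2))
    (Filter.Eventually.of_forall fun q => (integrable_gpdf_ouNoise ν _ _).aestronglyMeasurable)
    ?_ (integrable_const _) ?_
  · filter_upwards [hs] with q hq
    refine Filter.Eventually.of_forall fun y => ?_
    have hp := ouSd_pos ht2
    have hp' := ouSd_pos (ht2.trans hq)
    rw [Real.norm_eq_abs, abs_of_nonneg (mul_nonneg (gpdf_pos _).le (by positivity))]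
    refine (mul_le_of_le_one_left (by positivity) (gpdf_le_one _)).trans ?_
    exact one_div_le_one_div_of_le hp (ouSd_mono hq.le)
  · refine Filter.Eventually.of_forall fun y => ?_
    have h1 := (hasFDerivAt_ouNoise ht x y).continuousAt
    have h2 : ContinuousAt (fun q : ℝ × ℝ => ouSd q.1) (t, x) :=
      ContinuousAt.comp (f := Prod.fst) (g := ouSd) (hasDerivAt_ouSd ht).continuousAt
        continuousAt_fst
    exact (continuous_gpdf.continuousAt.comp h1).mul
      (continuousAt_const.div h2 (ouSd_pos ht).ne')

lemma continuousOn_flowTime (hν : Integrable (fun y => y) ν) :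
    ContinuousOn (fun q : ℝ × ℝ => flowTime ν q.1 q.2) (Set.Ioi 0 ×ˢ Set.univ) := by
  rintro ⟨t, x⟩ ⟨ht, -⟩
  have ht : 0 < t := ht
  have ht2 : 0 < t / 2 := by linarith
  have hs : ∀ᶠ q in 𝓝 (t, x), t / 2 < q.1 :=
    (isOpen_lt continuous_const continuous_fst).mem_nhds (by simp; linarith)
  refine ContinuousAt.continuousWithinAt ?_
  refine continuousAt_of_dominated
    (bound := fun y => ouRatio (t / 2) * (|y| + ouRatio (t / 2)))
    (Filter.Eventually.of_forall fun q =>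
      (continuous_ouNoiseTime_mul _ _).aestronglyMeasurable)
    ?_ ((hν.abs.add (integrable_const _)).const_mul _) ?_
  · filter_upwards [hs] with q hq
    exact Filter.Eventually.of_forall fun y => abs_ouNoiseTime_mul_gpdf_le ht2 hq.le q.2 y
  · refine Filter.Eventually.of_forall fun y => ?_
    have h1 := (hasFDerivAt_ouNoise ht x y).continuousAt
    have h2 : ContinuousAt (fun q : ℝ × ℝ => ouSd q.1) (t, x) :=
      ContinuousAt.comp (f := Prod.fst) (g := ouSd) (hasDerivAt_ouSd ht).continuousAt
        continuousAt_fst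
    have h3 : ContinuousAt (fun q : ℝ × ℝ => ouRatio q.1) (t, x) :=
      ContinuousAt.div (by fun_prop) h2 (ouSd_pos ht).ne'
    exact (h3.mul (continuousAt_const.sub (h3.mul h1))).mul (continuous_gpdf.continuousAt.comp h1)

end Flow

section Quantile

variable (ν : Measure ℝ) [IsProbabilityMeasure ν]

lemma hasDerivAt_flowCDF (hν : Integrable (fun y => y) ν) {t : ℝ} (ht : 0 < t) (x : ℝ) :
    HasDerivAt (flowCDF ν t) (flowDens ν t x) x := by
  have h1 := hasFDerivAt_flowCDF ν hν ht x
  have h2 : HasDerivAt (fun x : ℝ => (t, x)) ((0 : ℝ), (1 : ℝ)) x :=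
    (hasDerivAt_const x t).prodMk (hasDerivAt_id x)
  refine (h1.comp_hasDerivAt x h2).congr_deriv ?_
  simp

lemma continuous_flowCDF (hν : Integrable (fun y => y) ν) {t : ℝ} (ht : 0 < t) :
    Continuous (flowCDF ν t) :=
  continuous_iff_continuousAt.2 fun x => (hasDerivAt_flowCDF ν hν ht x).continuousAt

lemma strictMono_flowCDF (hν : Integrable (fun y => y) ν) {t : ℝ} (ht : 0 < t) :
    StrictMono (flowCDF ν t) :=
  strictMono_of_hasDerivAt_pos (fun x => hasDerivAt_flowCDF ν hν ht x)
    (fun x => flowDens_pos ν ht x)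

lemma tendsto_flowCDF_atTop {t : ℝ} (ht : 0 < t) :
    Filter.Tendsto (flowCDF ν t) Filter.atTop (𝓝 1) := by
  have : Filter.Tendsto (flowCDF ν t) Filter.atTop (𝓝 (∫ _, (1 : ℝ) ∂ν)) := by
    refine tendsto_integral_filter_of_dominated_convergence (fun _ => (1 : ℝ))
      (Filter.Eventually.of_forall fun x => (integrable_gcdf_ouNoise ν t x).aestronglyMeasurable)
      (Filter.Eventually.of_forall fun x => Filter.Eventually.of_forall fun y => ?_)
      (integrable_const _) (Filter.Eventually.of_forall fun y => ?_)
    · rw [Real.norm_eq_abs, abs_of_nonneg (cdf_nonneg _ _)]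
      exact cdf_le_one _ _
    · refine (tendsto_cdf_atTop (gaussianReal 0 1)).comp ?_
      exact (Filter.tendsto_atTop_add_const_right _ _ Filter.tendsto_id).atTop_div_const
        (ouSd_pos ht)
  simpa using this

lemma tendsto_flowCDF_atBot {t : ℝ} (ht : 0 < t) :
    Filter.Tendsto (flowCDF ν t) Filter.atBot (𝓝 0) := by
  have : Filter.Tendsto (flowCDF ν t) Filter.atBot (𝓝 (∫ _, (0 : ℝ) ∂ν)) := by
    refine tendsto_integral_filter_of_dominated_convergence (fun _ => (1 : ℝ))
      (Filter.Eventually.of_forall fun x => (integrable_gcdf_ouNoise ν t x).aestronglyMeasurable)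
      (Filter.Eventually.of_forall fun x => Filter.Eventually.of_forall fun y => ?_)
      (integrable_const _) (Filter.Eventually.of_forall fun y => ?_)
    · rw [Real.norm_eq_abs, abs_of_nonneg (cdf_nonneg _ _)]
      exact cdf_le_one _ _
    · refine (tendsto_cdf_atBot (gaussianReal 0 1)).comp ?_
      exact (Filter.tendsto_atBot_add_const_right _ _ Filter.tendsto_id).atBot_div_const
        (ouSd_pos ht)
  simpa using this

lemma range_flowCDF (hν : Integrable (fun y => y) ν) {t : ℝ} (ht : 0 < t) :
    Set.range (flowCDF ν t) = Set.Ioo 0 1 := by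
  have hm := strictMono_flowCDF ν hν ht
  have h1 := tendsto_flowCDF_atTop ν ht
  have h0 := tendsto_flowCDF_atBot ν ht
  apply Set.Subset.antisymm
  · rintro _ ⟨x, rfl⟩
    exact ⟨(hm.monotone.le_of_tendsto h0 (x - 1)).trans_lt (hm (by linarith)),
      (hm (show x < x + 1 by linarith)).trans_le (hm.monotone.ge_of_tendsto h1 (x + 1))⟩
  · intro u hu
    exact mem_range_of_exists_le_of_exists_ge (continuous_flowCDF ν hν ht)
      ((h0.eventually (gt_mem_nhds hu.1)).exists.imp fun _ h => h.le)
      ((h1.eventually (lt_mem_nhds hu.2)).exists.imp fun _ h => h.le)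

/-- The quantile function of the Ornstein-Uhlenbeck flow started from `ν`. -/
def flowQuantile (t u : ℝ) : ℝ := Function.invFun (flowCDF ν t) u

lemma flowCDF_flowQuantile (hν : Integrable (fun y => y) ν) {t u : ℝ} (ht : 0 < t)
    (hu : u ∈ Set.Ioo (0 : ℝ) 1) : flowCDF ν t (flowQuantile ν t u) = u := by
  rw [← range_flowCDF ν hν ht] at hu
  exact Function.invFun_eq hu

lemma flowQuantile_flowCDF (hν : Integrable (fun y => y) ν) {t : ℝ} (ht : 0 < t) (x : ℝ) :
    flowQuantile ν t (flowCDF ν t x) = x :=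
  Function.leftInverse_invFun (strictMono_flowCDF ν hν ht).injective x

lemma continuousAt_flowQuantile (hν : Integrable (fun y => y) ν) {t u : ℝ} (ht : 0 < t)
    (hu : u ∈ Set.Ioo (0 : ℝ) 1) :
    ContinuousAt (fun q : ℝ × ℝ => flowQuantile ν q.1 q.2) (t, u) := by
  have hs : ∀ᶠ q : ℝ × ℝ in 𝓝 (t, u), 0 < q.1 ∧ q.2 ∈ Set.Ioo (0 : ℝ) 1 :=
    ((isOpen_Ioi (a := (0 : ℝ))).prod (isOpen_Ioo (a := (0 : ℝ)) (b := 1))).mem_nhds ⟨ht, hu⟩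
  have hc : ∀ x, ContinuousAt (fun q : ℝ × ℝ => flowCDF ν q.1 x) (t, u) := fun x =>
    ContinuousAt.comp (g := fun r : ℝ × ℝ => flowCDF ν r.1 r.2) (f := fun q : ℝ × ℝ => (q.1, x))
      (hasFDerivAt_flowCDF ν hν ht x).continuousAt (by fun_prop)
  have hm := strictMono_flowCDF ν hν ht
  refine tendsto_order.2 ⟨fun a ha => ?_, fun a ha => ?_⟩
  · have h1 : flowCDF ν t a < u := by
      conv_rhs => rw [← flowCDF_flowQuantile ν hν ht hu]
      exact hm ha
    filter_upwards [hs, (hc a).eventually_lt continuousAt_snd h1] with q hq h2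
    rw [← flowCDF_flowQuantile ν hν hq.1 hq.2] at h2
    exact (strictMono_flowCDF ν hν hq.1).lt_iff_lt.1 h2
  · have h1 : u < flowCDF ν t a := by
      conv_lhs => rw [← flowCDF_flowQuantile ν hν ht hu]
      exact hm ha
    filter_upwards [hs, continuousAt_snd.eventually_lt (hc a) h1] with q hq h2
    rw [← flowCDF_flowQuantile ν hν hq.1 hq.2] at h2
    exact (strictMono_flowCDF ν hν hq.1).lt_iff_lt.1 h2

/-- The velocity field of the Ornstein-Uhlenbeck flow started from `ν`. -/
def flowVel (t x : ℝ) : ℝ := -(flowTime ν t x / flowDens ν t x)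

lemma continuousOn_flowVel (hν : Integrable (fun y => y) ν) :
    ContinuousOn (fun q : ℝ × ℝ => flowVel ν q.1 q.2) (Set.Ioi 0 ×ˢ Set.univ) :=
  ((continuousOn_flowTime ν hν).div (continuousOn_flowDens ν) fun q hq =>
    (flowDens_pos ν hq.1 q.2).ne').neg

lemma hasDerivAt_flowQuantile (hν : Integrable (fun y => y) ν) {t u : ℝ} (ht : 0 < t)
    (hu : u ∈ Set.Ioo (0 : ℝ) 1) :
    HasDerivAt (fun t => flowQuantile ν t u) (flowVel ν t (flowQuantile ν t u)) t := by
  set x := flowQuantile ν t u with hx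
  set A := flowTime ν t x
  set B := flowDens ν t x
  have hB : B ≠ 0 := (flowDens_pos ν ht x).ne'
  let f₁ : ℝ × ℝ →L[ℝ] ℝ × ℝ := (ContinuousLinearMap.fst ℝ ℝ ℝ).prod
    (A • ContinuousLinearMap.fst ℝ ℝ ℝ + B • ContinuousLinearMap.snd ℝ ℝ ℝ)
  let f₂ : ℝ × ℝ →L[ℝ] ℝ × ℝ := (ContinuousLinearMap.fst ℝ ℝ ℝ).prod
    (-(A / B) • ContinuousLinearMap.fst ℝ ℝ ℝ + B⁻¹ • ContinuousLinearMap.snd ℝ ℝ ℝ)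
  let e : (ℝ × ℝ) ≃L[ℝ] ℝ × ℝ := ContinuousLinearEquiv.equivOfInverse f₁ f₂
    (fun q => by ext <;> simp [f₁, f₂]; field_simp; ring)
    (fun q => by ext <;> simp [f₁, f₂]; field_simp; ring)
  have hs : ∀ᶠ q : ℝ × ℝ in 𝓝 (t, u), 0 < q.1 ∧ q.2 ∈ Set.Ioo (0 : ℝ) 1 :=
    ((isOpen_Ioi (a := (0 : ℝ))).prod (isOpen_Ioo (a := (0 : ℝ)) (b := 1))).mem_nhds ⟨ht, hu⟩
  have key : HasFDerivAt (fun q : ℝ × ℝ => (q.1, flowQuantile ν q.1 q.2))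
      (e.symm : ℝ × ℝ →L[ℝ] ℝ × ℝ) (t, u) := by
    refine HasFDerivAt.of_local_left_inverse (f := fun q : ℝ × ℝ => (q.1, flowCDF ν q.1 q.2))
      (continuousAt_fst.prodMk (continuousAt_flowQuantile ν hν ht hu)) ?_ ?_
    · exact hasFDerivAt_fst.prodMk (hasFDerivAt_flowCDF ν hν ht x)
    · filter_upwards [hs] with q hq
      simp [flowCDF_flowQuantile ν hν hq.1 hq.2]
  have h2 : HasDerivAt (fun t : ℝ => (t, u)) ((1 : ℝ), (0 : ℝ)) t :=
    (hasDerivAt_id t).prodMk (hasDerivAt_const t u)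
  have h3 : HasFDerivAt (fun q : ℝ × ℝ => flowQuantile ν q.1 q.2) _ (t, u) := key.snd
  refine (h3.comp_hasDerivAt t h2).congr_deriv ?_
  change (f₂ (1, 0)).2 = _
  simp [f₂, flowVel, A, B]

lemma lintegral_flowQuantile (hν : Integrable (fun y => y) ν) {t : ℝ} (ht : 0 < t)
    (h : ℝ → ℝ≥0∞) :
    ∫⁻ u in Set.Ioo (0 : ℝ) 1, h (flowQuantile ν t u) =
      ∫⁻ x, ENNReal.ofReal (flowDens ν t x) * h x := by
  rw [← range_flowCDF ν hν ht, ← Set.image_univ,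
    lintegral_image_eq_lintegral_abs_deriv_mul MeasurableSet.univ
      (fun x _ => (hasDerivAt_flowCDF ν hν ht x).hasDerivWithinAt)
      (strictMono_flowCDF ν hν ht).injective.injOn, Measure.restrict_univ]
  refine lintegral_congr fun x => ?_
  rw [flowQuantile_flowCDF ν hν ht, abs_of_pos (flowDens_pos ν ht x)]

lemma ofReal_flowDens {t : ℝ} (ht : 0 < t) (x : ℝ) :
    ENNReal.ofReal (flowDens ν t x) =
      ∫⁻ y, ENNReal.ofReal (gpdf (ouNoise t x y) * (1 / ouSd t)) ∂ν := by
  rw [flowDens, ofReal_integral_eq_lintegral_ofReal (integrable_gpdf_ouNoise ν t x)]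
  exact Filter.Eventually.of_forall fun y =>
    mul_nonneg (gpdf_pos _).le (one_div_pos.2 (ouSd_pos ht)).le

end Quantile

lemma measurable_ouNoise (t : ℝ) : Measurable fun q : ℝ × ℝ => ouNoise t q.1 q.2 := by
  unfold ouNoise; fun_prop

lemma lintegral_gaussian_eq_ouNoise {t : ℝ} (ht : 0 < t) (y : ℝ) {h : ℝ → ℝ≥0∞} :
    ∫⁻ x, ENNReal.ofReal (gpdf (ouNoise t x y) * (1 / ouSd t)) * h (ouNoise t x y) =
      ∫⁻ z, h z ∂gaussianReal 0 1 := by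
  have hb := ouSd_pos ht
  have h1 : ∫⁻ z, h z ∂gaussianReal 0 1 = ∫⁻ z, ENNReal.ofReal (gpdf z) * h z := by
    rw [gaussianReal_of_var_ne_zero 0 one_ne_zero,
      lintegral_withDensity_eq_lintegral_mul_non_measurable _ (measurable_gaussianPDF 0 1)]
    · rfl
    · exact Filter.Eventually.of_forall fun x => ENNReal.ofReal_lt_top
  have h2 := lintegral_image_eq_lintegral_abs_deriv_mul (s := Set.univ) MeasurableSet.univ
    (f := fun x => ouNoise t x y) (f' := fun _ => 1 / ouSd t)
    (fun x _ => (by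
      unfold ouNoise
      exact (((hasDerivAt_id x).sub_const _).div_const _).hasDerivWithinAt))
    (fun x _ x' _ hx => by
      simp only [ouNoise] at hx
      field_simp at hx
      linarith) (fun z => ENNReal.ofReal (gpdf z) * h z)
  have h3 : (fun x => ouNoise t x y) '' Set.univ = Set.univ := by
    refine Set.eq_univ_of_forall fun z => ⟨ouSd t * z + exp (-t) * y, trivial, ?_⟩
    simp only [ouNoise]
    field_simp
    ring
  rw [h3, Measure.restrict_univ] at h2
  rw [h1, h2]
  refine lintegral_congr fun x => ?_
  rw [← mul_assoc, ← ENNReal.ofReal_mul (abs_nonneg _), abs_of_pos (one_div_pos.2 hb), mul_comm (1 / _)]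

lemma lintegral_flowDens (ν : Measure ℝ) [IsProbabilityMeasure ν] {t : ℝ} (ht : 0 < t)
    {h : ℝ → ℝ≥0∞} (hh : Measurable h) :
    ∫⁻ x, ENNReal.ofReal (flowDens ν t x) * h x =
      ∫⁻ y, ∫⁻ z, h (exp (-t) * y + ouSd t * z) ∂gaussianReal 0 1 ∂ν := by
  have hb := (ouSd_pos ht).ne'
  have h0 : ∀ x y, h x = h (exp (-t) * y + ouSd t * ouNoise t x y) := fun x y => by
    congr 1; unfold ouNoise; field_simp; ring
  calc _ = ∫⁻ x, ∫⁻ y, ENNReal.ofReal (gpdf (ouNoise t x y) * (1 / ouSd t)) * h x ∂ν := by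
        refine lintegral_congr fun x => ?_
        rw [ofReal_flowDens ν ht, lintegral_mul_const]
        exact ((continuous_gpdf.comp (continuous_ouNoise_right t x)).measurable.mul_const
          _).ennreal_ofReal
    _ = ∫⁻ y, (∫⁻ x, ENNReal.ofReal (gpdf (ouNoise t x y) * (1 / ouSd t)) * h x) ∂ν := by
        rw [lintegral_lintegral_swap]
        exact (((continuous_gpdf.measurable.comp (measurable_ouNoise t)).mul_const
          _).ennreal_ofReal.mul (hh.comp measurable_fst)).aemeasurable
    _ = _ := by
        refine lintegral_congr fun y => ?_
        rw [← lintegral_gaussian_eq_ouNoise ht y]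
        exact lintegral_congr fun x => by rw [← h0]

/-- **Minkowski's integral inequality** for nonnegative functions. -/
theorem lintegral_rpow_lintegral_le {α β : Type*} [MeasurableSpace α] [MeasurableSpace β]
    (μ : Measure α) (ρ : Measure β) [SigmaFinite μ] [SFinite ρ] {p : ℝ} (hp : 1 ≤ p)
    {h : α → β → ℝ≥0∞} (hh : Measurable (Function.uncurry h)) :
    (∫⁻ u, (∫⁻ t, h t u ∂μ) ^ p ∂ρ) ^ (1 / p) ≤
      ∫⁻ t, (∫⁻ u, h t u ^ p ∂ρ) ^ (1 / p) ∂μ := by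
  have hp0 : 0 < p := by linarith
  rcases hp.eq_or_lt with rfl | hp1
  · simp only [ENNReal.rpow_one, div_one]
    rw [lintegral_lintegral_swap]
    exact (hh.comp measurable_swap).aemeasurable
  set w : α → ℝ≥0∞ := fun t => (∫⁻ u, h t u ^ p ∂ρ) ^ (1 / p) with hw
  have hhp : Measurable (Function.uncurry fun t u => h t u ^ p) := hh.pow_const p
  have hwm : Measurable w := (hhp.lintegral_prod_right').pow_const _
  by_cases hI : ∫⁻ t, w t ∂μ = ∞
  · rw [hI]; exact le_top
  refine ENNReal.le_of_forall_pos_le_add fun ε hε _ => ?_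
  obtain ⟨g, hg, hgm, hgε⟩ := exists_pos_lintegral_lt_of_sigmaFinite μ
    (ε := (ε : ℝ≥0∞)) (by exact_mod_cast hε.ne')
  set W : α → ℝ≥0∞ := fun t => w t + g t with hW
  have hWm : Measurable W := hwm.add hgm.coe_nnreal_ennreal
  set A := ∫⁻ t, W t ∂μ with hA
  have hAle : A ≤ ∫⁻ t, w t ∂μ + ε := by
    rw [hA, lintegral_add_left hwm]
    gcongr
  have hAtop : A ≠ ∞ := ne_top_of_le_ne_top (ENNReal.add_ne_top.2 ⟨hI, ENNReal.coe_ne_top⟩) hAle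
  have hWtop : ∀ᵐ t ∂μ, W t < ∞ := ae_lt_top hWm hAtop
  have hW0 : ∀ t, W t ≠ 0 := fun t => by
    have : (g t : ℝ≥0∞) ≠ 0 := by exact_mod_cast (hg t).ne'
    simp [hW, this]
  refine le_trans ?_ hAle
  have hpq : p.HolderConjugate (p / (p - 1)) := Real.HolderConjugate.conjExponent hp1
  have hq : 1 / (p / (p - 1)) = (p - 1) / p := one_div_div _ _
  have h1 : ∀ u, (∫⁻ t, h t u ∂μ) ^ p ≤
      A ^ (p - 1) * ∫⁻ t, h t u ^ p * W t ^ (1 - p) ∂μ := fun u => by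
    have hm : Measurable fun t => h t u := hh.comp measurable_prodMk_right
    have h2 := ENNReal.lintegral_mul_le_Lp_mul_Lq μ hpq
      (f := fun t => h t u * W t ^ ((1 - p) / p)) (g := fun t => W t ^ ((p - 1) / p))
      (hm.mul (hWm.pow_const _)).aemeasurable (hWm.pow_const _).aemeasurable
    have h3 : ∫⁻ t, h t u ∂μ = ∫⁻ t, ((fun t => h t u * W t ^ ((1 - p) / p)) *
        fun t => W t ^ ((p - 1) / p)) t ∂μ := by
      refine lintegral_congr_ae ?_
      filter_upwards [hWtop] with t ht
      simp only [Pi.mul_apply]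
      rw [mul_assoc, ← ENNReal.rpow_add _ _ (hW0 t) ht.ne]
      rw [← add_div]
      simp
    have h4 : ∀ t, (h t u * W t ^ ((1 - p) / p)) ^ p = h t u ^ p * W t ^ (1 - p) := fun t => by
      rw [ENNReal.mul_rpow_of_nonneg _ _ hp0.le, ← ENNReal.rpow_mul, div_mul_cancel₀ _ hp0.ne']
    have h5 : ∀ t, (W t ^ ((p - 1) / p)) ^ (p / (p - 1)) = W t := fun t => by
      rw [← ENNReal.rpow_mul, div_mul_div_cancel₀ hp0.ne', div_self (by linarith), ENNReal.rpow_one]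
    rw [← h3] at h2
    simp only [h4, h5] at h2
    calc _ ≤ _ := ENNReal.rpow_le_rpow h2 hp0.le
      _ = _ := by
        rw [ENNReal.mul_rpow_of_nonneg _ _ hp0.le, ← ENNReal.rpow_mul, ← ENNReal.rpow_mul, hq,
          div_mul_cancel₀ _ hp0.ne', div_mul_cancel₀ _ hp0.ne', ENNReal.rpow_one, mul_comm]
  have hm2 : Measurable (Function.uncurry fun t u => h t u ^ p * W t ^ (1 - p)) :=
    hhp.mul ((hWm.pow_const _).comp measurable_fst)
  have h6 : ∫⁻ u, (∫⁻ t, h t u ∂μ) ^ p ∂ρ ≤ A ^ p := by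
    calc _ ≤ ∫⁻ u, A ^ (p - 1) * ∫⁻ t, h t u ^ p * W t ^ (1 - p) ∂μ ∂ρ := lintegral_mono h1
      _ = A ^ (p - 1) * ∫⁻ u, ∫⁻ t, h t u ^ p * W t ^ (1 - p) ∂μ ∂ρ := by
        rw [lintegral_const_mul]
        exact hm2.lintegral_prod_left'
      _ = A ^ (p - 1) * ∫⁻ t, ∫⁻ u, h t u ^ p * W t ^ (1 - p) ∂ρ ∂μ := by
        rw [lintegral_lintegral_swap]
        exact (hm2.comp measurable_swap).aemeasurable
      _ = A ^ (p - 1) * ∫⁻ t, w t ^ p * W t ^ (1 - p) ∂μ := by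
        congr 1
        refine lintegral_congr fun t => ?_
        rw [lintegral_mul_const]
        · congr 1
          rw [hw]
          simp only
          rw [← ENNReal.rpow_mul, one_div_mul_cancel hp0.ne', ENNReal.rpow_one]
        · exact hhp.comp measurable_prodMk_left
      _ ≤ A ^ (p - 1) * A := by
        gcongr
        rw [hA]
        refine lintegral_mono_ae ?_
        filter_upwards [hWtop] with t ht
        calc _ ≤ W t ^ p * W t ^ (1 - p) := by
              gcongr
              exact le_self_add
          _ = W t := by
            rw [← ENNReal.rpow_add _ _ (hW0 t) ht.ne]
            simp
      _ = A ^ p := by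
        rcases eq_or_ne A 0 with h0 | h0
        · rw [h0, mul_zero, ENNReal.zero_rpow_of_pos hp0]
        · conv_lhs => rw [← ENNReal.rpow_one A, ← ENNReal.rpow_mul,
            ← ENNReal.rpow_add _ _ h0 hAtop]
          congr 1; ring
  calc _ ≤ (A ^ p) ^ (1 / p) := ENNReal.rpow_le_rpow h6 (by positivity)
    _ = A := by rw [← ENNReal.rpow_mul, mul_one_div_cancel hp0.ne', ENNReal.rpow_one]

lemma exists_tendsto_of_hasDerivAt_Ioi {f f' : ℝ → ℝ} (hd : ∀ t, 0 < t → HasDerivAt f (f' t) t)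
    (hi : IntegrableOn f' (Set.Ioi 0)) :
    ∃ a b, Filter.Tendsto f (𝓝[>] 0) (𝓝 a) ∧ Filter.Tendsto f Filter.atTop (𝓝 b) ∧
      ‖a - b‖ₑ ≤ ∫⁻ t in Set.Ioi (0 : ℝ), ‖f' t‖ₑ := by
  have hii : ∀ r t : ℝ, 0 ≤ r → r ≤ t → IntervalIntegrable f' volume r t := fun r t hr hrt =>
    (intervalIntegrable_iff_integrableOn_Ioc_of_le hrt).2
      (hi.mono_set fun x hx => hr.trans_lt hx.1)
  have hftc : ∀ r t : ℝ, 0 < r → r ≤ t → ∫ x in r..t, f' x = f t - f r := fun r t hr hrt =>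
    intervalIntegral.integral_eq_sub_of_hasDerivAt
      (fun x hx => hd x (hr.trans_le ((Set.uIcc_of_le hrt ▸ hx).1))) (hii r t hr.le hrt)
  have hb := tendsto_limUnder_of_hasDerivAt_of_integrableOn_Ioi (a := 0) (f := f) (f' := f')
    (fun x hx => hd x hx) hi
  have ha : Filter.Tendsto f (𝓝[>] 0) (𝓝 (f 1 - ∫ x in (0 : ℝ)..1, f' x)) := by
    have hc := intervalIntegral.continuousOn_primitive_interval_left (f := f') (μ := volume)
      (a := 0) (b := 1) (by
        rw [Set.uIcc_of_le zero_le_one]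
        rw [integrableOn_Icc_iff_integrableOn_Ioc]
        exact (hi.mono_set fun x hx => hx.1))
    have h1 := (hc 0 (by simp)).tendsto
    rw [Set.uIcc_of_le zero_le_one, ← Set.Ioc_union_left zero_le_one] at h1
    have h2 : Filter.Tendsto (fun x => ∫ t in x..1, f' t) (𝓝[Set.Ioc 0 1] 0)
        (𝓝 (∫ x in (0 : ℝ)..1, f' x)) := h1.mono_left (nhdsWithin_mono _ Set.subset_union_left)
    rw [nhdsWithin_Ioc_eq_nhdsGT zero_lt_one] at h2
    refine (tendsto_const_nhds.sub h2).congr' ?_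
    filter_upwards [Ioc_mem_nhdsGT (zero_lt_one (α := ℝ))] with x hx
    rw [hftc x 1 hx.1 hx.2]; ring
  refine ⟨_, _, ha, hb, ?_⟩
  have hτ : Filter.Tendsto (fun n : ℕ => 1 / ((n : ℝ) + 1)) Filter.atTop (𝓝[>] 0) :=
    tendsto_nhdsWithin_iff.2 ⟨tendsto_one_div_add_atTop_nhds_zero_nat,
      Filter.Eventually.of_forall fun n => by simp only [Set.mem_Ioi]; positivity⟩
  have hσ : Filter.Tendsto (fun n : ℕ => (n : ℝ) + 1) Filter.atTop Filter.atTop :=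
    Filter.tendsto_atTop_add_const_right _ _ tendsto_natCast_atTop_atTop
  refine le_of_tendsto (((ha.comp hτ).sub (hb.comp hσ)).enorm) (Filter.Eventually.of_forall
    fun n => ?_)
  have h1 : (0 : ℝ) < 1 / ((n : ℝ) + 1) := by positivity
  have h2 : 1 / ((n : ℝ) + 1) ≤ (n : ℝ) + 1 := by
    rw [div_le_iff₀ (by positivity)]
    nlinarith [(Nat.cast_nonneg n : (0 : ℝ) ≤ n)]
  simp only [Function.comp_apply]
  rw [← neg_sub, enorm_neg, ← hftc _ _ h1 h2, intervalIntegral.integral_of_le h2]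
  refine (enorm_integral_le_lintegral_enorm _).trans (lintegral_mono_set fun x hx => h1.trans hx.1)

section Coupling

variable (ν : Measure ℝ) [IsProbabilityMeasure ν]

lemma aemeasurable_flowQuantile (hν : Integrable (fun y => y) ν) {t : ℝ} (ht : 0 < t) :
    AEMeasurable (flowQuantile ν t) (volume.restrict (Set.Ioo 0 1)) := by
  refine ContinuousOn.aemeasurable (fun u hu => ContinuousAt.continuousWithinAt ?_)
    measurableSet_Ioo
  exact ContinuousAt.comp (g := fun q : ℝ × ℝ => flowQuantile ν q.1 q.2) (f := fun u => (t, u))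
    (continuousAt_flowQuantile ν hν ht hu) (by fun_prop)

lemma map_limit_flowQuantile (hν : Integrable (fun y => y) ν) {τ : ℕ → ℝ} (hτ : ∀ n, 0 < τ n)
    {a b : ℝ} (ha : Filter.Tendsto (fun n => exp (-τ n)) Filter.atTop (𝓝 a))
    (hb : Filter.Tendsto (fun n => ouSd (τ n)) Filter.atTop (𝓝 b)) {L : ℝ → ℝ}
    (hL : ∀ᵐ u ∂volume.restrict (Set.Ioo (0 : ℝ) 1),
      Filter.Tendsto (fun n => flowQuantile ν (τ n) u) Filter.atTop (𝓝 (L u))) :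
    AEMeasurable L (volume.restrict (Set.Ioo 0 1)) ∧
    (volume.restrict (Set.Ioo 0 1)).map L =
      (ν.prod (gaussianReal 0 1)).map (fun q => a * q.1 + b * q.2) := by
  have hm : AEMeasurable L (volume.restrict (Set.Ioo 0 1)) :=
    aemeasurable_of_tendsto_metrizable_ae _ (fun n => aemeasurable_flowQuantile ν hν (hτ n)) hL
  refine ⟨hm, ?_⟩
  have hm2 : Measurable fun q : ℝ × ℝ => a * q.1 + b * q.2 := by fun_prop
  have : IsFiniteMeasure ((volume.restrict (Set.Ioo (0 : ℝ) 1)).map L) :=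
    Measure.isFiniteMeasure_map _ _
  have : IsFiniteMeasure ((ν.prod (gaussianReal 0 1)).map (fun q => a * q.1 + b * q.2)) :=
    Measure.isFiniteMeasure_map _ _
  refine ext_of_forall_lintegral_eq_of_IsFiniteMeasure fun f => ?_
  have hf : Measurable fun x => (f x : ℝ≥0∞) := f.continuous.measurable.coe_nnreal_ennreal
  rw [lintegral_map' hf.aemeasurable hm, lintegral_map hf hm2]
  have hbd : ∀ x, (f x : ℝ≥0∞) ≤ nndist 0 f := fun x => by
    exact_mod_cast f.apply_le_nndist_zero x
  have h1 : Filter.Tendsto (fun n => ∫⁻ u in Set.Ioo (0 : ℝ) 1, (f (flowQuantile ν (τ n) u) : ℝ≥0∞))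
      Filter.atTop (𝓝 (∫⁻ u in Set.Ioo (0 : ℝ) 1, (f (L u) : ℝ≥0∞))) := by
    refine tendsto_lintegral_of_dominated_convergence' (fun _ => (nndist 0 f : ℝ≥0∞))
      (fun n => hf.comp_aemeasurable (aemeasurable_flowQuantile ν hν (hτ n)))
      (fun n => Filter.Eventually.of_forall fun u => hbd _) (by simp) ?_
    filter_upwards [hL] with u hu
    exact ENNReal.tendsto_coe.2 ((f.continuous.tendsto _).comp hu)
  have h2 : Filter.Tendsto (fun n => ∫⁻ q, (f (exp (-τ n) * q.1 + ouSd (τ n) * q.2) : ℝ≥0∞)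
      ∂(ν.prod (gaussianReal 0 1)))
      Filter.atTop (𝓝 (∫⁻ q, (f (a * q.1 + b * q.2) : ℝ≥0∞) ∂(ν.prod (gaussianReal 0 1)))) := by
    refine tendsto_lintegral_of_dominated_convergence (fun _ => (nndist 0 f : ℝ≥0∞))
      (fun n => hf.comp (by fun_prop))
      (fun n => Filter.Eventually.of_forall fun u => hbd _) (by simp)
      (Filter.Eventually.of_forall fun q => ?_)
    exact ENNReal.tendsto_coe.2 ((f.continuous.tendsto _).comp
      ((ha.mul_const _).add (hb.mul_const _)))
  refine tendsto_nhds_unique h1 (h2.congr fun n => ?_)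
  rw [lintegral_flowQuantile ν hν (hτ n) (fun x => (f x : ℝ≥0∞)), lintegral_flowDens ν (hτ n) hf,
    lintegral_prod]
  exact (hf.comp (by fun_prop)).aemeasurable

theorem wassersteinDist_gaussianReal_le (hν : Integrable (fun y => y) ν) {p : ℝ} (hp : 1 ≤ p) :
    wassersteinDist p ν (gaussianReal 0 1) ≤
      ∫⁻ t in Set.Ioi (0 : ℝ),
        (∫⁻ x, ENNReal.ofReal (flowDens ν t x) * ‖flowVel ν t x‖ₑ ^ p) ^ (1 / p) := by
  have hp0 : 0 < p := by linarith
  set ρ : Measure ℝ := volume.restrict (Set.Ioo 0 1) with hρ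
  have : IsProbabilityMeasure ρ := ⟨by simp [hρ]⟩
  set D : Set (ℝ × ℝ) := Set.Ioi 0 ×ˢ Set.Ioo 0 1 with hD
  have hDm : MeasurableSet D := measurableSet_Ioi.prod measurableSet_Ioo
  set k : ℝ × ℝ → ℝ := fun q => flowVel ν q.1 (flowQuantile ν q.1 q.2) with hk
  have hkc : ContinuousOn k D := by
    refine ContinuousOn.comp (g := fun r : ℝ × ℝ => flowVel ν r.1 r.2)
      (f := fun q : ℝ × ℝ => (q.1, flowQuantile ν q.1 q.2)) (t := Set.Ioi 0 ×ˢ Set.univ)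
      (continuousOn_flowVel ν hν) (continuousOn_fst.prodMk fun q hq =>
        (continuousAt_flowQuantile ν hν hq.1 hq.2).continuousWithinAt) ?_
    exact fun q hq => ⟨hq.1, trivial⟩
  set h : ℝ → ℝ → ℝ≥0∞ := fun t u => D.indicator (fun q => ‖k q‖ₑ) (t, u) with hh
  have hhm : Measurable (Function.uncurry h) := by
    have : Measurable (D.indicator k) := by
      rw [← Set.piecewise_eq_indicator]
      exact hkc.measurable_piecewise continuousOn_const hDm
    have h2 : Function.uncurry h = fun q => ‖D.indicator k q‖ₑ := by
      ext q
      simp only [hh, Function.uncurry]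
      by_cases hq : q ∈ D <;> simp [hq]
    rw [h2]
    exact this.enorm
  have hmink := lintegral_rpow_lintegral_le (volume.restrict (Set.Ioi (0 : ℝ))) ρ hp hhm
  have h1 : ∫⁻ t in Set.Ioi (0 : ℝ), (∫⁻ u, h t u ^ p ∂ρ) ^ (1 / p) =
      ∫⁻ t in Set.Ioi (0 : ℝ),
        (∫⁻ x, ENNReal.ofReal (flowDens ν t x) * ‖flowVel ν t x‖ₑ ^ p) ^ (1 / p) := by
    refine setLIntegral_congr_fun measurableSet_Ioi fun t ht => ?_
    rw [← lintegral_flowQuantile ν hν ht (fun x => ‖flowVel ν t x‖ₑ ^ p)]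
    congr 1
    refine setLIntegral_congr_fun measurableSet_Ioo fun u hu => ?_
    have : (t, u) ∈ D := ⟨ht, hu⟩
    simp [hh, this, hk]
  rw [h1] at hmink
  refine le_trans ?_ hmink
  set J := ∫⁻ t in Set.Ioi (0 : ℝ),
        (∫⁻ x, ENNReal.ofReal (flowDens ν t x) * ‖flowVel ν t x‖ₑ ^ p) ^ (1 / p) with hJ
  by_cases hfin : (∫⁻ u, (∫⁻ t in Set.Ioi (0 : ℝ), h t u) ^ p ∂ρ) ^ (1 / p) = ∞
  · rw [hfin]; exact le_top
  have hfin2 : ∫⁻ u, (∫⁻ t in Set.Ioi (0 : ℝ), h t u) ^ p ∂ρ ≠ ∞ := fun hc => by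
    rw [hc, ENNReal.top_rpow_of_pos (by positivity)] at hfin
    exact hfin rfl
  have hgood : ∀ᵐ u ∂ρ, ∃ a b, Filter.Tendsto (fun t => flowQuantile ν t u) (𝓝[>] 0) (𝓝 a) ∧
      Filter.Tendsto (fun t => flowQuantile ν t u) Filter.atTop (𝓝 b) ∧
      ‖a - b‖ₑ ≤ ∫⁻ t in Set.Ioi (0 : ℝ), h t u := by
    have hae := ae_lt_top ((hhm.lintegral_prod_left' (μ := volume.restrict (Set.Ioi (0 : ℝ)))).pow_const p) hfin2
    filter_upwards [hae, ae_restrict_mem measurableSet_Ioo] with u hu1 hu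
    have e : ∫⁻ t in Set.Ioi (0 : ℝ), h t u = ∫⁻ t in Set.Ioi (0 : ℝ), ‖k (t, u)‖ₑ := by
      refine setLIntegral_congr_fun measurableSet_Ioi fun t ht => ?_
      have : (t, u) ∈ D := ⟨ht, hu⟩
      simp [hh, this]
    have hu2 : ∫⁻ t in Set.Ioi (0 : ℝ), h t u < ∞ := by
      rw [ENNReal.rpow_lt_top_iff_of_pos hp0] at hu1
      exact hu1
    rw [e] at hu2 ⊢
    refine exists_tendsto_of_hasDerivAt_Ioi (f' := fun t => k (t, u))
      (fun t ht => hasDerivAt_flowQuantile ν hν ht hu) ⟨?_, hu2⟩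
    refine ContinuousOn.aestronglyMeasurable (fun t ht => ?_) measurableSet_Ioi
    exact ContinuousWithinAt.comp (g := k) (f := fun t => (t, u)) (t := D) (hkc (t, u) ⟨ht, hu⟩)
      (by fun_prop) (fun t ht => ⟨ht, hu⟩)
  set T₀ : ℝ → ℝ := fun u => (𝓝[>] 0).limUnder (fun t => flowQuantile ν t u)
  set T₁ : ℝ → ℝ := fun u => Filter.atTop.limUnder (fun t => flowQuantile ν t u)
  have hgood' : ∀ᵐ u ∂ρ, Filter.Tendsto (fun t => flowQuantile ν t u) (𝓝[>] 0) (𝓝 (T₀ u)) ∧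
      Filter.Tendsto (fun t => flowQuantile ν t u) Filter.atTop (𝓝 (T₁ u)) ∧
      ‖T₀ u - T₁ u‖ₑ ≤ ∫⁻ t in Set.Ioi (0 : ℝ), h t u := by
    filter_upwards [hgood] with u ⟨a, b, ha, hb, hab⟩
    have e1 : T₀ u = a := ha.limUnder_eq
    have e2 : T₁ u = b := hb.limUnder_eq
    rw [e1, e2]
    exact ⟨ha, hb, hab⟩
  have hτ : Filter.Tendsto (fun n : ℕ => 1 / ((n : ℝ) + 1)) Filter.atTop (𝓝[>] 0) :=
    tendsto_nhdsWithin_iff.2 ⟨tendsto_one_div_add_atTop_nhds_zero_nat,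
      Filter.Eventually.of_forall fun n => by simp only [Set.mem_Ioi]; positivity⟩
  have hσ : Filter.Tendsto (fun n : ℕ => (n : ℝ) + 1) Filter.atTop Filter.atTop :=
    Filter.tendsto_atTop_add_const_right _ _ tendsto_natCast_atTop_atTop
  have hsdc : Continuous ouSd := by unfold ouSd; fun_prop
  obtain ⟨m0, law0⟩ := map_limit_flowQuantile ν hν (τ := fun n : ℕ => 1 / ((n : ℝ) + 1))
    (a := 1) (b := 0) (L := T₀) (fun n => by positivity)
    (by
      have : Filter.Tendsto (fun t : ℝ => exp (-t)) (𝓝[>] 0) (𝓝 (exp (-0))) :=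
        (Continuous.tendsto (by fun_prop) 0).mono_left nhdsWithin_le_nhds
      rw [neg_zero, exp_zero] at this
      exact this.comp hτ)
    (by
      have : Filter.Tendsto ouSd (𝓝[>] 0) (𝓝 (ouSd 0)) :=
        (hsdc.tendsto 0).mono_left nhdsWithin_le_nhds
      rw [show ouSd 0 = 0 by simp [ouSd]] at this
      exact this.comp hτ)
    (hgood'.mono fun u hu => hu.1.comp hτ)
  obtain ⟨m1, law1⟩ := map_limit_flowQuantile ν hν (τ := fun n : ℕ => (n : ℝ) + 1)
    (a := 0) (b := 1) (L := T₁) (fun n => by positivity)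
    (tendsto_exp_neg_atTop_nhds_zero.comp hσ)
    (by
      have h2 : Filter.Tendsto (fun t : ℝ => exp (-2 * t)) Filter.atTop (𝓝 0) :=
        tendsto_exp_atBot.comp (Filter.tendsto_id.const_mul_atTop_of_neg (by norm_num))
      have : Filter.Tendsto ouSd Filter.atTop (𝓝 √(1 - 0)) :=
        (continuous_sqrt.tendsto _).comp (h2.const_sub 1)
      rw [sub_zero, sqrt_one] at this
      exact this.comp hσ)
    (hgood'.mono fun u hu => hu.2.1.comp hσ)
  have law0' : ρ.map T₀ = ν := by
    rw [law0]
    simp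
  have law1' : ρ.map T₁ = gaussianReal 0 1 := by
    rw [law1]
    simp
  have mp : AEMeasurable (fun u => (T₀ u, T₁ u)) ρ := m0.prodMk m1
  have : IsProbabilityMeasure (ρ.map fun u => (T₀ u, T₁ u)) := Measure.isProbabilityMeasure_map mp
  unfold wassersteinDist
  refine iInf_le_of_le (ρ.map fun u => (T₀ u, T₁ u)) (iInf_le_of_le inferInstance
    (iInf_le_of_le ?_ (iInf_le_of_le ?_ ?_)))
  · rw [AEMeasurable.map_map_of_aemeasurable measurable_fst.aemeasurable mp]
    exact law0'
  · rw [AEMeasurable.map_map_of_aemeasurable measurable_snd.aemeasurable mp]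
    exact law1'
  · gcongr
    rw [lintegral_map' (by fun_prop) mp]
    refine lintegral_mono_ae ?_
    filter_upwards [hgood'] with u hu
    rw [← ENNReal.ofReal_rpow_of_nonneg (norm_nonneg _) hp0.le, ofReal_norm]
    gcongr
    exact hu.2.2

end Coupling

lemma exists_bound_mul_gpdf {f : ℝ → ℝ} (hf : ExpBdd f) : ∃ C, ∀ z, |f z * gpdf z| ≤ C := by
  obtain ⟨C, κ, hC, hκ, h⟩ := hf
  refine ⟨C * exp (κ ^ 2 / 2), fun z => ?_⟩
  rw [abs_mul, abs_of_pos (gpdf_pos z)]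
  calc |f z| * gpdf z ≤ (C * exp (κ * |z|)) * exp (-z ^ 2 / 2) :=
        mul_le_mul (h z) (gpdf_le_exp z) (gpdf_pos z).le (by positivity)
    _ = C * exp (κ * |z| + -z ^ 2 / 2) := by rw [mul_assoc, exp_add]
    _ ≤ _ := by
      gcongr
      nlinarith [sq_nonneg (κ - |z|), sq_abs z]

lemma lintegral_hermiteSum_rpow_le {p : ℝ} (hp : 1 ≤ p) (N : ℕ) (c : ℕ → ℝ) :
    ∫⁻ z, ‖hermiteSum N c 1 z‖ₑ ^ p ∂gaussianReal 0 1 ≤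
      ENNReal.ofReal (∑ j ∈ Finset.range N, c j ^ 2 * j.factorial * (max 1 (p - 1)) ^ j) ^
        (p / 2) := by
  have hp0 : 0 < p := by linarith
  set m := max 2 p with hm
  have hm2 : 2 ≤ m := le_max_left _ _
  have hm0 : 0 < m := by linarith
  have hq : max 1 (p - 1) = m - 1 := by rw [hm, ← max_sub_sub_right]; norm_num
  have hcont := continuous_hermiteSum N c 1
  have h1 := eLpNorm'_le_eLpNorm'_of_exponent_le (μ := gaussianReal 0 1) hp0
    (le_max_right 2 p : p ≤ m) hcont.aestronglyMeasurable
  have hintg : Integrable (fun z => |hermiteSum N c 1 z| ^ m) (gaussianReal 0 1) :=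
    ((expBdd_hermiteSum N c 1).rpow hm0.le).integrable
      (hcont.abs.rpow_const fun _ => Or.inr hm0.le).aestronglyMeasurable
  have h2 : ∫⁻ z, ‖hermiteSum N c 1 z‖ₑ ^ m ∂gaussianReal 0 1 =
      ENNReal.ofReal (∫ z, |hermiteSum N c 1 z| ^ m ∂gaussianReal 0 1) := by
    rw [ofReal_integral_eq_lintegral_ofReal hintg
      (Filter.Eventually.of_forall fun z => by positivity)]
    refine lintegral_congr fun z => ?_
    rw [← ENNReal.ofReal_rpow_of_nonneg (abs_nonneg _) hm0.le, ← Real.norm_eq_abs, ofReal_norm]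
  have hI0 : 0 ≤ ∫ z, |hermiteSum N c 1 z| ^ m ∂gaussianReal 0 1 :=
    integral_nonneg fun z => by positivity
  unfold eLpNorm' at h1
  rw [h2] at h1
  have h3 := ENNReal.rpow_le_rpow h1 hp0.le
  rw [← ENNReal.rpow_mul, one_div_mul_cancel hp0.ne', ENNReal.rpow_one] at h3
  refine h3.trans ?_
  rw [← ENNReal.rpow_mul, show 1 / m * p = (2 / m) * (p / 2) by ring, ENNReal.rpow_mul,
    ENNReal.ofReal_rpow_of_nonneg hI0 (by positivity), hq]
  gcongr
  exact hermiteSum_hypercontractive hm2 N c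

lemma lintegral_hermiteR_le (j : ℕ) :
    ∫⁻ z, ‖hermiteR j z‖ₑ ∂gaussianReal 0 1 ≤ ENNReal.ofReal √j.factorial := by
  have h := lintegral_hermiteSum_rpow_le le_rfl (j + 1) (Pi.single j (1 : ℝ))
  have e : ∀ z, hermiteSum (j + 1) (Pi.single j (1 : ℝ)) 1 z = hermiteR j z := fun z => by
    rw [hermiteSum, Finset.sum_eq_single j]
    · simp
    · intro i _ hi; simp [hi]
    · simp
  have e2 : ∑ i ∈ Finset.range (j + 1), (Pi.single j (1 : ℝ) : ℕ → ℝ) i ^ 2 * i.factorial *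
      (max 1 ((1 : ℝ) - 1)) ^ i = j.factorial := by
    rw [Finset.sum_eq_single j]
    · simp
    · intro i _ hi; simp [hi]
    · simp
  simp only [e, e2, ENNReal.rpow_one] at h
  refine h.trans_eq ?_
  rw [sqrt_eq_rpow, ENNReal.ofReal_rpow_of_nonneg (by positivity) (by positivity)]

lemma abs_pow_le_sqrt_factorial_mul_exp {κ : ℝ} (hκ : 0 < κ) (w : ℝ) (k : ℕ) :
    |w| ^ k ≤ √k.factorial * (1 / √κ) ^ k * exp (κ * w ^ 2 / 2) := by
  have h1 := pow_div_factorial_le_exp (x := κ * w ^ 2) (by positivity) k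
  rw [div_le_iff₀ (by positivity)] at h1
  have h2 := sqrt_le_sqrt h1
  have hs : 0 < √κ := sqrt_pos.2 hκ
  have e1 : √((κ * w ^ 2) ^ k) = (√κ * |w|) ^ k := by
    rw [← sqrt_sq (by positivity : 0 ≤ (√κ * |w|) ^ k)]
    congr 1
    rw [← pow_mul, mul_comm k 2, pow_mul, mul_pow √κ, sq_sqrt hκ.le, sq_abs]
  have e2 : √(exp (κ * w ^ 2) * k.factorial) = exp (κ * w ^ 2 / 2) * √k.factorial := by
    rw [sqrt_mul (exp_pos _).le, exp_half]
  rw [e1, e2, mul_pow] at h2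
  rw [one_div, inv_pow]
  have h3 : |w| ^ k ≤ (exp (κ * w ^ 2 / 2) * √k.factorial) / √κ ^ k := by
    rw [le_div_iff₀ (by positivity)]; linarith
  refine h3.trans_eq ?_
  field_simp

lemma integrable_pow_of_exp_sq {Ω : Type*} [MeasurableSpace Ω] (P : Measure Ω)
    {W : Ω → ℝ} (hW : Measurable W) {κ : ℝ} (hκ : 0 < κ)
    (hexp : ∫⁻ ω, ENNReal.ofReal (exp (κ * W ω ^ 2 / 2)) ∂P ≠ ∞) (k : ℕ) :
    Integrable (fun ω => W ω ^ k) P := by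
  have h1 : Integrable (fun ω => exp (κ * W ω ^ 2 / 2)) P := by
    refine ⟨(by fun_prop : Measurable _).aestronglyMeasurable, ?_⟩
    refine lt_of_eq_of_lt (lintegral_congr fun ω => ?_) hexp.lt_top
    rw [Real.enorm_of_nonneg (exp_pos _).le]
  refine (h1.const_mul (√k.factorial * (1 / √κ) ^ k)).mono' (hW.pow_const k).aestronglyMeasurable
    (Filter.Eventually.of_forall fun ω => ?_)
  rw [norm_pow, Real.norm_eq_abs]
  exact abs_pow_le_sqrt_factorial_mul_exp hκ _ k

section FixedTime

variable {Ω : Type*} [MeasurableSpace Ω] (P : Measure Ω)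

lemma measurable_ouNoise_comp {Y : Ω → ℝ} (hY : Measurable Y) (t : ℝ) :
    Measurable fun q : ℝ × Ω => ouNoise t q.1 (Y q.2) :=
  (measurable_ouNoise t).comp (measurable_fst.prodMk (hY.comp measurable_snd))

lemma ae_tsum_lintegral_ne_top [SFinite P] {W Y : Ω → ℝ} (hW : Measurable W) (hY : Measurable Y) {t ξ : ℝ}
    (ht : 0 < t) (hξ : 0 < ξ)
    (hexp : ∫⁻ ω, ENNReal.ofReal (exp ((1 + ξ) * W ω ^ 2 / 2)) ∂P ≠ ∞) :
    ∀ᵐ x : ℝ, ∑' j : ℕ, ∫⁻ ω, ‖W ω ^ (j + 1) / (j + 1).factorial *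
      (hermiteR j (ouNoise t x (Y ω)) * (gpdf (ouNoise t x (Y ω)) * (1 / ouSd t)))‖ₑ ∂P ≠ ∞ := by
  have hb := ouSd_pos ht
  set θ := 1 / √(1 + ξ) with hθ
  have hθ0 : 0 < θ := one_div_pos.2 (sqrt_pos.2 (by linarith))
  have hθ1 : θ < 1 := by
    rw [hθ, div_lt_one (sqrt_pos.2 (by linarith)), lt_sqrt zero_le_one]; linarith
  have hz := measurable_ouNoise_comp hY t
  have hm : ∀ j : ℕ, Measurable (Function.uncurry fun (x : ℝ) (ω : Ω) =>
      ‖W ω ^ (j + 1) / (j + 1).factorial *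
        (hermiteR j (ouNoise t x (Y ω)) * (gpdf (ouNoise t x (Y ω)) * (1 / ouSd t)))‖ₑ) := fun j =>
    ((((hW.comp measurable_snd).pow_const _).div_const _).mul
      (((continuous_hermiteR j).measurable.comp hz).mul
        ((continuous_gpdf.measurable.comp hz).mul_const _))).enorm
  have hj : ∀ j : ℕ, ∫⁻ x : ℝ, ∫⁻ ω, ‖W ω ^ (j + 1) / (j + 1).factorial *
      (hermiteR j (ouNoise t x (Y ω)) * (gpdf (ouNoise t x (Y ω)) * (1 / ouSd t)))‖ₑ ∂P ≤
      ENNReal.ofReal (θ ^ (j + 1)) * ∫⁻ ω, ENNReal.ofReal (exp ((1 + ξ) * W ω ^ 2 / 2)) ∂P := by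
    intro j
    rw [lintegral_lintegral_swap (hm j).aemeasurable, ← lintegral_const_mul _ (by fun_prop)]
    refine lintegral_mono fun ω => ?_
    have e : ∀ x, ‖W ω ^ (j + 1) / (j + 1).factorial *
        (hermiteR j (ouNoise t x (Y ω)) * (gpdf (ouNoise t x (Y ω)) * (1 / ouSd t)))‖ₑ =
        ‖W ω ^ (j + 1) / (j + 1).factorial‖ₑ *
        (ENNReal.ofReal (gpdf (ouNoise t x (Y ω)) * (1 / ouSd t)) *
          ‖hermiteR j (ouNoise t x (Y ω))‖ₑ) := fun x => by
      rw [enorm_mul, enorm_mul, mul_comm ‖hermiteR _ _‖ₑ, Real.enorm_of_nonneg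
        (mul_nonneg (gpdf_pos _).le (one_div_pos.2 hb).le)]
    simp only [e]
    rw [lintegral_const_mul' _ _ enorm_ne_top,
      lintegral_gaussian_eq_ouNoise ht (Y ω) (h := fun z => ‖hermiteR j z‖ₑ)]
    refine (mul_le_mul_right (lintegral_hermiteR_le j) _).trans ?_
    rw [← ofReal_norm, ← ENNReal.ofReal_mul (norm_nonneg _), ← ENNReal.ofReal_mul (by positivity)]
    refine ENNReal.ofReal_le_ofReal ?_
    have h1 := abs_pow_le_sqrt_factorial_mul_exp (show 0 < 1 + ξ by linarith) (W ω) (j + 1)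
    have h2 : √(j.factorial : ℝ) ≤ √((j + 1).factorial : ℝ) :=
      sqrt_le_sqrt (by exact_mod_cast Nat.factorial_le (Nat.le_succ j))
    have h3 : √((j + 1).factorial : ℝ) * √((j + 1).factorial : ℝ) = (j + 1).factorial :=
      mul_self_sqrt (by positivity)
    rw [norm_div, norm_pow, Real.norm_eq_abs, Real.norm_natCast, div_mul_eq_mul_div,
      div_le_iff₀ (by positivity)]
    calc |W ω| ^ (j + 1) * √(j.factorial : ℝ) ≤
        (√((j + 1).factorial : ℝ) * θ ^ (j + 1) * exp ((1 + ξ) * W ω ^ 2 / 2)) *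
          √((j + 1).factorial : ℝ) := by gcongr
      _ = (√((j + 1).factorial : ℝ) * √((j + 1).factorial : ℝ)) * (θ ^ (j + 1) *
          exp ((1 + ξ) * W ω ^ 2 / 2)) := by ring
      _ = _ := by rw [h3]; ring
  have hmj : ∀ j : ℕ, Measurable fun x : ℝ => ∫⁻ ω, ‖W ω ^ (j + 1) / (j + 1).factorial *
      (hermiteR j (ouNoise t x (Y ω)) * (gpdf (ouNoise t x (Y ω)) * (1 / ouSd t)))‖ₑ ∂P :=
    fun j => (hm j).lintegral_prod_right'
  have hfin : ∫⁻ x : ℝ, ∑' j : ℕ, ∫⁻ ω, ‖W ω ^ (j + 1) / (j + 1).factorial *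
      (hermiteR j (ouNoise t x (Y ω)) * (gpdf (ouNoise t x (Y ω)) * (1 / ouSd t)))‖ₑ ∂P ≠ ∞ := by
    rw [lintegral_tsum fun j => (hmj j).aemeasurable]
    refine ne_top_of_le_ne_top ?_ (ENNReal.tsum_le_tsum hj)
    rw [ENNReal.tsum_mul_right, ← ENNReal.ofReal_tsum_of_nonneg (fun j => by positivity)
      ((summable_nat_add_iff 1).2 (summable_geometric_of_lt_one hθ0.le hθ1))]
    exact ENNReal.mul_ne_top ENNReal.ofReal_ne_top hexp
  refine (ae_lt_top (Measurable.tsum hmj) hfin).mono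
    fun x hx => hx.ne

lemma hasSum_integral_hermite {W Y : Ω → ℝ} (hW : Measurable W) (hY : Measurable Y) {t x : ℝ}
    (hfin : ∑' j : ℕ, ∫⁻ ω, ‖W ω ^ (j + 1) / (j + 1).factorial *
      (hermiteR j (ouNoise t x (Y ω)) * (gpdf (ouNoise t x (Y ω)) * (1 / ouSd t)))‖ₑ ∂P ≠ ∞) :
    HasSum (fun j : ℕ => ∫ ω, W ω ^ (j + 1) / (j + 1).factorial *
      (hermiteR j (ouNoise t x (Y ω)) * (gpdf (ouNoise t x (Y ω)) * (1 / ouSd t))) ∂P)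
      (∫ ω, (gcdf (ouNoise t x (Y ω)) - gcdf (ouNoise t x (Y ω) - W ω)) * (1 / ouSd t) ∂P) := by
  have hz : Measurable fun ω => ouNoise t x (Y ω) :=
    (continuous_ouNoise_right t x).measurable.comp hY
  have hm : ∀ j : ℕ, Measurable fun ω => W ω ^ (j + 1) / (j + 1).factorial *
      (hermiteR j (ouNoise t x (Y ω)) * (gpdf (ouNoise t x (Y ω)) * (1 / ouSd t))) := fun j =>
    ((hW.pow_const _).div_const _).mul (((continuous_hermiteR j).measurable.comp hz).mul
      ((continuous_gpdf.measurable.comp hz).mul_const _))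
  have hi : ∀ j : ℕ, Integrable (fun ω => W ω ^ (j + 1) / (j + 1).factorial *
      (hermiteR j (ouNoise t x (Y ω)) * (gpdf (ouNoise t x (Y ω)) * (1 / ouSd t)))) P := fun j =>
    ⟨(hm j).aestronglyMeasurable, (ENNReal.ne_top_of_tsum_ne_top hfin j).lt_top⟩
  have hs : Summable fun j : ℕ => ∫ ω, ‖W ω ^ (j + 1) / (j + 1).factorial *
      (hermiteR j (ouNoise t x (Y ω)) * (gpdf (ouNoise t x (Y ω)) * (1 / ouSd t)))‖ ∂P := by
    simp only [integral_norm_eq_lintegral_enorm (hm _).aestronglyMeasurable]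
    exact ENNReal.summable_toReal hfin
  have h := hasSum_integral_of_summable_integral_norm hi hs
  have e : ∀ ω, ∑' j : ℕ, W ω ^ (j + 1) / (j + 1).factorial *
      (hermiteR j (ouNoise t x (Y ω)) * (gpdf (ouNoise t x (Y ω)) * (1 / ouSd t))) =
      (gcdf (ouNoise t x (Y ω)) - gcdf (ouNoise t x (Y ω) - W ω)) * (1 / ouSd t) := fun ω => by
    rw [← ((hasSum_gcdf_sub (ouNoise t x (Y ω)) (W ω)).mul_right (1 / ouSd t)).tsum_eq]
    exact tsum_congr fun j => by ring
  simpa only [e] using h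

end FixedTime

section FixedTime

variable {Ω : Type*} {m₀ : MeasurableSpace Ω} (P : Measure Ω)

lemma integral_condExp_mul_of_bounded [IsFiniteMeasure P] {m : MeasurableSpace Ω} (hm : m ≤ m₀)
    {A h : Ω → ℝ} (hA : Integrable A P) (hh : StronglyMeasurable[m] h) {C : ℝ}
    (hC : ∀ ω, |h ω| ≤ C) : ∫ ω, (P[A | m]) ω * h ω ∂P = ∫ ω, A ω * h ω ∂P := by
  have hAh : Integrable (A * h) P :=
    hA.mul_bdd (hh.mono hm).aestronglyMeasurable (Filter.Eventually.of_forall hC)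
  rw [← integral_condExp hm (f := fun ω => A ω * h ω)]
  exact integral_congr_ae (condExp_mul_of_stronglyMeasurable_right hh hAh hA).symm

lemma ofReal_mul_enorm_integral_div_rpow_le {p : ℝ} (hp : 1 ≤ p) {g k : Ω → ℝ} (hg : Measurable g)
    (hk : Measurable k) (hk0 : ∀ ω, 0 ≤ k ω) {K : ℝ} (hK : 0 < K)
    (hkK : ∫⁻ ω, ENNReal.ofReal (k ω) ∂P = ENNReal.ofReal K) :
    ENNReal.ofReal K * ‖(∫ ω, g ω * k ω ∂P) / K‖ₑ ^ p ≤
      ∫⁻ ω, ENNReal.ofReal (k ω) * ‖g ω‖ₑ ^ p ∂P := by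
  have hp0 : 0 < p := by linarith
  set κ := ENNReal.ofReal K with hκ
  have hκ0 : κ ≠ 0 := (ENNReal.ofReal_pos.2 hK).ne'
  have hκt : κ ≠ ∞ := ENNReal.ofReal_ne_top
  have hkm : Measurable fun ω => ENNReal.ofReal (k ω) := hk.ennreal_ofReal
  set Q := P.withDensity fun ω => ENNReal.ofReal (k ω) with hQ
  have hQu : Q Set.univ = κ := by
    rw [hQ, withDensity_apply _ MeasurableSet.univ, Measure.restrict_univ, hkK]
  have h1 := eLpNorm'_le_eLpNorm'_mul_rpow_measure_univ (μ := Q) one_pos hp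
    hg.aestronglyMeasurable
  have e : ∀ r : ℝ, ∫⁻ ω, ‖g ω‖ₑ ^ r ∂Q = ∫⁻ ω, ENNReal.ofReal (k ω) * ‖g ω‖ₑ ^ r ∂P := fun r =>
    lintegral_withDensity_eq_lintegral_mul P hkm (hg.enorm.pow_const r)
  unfold eLpNorm' at h1
  rw [e, e, hQu] at h1
  simp only [ENNReal.rpow_one, div_one] at h1
  set I := ∫⁻ ω, ENNReal.ofReal (k ω) * ‖g ω‖ₑ ^ p ∂P with hI
  have h2 : ‖∫ ω, g ω * k ω ∂P‖ₑ ≤ I ^ (1 / p) * κ ^ (1 - 1 / p) := by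
    refine (enorm_integral_le_lintegral_enorm _).trans (le_trans (le_of_eq ?_) h1)
    refine lintegral_congr fun ω => ?_
    rw [enorm_mul, mul_comm, Real.enorm_of_nonneg (hk0 ω)]
  have h3 : ‖(∫ ω, g ω * k ω ∂P) / K‖ₑ ≤ I ^ (1 / p) * κ ^ (-(1 / p)) := by
    rw [div_eq_mul_inv, enorm_mul, Real.enorm_of_nonneg (inv_pos.2 hK).le,
      ENNReal.ofReal_inv_of_pos hK]
    refine (mul_le_mul_left h2 _).trans_eq ?_
    rw [mul_assoc, ← ENNReal.rpow_neg_one, ← ENNReal.rpow_add _ _ hκ0 hκt]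
    ring_nf
  have h4 := ENNReal.rpow_le_rpow h3 hp0.le
  rw [ENNReal.mul_rpow_of_nonneg _ _ hp0.le, ← ENNReal.rpow_mul, ← ENNReal.rpow_mul,
    one_div_mul_cancel hp0.ne', ENNReal.rpow_one, neg_mul, one_div_mul_cancel hp0.ne',
    ENNReal.rpow_neg_one] at h4
  calc κ * ‖(∫ ω, g ω * k ω ∂P) / K‖ₑ ^ p ≤ κ * (I * κ⁻¹) := mul_le_mul_right h4 _
    _ = I := by rw [mul_comm I, ← mul_assoc, ENNReal.mul_inv_cancel hκ0 hκt, one_mul]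

/-- The coefficients of the Hermite expansion of the velocity field. -/
def velCoeff (c s : ℝ) (X Y : Ω → ℝ) (j : ℕ) (ω : Ω) : ℝ :=
  c ^ j * (Y ω - X ω) ^ (j + 1) / ((j + 1).factorial * s) +
    if j = 0 then X ω else if j = 1 then -c else 0

variable {X Y : Ω → ℝ} {t ξ s : ℝ}

lemma integrable_sub_pow_of_exp_sq (hX : Measurable X) (hY : Measurable Y) (ht : 0 < t)
    (hξ : 0 < ξ)
    (hexp : ∫⁻ ω, ENNReal.ofReal (exp ((1 + ξ) * (ouRatio t * (Y ω - X ω)) ^ 2 / 2)) ∂P ≠ ∞)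
    (k : ℕ) : Integrable (fun ω => (Y ω - X ω) ^ k) P := by
  have h := integrable_pow_of_exp_sq P ((hY.sub hX).const_mul (ouRatio t))
    (show 0 < 1 + ξ by linarith) hexp k
  simp only [mul_pow] at h
  exact (integrable_const_mul_iff (pow_pos (ouRatio_pos ht) k).ne'.isUnit _).1 h

variable [IsProbabilityMeasure P]

lemma integrable_velCoeff (hXi : Integrable X P)
    (hpow : ∀ k : ℕ, Integrable (fun ω => (Y ω - X ω) ^ k) P) (c s : ℝ) (j : ℕ) :
    Integrable (velCoeff c s X Y j) P := by
  refine (((hpow (j + 1)).const_mul _).div_const _).add ?_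
  split_ifs
  · exact hXi
  · exact integrable_const _
  · exact integrable_const _

lemma gcdf_integral_sub_eq_zero (hX : Measurable X) (hY : Measurable Y)
    (hlaw : P.map Y = P.map X) (t x : ℝ) :
    ∫ ω, (gcdf (ouNoise t x (X ω)) - gcdf (ouNoise t x (X ω) - ouRatio t * (Y ω - X ω))) *
      (1 / ouSd t) ∂P = 0 := by
  have e : ∀ ω, ouNoise t x (X ω) - ouRatio t * (Y ω - X ω) = ouNoise t x (Y ω) := fun ω => by
    simp only [ouNoise, ouRatio]; ring
  have hc : Continuous fun y => gcdf (ouNoise t x y) :=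
    continuous_gcdf.comp (continuous_ouNoise_right t x)
  have hi : ∀ Z : Ω → ℝ, Measurable Z → Integrable (fun ω => gcdf (ouNoise t x (Z ω))) P :=
    fun Z hZ => by
      have : IsProbabilityMeasure (P.map Z) := Measure.isProbabilityMeasure_map hZ.aemeasurable
      exact (integrable_gcdf_ouNoise (P.map Z) t x).comp_measurable hZ
  simp only [e]
  rw [integral_mul_const, integral_sub (hi X hX) (hi Y hY),
    ← integral_map hX.aemeasurable hc.aestronglyMeasurable,
    ← integral_map hY.aemeasurable hc.aestronglyMeasurable, hlaw, sub_self, zero_mul]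

lemma abs_hermiteR_mul_gpdf_bounded (j : ℕ) (t : ℝ) :
    ∃ C, ∀ z, |hermiteR j z * (gpdf z * (1 / ouSd t))| ≤ C := by
  obtain ⟨C, hC⟩ := exists_bound_mul_gpdf (ExpBdd.hermite j)
  refine ⟨C * |1 / ouSd t|, fun z => ?_⟩
  rw [← mul_assoc, abs_mul]
  exact mul_le_mul_of_nonneg_right (hC z) (abs_nonneg _)

lemma ae_hasSum_velCoeff (hX : Measurable X) (hY : Measurable Y) (hXi : Integrable X P)
    (hlaw : P.map Y = P.map X) (ht : 0 < t) (hξ : 0 < ξ) (hs : 0 < s)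
    (hexp : ∫⁻ ω, ENNReal.ofReal (exp ((1 + ξ) * (ouRatio t * (Y ω - X ω)) ^ 2 / 2)) ∂P ≠ ∞) :
    ∀ᵐ x : ℝ, HasSum (fun j : ℕ => ∫ ω, velCoeff (ouRatio t) s X Y j ω *
      (hermiteR j (ouNoise t x (X ω)) * (gpdf (ouNoise t x (X ω)) * (1 / ouSd t))) ∂P)
      (flowTime (P.map X) t x / exp (-t)) := by
  have hc := ouRatio_pos ht
  have hpow := integrable_sub_pow_of_exp_sq P hX hY ht hξ hexp
  filter_upwards [ae_tsum_lintegral_ne_top P ((hY.sub hX).const_mul (ouRatio t)) hX ht hξ hexp]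
    with x hx
  have hz : Measurable fun ω => ouNoise t x (X ω) :=
    (continuous_ouNoise_right t x).measurable.comp hX
  have hkm : ∀ j : ℕ, Measurable fun ω => hermiteR j (ouNoise t x (X ω)) *
      (gpdf (ouNoise t x (X ω)) * (1 / ouSd t)) := fun j =>
    ((continuous_hermiteR j).measurable.comp hz).mul
      ((continuous_gpdf.measurable.comp hz).mul_const _)
  have hmul : ∀ (j : ℕ) {A : Ω → ℝ}, Integrable A P → Integrable (fun ω => A ω *
      (hermiteR j (ouNoise t x (X ω)) * (gpdf (ouNoise t x (X ω)) * (1 / ouSd t)))) P :=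
    fun j A hA => by
      obtain ⟨C, hC⟩ := abs_hermiteR_mul_gpdf_bounded j t
      exact hA.mul_bdd (hkm j).aestronglyMeasurable
        (Filter.Eventually.of_forall fun ω => hC (ouNoise t x (X ω)))
  have h1 := hasSum_integral_hermite P ((hY.sub hX).const_mul (ouRatio t)) hX hx
  simp only [Pi.sub_apply] at h1
  rw [gcdf_integral_sub_eq_zero P hX hY hlaw t x] at h1
  have h2 := h1.mul_left (1 / (ouRatio t * s))
  set r : ℕ → Ω → ℝ := fun j ω => if j = 0 then X ω else if j = 1 then -ouRatio t else 0 with hr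
  have hri : ∀ j, Integrable (r j) P := fun j => by
    simp only [hr]
    split_ifs
    · exact hXi
    · exact integrable_const _
    · exact integrable_const _
  have h3 : HasSum (fun j : ℕ => ∫ ω, r j ω * (hermiteR j (ouNoise t x (X ω)) *
      (gpdf (ouNoise t x (X ω)) * (1 / ouSd t))) ∂P) _ :=
    hasSum_sum_of_ne_finset_zero (s := Finset.range 2) fun j hj => by
      have : 1 < j := by simpa using hj
      simp [hr, show j ≠ 0 by lia, show j ≠ 1 by lia]
  have h4 := h2.add h3
  have hval : 1 / (ouRatio t * s) * 0 + ∑ j ∈ Finset.range 2, ∫ ω, r j ω *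
      (hermiteR j (ouNoise t x (X ω)) * (gpdf (ouNoise t x (X ω)) * (1 / ouSd t))) ∂P =
      flowTime (P.map X) t x / exp (-t) := by
    have hb := ouSd_pos ht
    rw [Finset.sum_range_succ, Finset.sum_range_one, ← integral_add (hmul 0 (hri 0))
      (hmul 1 (hri 1)), flowTime, integral_map hX.aemeasurable
      (continuous_ouNoiseTime_mul t x).aestronglyMeasurable, mul_zero, zero_add,
      ← integral_div]
    refine integral_congr_ae (Filter.Eventually.of_forall fun ω => ?_)
    simp only [hr, hermiteR_zero, hermiteR_one, ouNoiseTime, ouRatio, if_true, one_ne_zero,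
      if_false]
    field_simp
    try ring
  rw [hval] at h4
  refine (congrArg (fun f => HasSum f (flowTime (P.map X) t x / exp (-t))) (funext fun j => ?_)).mpr h4
  rw [← integral_const_mul, ← integral_add ?_ (hmul j (hri j))]
  · refine integral_congr_ae (Filter.Eventually.of_forall fun ω => ?_)
    simp only [velCoeff, hr, add_mul, mul_pow]
    congr 1
    field_simp
    ring
  · have := hmul j ((hpow (j + 1)).const_mul
      (1 / (ouRatio t * s) * (ouRatio t ^ (j + 1) / (j + 1).factorial)))
    refine this.congr (Filter.Eventually.of_forall fun ω => ?_)
    simp only [mul_pow]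
    ring

end FixedTime

section FixedTime

variable {Ω : Type*} {m₀ : MeasurableSpace Ω} (P : Measure Ω) [IsProbabilityMeasure P]
  {X Y : Ω → ℝ} {t ξ s p : ℝ}

lemma lintegral_rpow_hermiteSum_le {c : ℕ → Ω → ℝ} (hc : ∀ j, Measurable (c j))
    (hX : Measurable X) (ht : 0 < t) (hp : 1 ≤ p) (N : ℕ) {B : Ω → ℝ≥0∞}
    (hB : ∀ᵐ ω ∂P, ENNReal.ofReal (∑ j ∈ Finset.range N,
      c j ω ^ 2 * j.factorial * (max 1 (p - 1)) ^ j) ≤ B ω) :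
    (Measurable fun x : ℝ => ∫⁻ ω, ENNReal.ofReal (gpdf (ouNoise t x (X ω)) * (1 / ouSd t)) *
      ‖hermiteSum N (fun j => c j ω) 1 (ouNoise t x (X ω))‖ₑ ^ p ∂P) ∧
    ∫⁻ x : ℝ, ∫⁻ ω, ENNReal.ofReal (gpdf (ouNoise t x (X ω)) * (1 / ouSd t)) *
      ‖hermiteSum N (fun j => c j ω) 1 (ouNoise t x (X ω))‖ₑ ^ p ∂P ≤
      ∫⁻ ω, B ω ^ (p / 2) ∂P := by
  have hz := measurable_ouNoise_comp hX t
  have hm : Measurable fun q : ℝ × Ω =>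
      ENNReal.ofReal (gpdf (ouNoise t q.1 (X q.2)) * (1 / ouSd t)) *
        ‖hermiteSum N (fun j => c j q.2) 1 (ouNoise t q.1 (X q.2))‖ₑ ^ p := by
    refine ((continuous_gpdf.measurable.comp hz).mul_const _).ennreal_ofReal.mul
      (Measurable.pow_const (Measurable.enorm ?_) _)
    unfold hermiteSum
    exact Finset.measurable_sum _ fun j _ => (((hc j).comp measurable_snd).mul_const _).mul
      ((continuous_hermiteR j).measurable.comp hz)
  refine ⟨hm.lintegral_prod_right', ?_⟩
  rw [lintegral_lintegral_swap hm.aemeasurable]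
  refine lintegral_mono_ae (hB.mono fun ω hω => ?_)
  rw [lintegral_gaussian_eq_ouNoise ht (X ω)
    (h := fun z => ‖hermiteSum N (fun j => c j ω) 1 z‖ₑ ^ p)]
  exact (lintegral_hermiteSum_rpow_le hp N _).trans (ENNReal.rpow_le_rpow hω (by linarith))

theorem lintegral_flowVel_rpow_le (hX : Measurable X) (hY : Measurable Y) (hXi : Integrable X P)
    (hlaw : P.map Y = P.map X) (ht : 0 < t) (hξ : 0 < ξ) (hs : 0 < s) (hp : 1 ≤ p)
    (hexp : ∫⁻ ω, ENNReal.ofReal (exp ((1 + ξ) * (ouRatio t * (Y ω - X ω)) ^ 2 / 2)) ∂P ≠ ∞)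
    {B : Ω → ℝ≥0∞}
    (hB : ∀ N : ℕ, ∀ᵐ ω ∂P, ENNReal.ofReal (∑ j ∈ Finset.range N,
      (P[velCoeff (ouRatio t) s X Y j | MeasurableSpace.comap X inferInstance]) ω ^ 2 *
        j.factorial * (max 1 (p - 1)) ^ j) ≤ B ω) :
    ∫⁻ x, ENNReal.ofReal (flowDens (P.map X) t x) * ‖flowVel (P.map X) t x‖ₑ ^ p ≤
      ENNReal.ofReal (exp (-t)) ^ p * ∫⁻ ω, B ω ^ (p / 2) ∂P := by
  have hp0 : 0 < p := by linarith
  have hb := ouSd_pos ht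
  have hmX : MeasurableSpace.comap X inferInstance ≤ m₀ := hX.comap_le
  have : IsProbabilityMeasure (P.map X) := Measure.isProbabilityMeasure_map hX.aemeasurable
  set C : ℕ → Ω → ℝ := fun j =>
    P[velCoeff (ouRatio t) s X Y j | MeasurableSpace.comap X inferInstance] with hC
  have hCm : ∀ j, Measurable (C j) := fun j =>
    (stronglyMeasurable_condExp.mono hmX).measurable
  set F : ℕ → ℝ → ℝ≥0∞ := fun N x =>
    ∫⁻ ω, ENNReal.ofReal (gpdf (ouNoise t x (X ω)) * (1 / ouSd t)) *
      ‖hermiteSum N (fun j => C j ω) 1 (ouNoise t x (X ω))‖ₑ ^ p ∂P with hF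
  have hFb := fun N => lintegral_rpow_hermiteSum_le P hCm hX ht hp N (hB N)
  have hpow := integrable_sub_pow_of_exp_sq P hX hY ht hξ hexp
  have hA := integrable_velCoeff P hXi hpow (ouRatio t) s
  have hae : ∀ᵐ x : ℝ, ENNReal.ofReal (flowDens (P.map X) t x) * ‖flowVel (P.map X) t x‖ₑ ^ p ≤
      ENNReal.ofReal (exp (-t)) ^ p * Filter.liminf (fun N => F N x) Filter.atTop := by
    filter_upwards [ae_hasSum_velCoeff P hX hY hXi hlaw ht hξ hs hexp] with x hx
    have hK := flowDens_pos (P.map X) ht x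
    set K := flowDens (P.map X) t x with hKdef
    have hz : Measurable fun ω => ouNoise t x (X ω) :=
      (continuous_ouNoise_right t x).measurable.comp hX
    have hkm : Measurable fun ω => gpdf (ouNoise t x (X ω)) * (1 / ouSd t) :=
      (continuous_gpdf.measurable.comp hz).mul_const _
    have hkK : ∫⁻ ω, ENNReal.ofReal (gpdf (ouNoise t x (X ω)) * (1 / ouSd t)) ∂P =
        ENNReal.ofReal K := by
      rw [hKdef, ofReal_flowDens (P.map X) ht x, lintegral_map ?_ hX]
      exact ((continuous_gpdf.measurable.comp
        (continuous_ouNoise_right t x).measurable).mul_const _).ennreal_ofReal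
    have hterm : ∀ j : ℕ, Integrable (fun ω => C j ω * (hermiteR j (ouNoise t x (X ω)) *
        (gpdf (ouNoise t x (X ω)) * (1 / ouSd t)))) P ∧
        ∫ ω, C j ω * (hermiteR j (ouNoise t x (X ω)) *
          (gpdf (ouNoise t x (X ω)) * (1 / ouSd t))) ∂P =
        ∫ ω, velCoeff (ouRatio t) s X Y j ω * (hermiteR j (ouNoise t x (X ω)) *
          (gpdf (ouNoise t x (X ω)) * (1 / ouSd t))) ∂P := fun j => by
      obtain ⟨R, hR⟩ := abs_hermiteR_mul_gpdf_bounded j t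
      have hcont : Measurable fun y => hermiteR j (ouNoise t x y) *
          (gpdf (ouNoise t x y) * (1 / ouSd t)) :=
        ((continuous_hermiteR j).measurable.comp (continuous_ouNoise_right t x).measurable).mul
          ((continuous_gpdf.measurable.comp (continuous_ouNoise_right t x).measurable).mul_const _)
      have hsm : StronglyMeasurable[MeasurableSpace.comap X inferInstance] fun ω =>
          hermiteR j (ouNoise t x (X ω)) * (gpdf (ouNoise t x (X ω)) * (1 / ouSd t)) :=
        (hcont.comp (comap_measurable X)).stronglyMeasurable
      exact ⟨integrable_condExp.mul_bdd (hsm.mono hmX).aestronglyMeasurable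
        (Filter.Eventually.of_forall fun ω => hR (ouNoise t x (X ω))),
        integral_condExp_mul_of_bounded P hmX (hA j) hsm fun ω => hR (ouNoise t x (X ω))⟩
    have hsum : ∀ N : ℕ, ∑ j ∈ Finset.range N, ∫ ω, velCoeff (ouRatio t) s X Y j ω *
        (hermiteR j (ouNoise t x (X ω)) * (gpdf (ouNoise t x (X ω)) * (1 / ouSd t))) ∂P =
        ∫ ω, hermiteSum N (fun j => C j ω) 1 (ouNoise t x (X ω)) *
          (gpdf (ouNoise t x (X ω)) * (1 / ouSd t)) ∂P := fun N => by
      rw [← Finset.sum_congr rfl fun j _ => (hterm j).2,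
        ← integral_finsetSum _ fun j _ => (hterm j).1]
      refine integral_congr_ae (Filter.Eventually.of_forall fun ω => ?_)
      simp only [hermiteSum, one_pow, mul_one, Finset.sum_mul]
      exact Finset.sum_congr rfl fun j _ => by ring
    have hlim := hx.tendsto_sum_nat
    simp only [hsum] at hlim
    have hlim2 := ((continuous_enorm.tendsto _).comp (hlim.div_const K))
    have hlim3 := ENNReal.Tendsto.const_mul (a := ENNReal.ofReal K)
      ((ENNReal.continuous_rpow_const (y := p)).tendsto _ |>.comp hlim2)
      (Or.inr ENNReal.ofReal_ne_top)
    have hle : ENNReal.ofReal K * ‖flowTime (P.map X) t x / exp (-t) / K‖ₑ ^ p ≤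
        Filter.liminf (fun N => F N x) Filter.atTop := by
      rw [← hlim3.liminf_eq]
      refine Filter.liminf_le_liminf (Filter.Eventually.of_forall fun N => ?_)
      refine ofReal_mul_enorm_integral_div_rpow_le P hp ?_ hkm
        (fun ω => mul_nonneg (gpdf_pos _).le (one_div_pos.2 hb).le) hK hkK
      unfold hermiteSum
      exact Finset.measurable_sum _ fun j _ => ((hCm j).mul_const _).mul
        ((continuous_hermiteR j).measurable.comp hz)
    have e : flowVel (P.map X) t x = -(exp (-t) * (flowTime (P.map X) t x / exp (-t) / K)) := by
      rw [flowVel, ← hKdef]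
      field_simp
    rw [e, enorm_neg, enorm_mul, ENNReal.mul_rpow_of_nonneg _ _ hp0.le,
      Real.enorm_of_nonneg (exp_pos _).le, mul_left_comm]
    exact mul_le_mul_right hle _
  refine (lintegral_mono_ae hae).trans ?_
  rw [lintegral_const_mul' _ _ (ENNReal.rpow_ne_top_of_nonneg hp0.le ENNReal.ofReal_ne_top)]
  refine mul_le_mul_right ((lintegral_liminf_le fun N => (hFb N).1).trans ?_) _
  refine (Filter.liminf_le_liminf (Filter.Eventually.of_forall fun N => (hFb N).2)).trans ?_
  simp

end FixedTime

section FixedTime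

variable {Ω : Type*} {m m₀ : MeasurableSpace Ω} (P : Measure Ω) {X Y : Ω → ℝ}

lemma condExp_velCoeff_add_two (c s : ℝ) (j : ℕ) :
    P[velCoeff c s X Y (j + 2) | m] =ᵐ[P] fun ω =>
      c ^ (j + 2) / ((j + 3).factorial * s) * (P[fun ω' => (Y ω' - X ω') ^ (j + 3) | m]) ω := by
  have e : velCoeff c s X Y (j + 2) = (c ^ (j + 2) / ((j + 3).factorial * s)) •
      fun ω' => (Y ω' - X ω') ^ (j + 3) := by
    funext ω
    simp only [velCoeff, Pi.smul_apply, smul_eq_mul, show j + 2 ≠ 0 by lia,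
      show j + 2 ≠ 1 by lia, if_false, add_zero]
    ring
  rw [e]
  exact condExp_smul _ _ m

lemma condExp_velCoeff_one (c s : ℝ) :
    P[velCoeff c s X Y 1 | m] =ᵐ[P] fun ω =>
      c * (P[fun ω' => (Y ω' - X ω') ^ 2 / (2 * s) - 1 | m]) ω := by
  have e : velCoeff c s X Y 1 = c • fun ω' => (Y ω' - X ω') ^ 2 / (2 * s) - 1 := by
    funext ω
    simp [velCoeff]
    ring
  rw [e]
  exact condExp_smul _ _ m

lemma velCoeff_zero (c s : ℝ) :
    velCoeff c s X Y 0 = fun ω' => (Y ω' - X ω') / s + X ω' := by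
  funext ω
  simp [velCoeff]

lemma ae_ofReal_sum_velCoeff_le {t s : ℝ} (ht : 0 < t) (hs : 0 < s) (p : ℝ) (N : ℕ) :
    ∀ᵐ ω ∂P, ENNReal.ofReal (∑ j ∈ Finset.range N,
      (P[velCoeff (ouRatio t) s X Y j | m]) ω ^ 2 * j.factorial * (max 1 (p - 1)) ^ j) ≤
      (ENNReal.ofReal (((P[fun ω' => (Y ω' - X ω') / s + X ω' | m]) ω) ^ 2)
        + ENNReal.ofReal (max 1 (p - 1) / (exp (2 * t) - 1) *
            ((P[fun ω' => (Y ω' - X ω') ^ 2 / (2 * s) - 1 | m]) ω) ^ 2)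
        + ∑' k : ℕ, if 3 ≤ k then
            ENNReal.ofReal ((max 1 (p - 1)) ^ (k - 1) /
                (s ^ 2 * k * k.factorial * (exp (2 * t) - 1) ^ (k - 1)) *
              ((P[fun ω' => (Y ω' - X ω') ^ k | m]) ω) ^ 2)
          else 0) := by
  filter_upwards [condExp_velCoeff_one P (m := m) (X := X) (Y := Y) (ouRatio t) s,
    ae_all_iff.2 fun j => condExp_velCoeff_add_two P (m := m) (X := X) (Y := Y) (ouRatio t) s j]
    with ω h1 h2
  have hq : 1 ≤ max 1 (p - 1) := le_max_left _ _
  set q := max 1 (p - 1) with hqdef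
  have hE : 0 < exp (2 * t) - 1 := sub_pos.2 (one_lt_exp_iff.2 (by linarith))
  set E := exp (2 * t) - 1 with hEdef
  have hc2 : ouRatio t ^ 2 = 1 / E := ouRatio_sq ht
  set f : ℕ → ℝ := fun j =>
    (P[velCoeff (ouRatio t) s X Y j | m]) ω ^ 2 * j.factorial * q ^ j with hf
  have hf0 : ∀ j, 0 ≤ f j := fun j => by positivity
  have e0 : f 0 = ((P[fun ω' => (Y ω' - X ω') / s + X ω' | m]) ω) ^ 2 := by
    simp [hf, velCoeff_zero]
  have e1 : f 1 = q / E * ((P[fun ω' => (Y ω' - X ω') ^ 2 / (2 * s) - 1 | m]) ω) ^ 2 := by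
    simp only [hf, h1, mul_pow, hc2, Nat.factorial_one, Nat.cast_one, pow_one]
    ring
  have e2 : ∀ j : ℕ, f (j + 2) = q ^ (j + 3 - 1) /
      (s ^ 2 * (j + 3 : ℕ) * (j + 3).factorial * E ^ (j + 3 - 1)) *
        ((P[fun ω' => (Y ω' - X ω') ^ (j + 3) | m]) ω) ^ 2 := fun j => by
    have hfac : ((j + 3).factorial : ℝ) = (j + 3 : ℕ) * (j + 2).factorial := by
      rw [Nat.factorial_succ]; push_cast; ring
    have hpos : (0 : ℝ) < (j + 2).factorial := by positivity
    have hpos3 : (0 : ℝ) < (j + 3 : ℕ) := by positivity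
    simp only [hf, h2, show j + 3 - 1 = j + 2 by lia]
    rw [mul_pow, div_pow, ← pow_mul, mul_comm (j + 2) 2, pow_mul, hc2, hfac, one_div, inv_pow]
    field_simp
  calc ENNReal.ofReal (∑ j ∈ Finset.range N, f j)
      ≤ ENNReal.ofReal (∑ j ∈ Finset.range (N + 2), f j) := by
        refine ENNReal.ofReal_le_ofReal (Finset.sum_le_sum_of_subset_of_nonneg ?_ fun j _ _ => hf0 j)
        exact Finset.range_mono (by lia)
    _ = ENNReal.ofReal (f 0) + ENNReal.ofReal (f 1) +
        ∑ j ∈ Finset.range N, ENNReal.ofReal (f (j + 2)) := by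
      rw [Finset.sum_range_succ', Finset.sum_range_succ',
        ENNReal.ofReal_add (add_nonneg (Finset.sum_nonneg fun j _ => hf0 _) (hf0 _)) (hf0 _),
        ENNReal.ofReal_add (Finset.sum_nonneg fun j _ => hf0 _) (hf0 _),
        ENNReal.ofReal_sum_of_nonneg fun j _ => hf0 _]
      ring
    _ ≤ _ := by
      rw [e0, e1]
      refine add_le_add le_rfl ((ENNReal.sum_le_tsum _).trans ?_)
      refine le_trans (le_of_eq ?_) (ENNReal.tsum_comp_le_tsum_of_injective
        (add_left_injective 3) _)
      refine tsum_congr fun j => ?_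
      rw [e2, if_pos (by lia)]

end FixedTime

lemma integrable_id_of_integrable_rpow {ν : Measure ℝ} [IsFiniteMeasure ν] {p : ℝ} (hp : 1 ≤ p)
    (hmom : Integrable (fun x => |x| ^ p) ν) : Integrable (fun x => x) ν := by
  refine ((integrable_const (1 : ℝ)).add hmom).mono' measurable_id.aestronglyMeasurable
    (Filter.Eventually.of_forall fun x => ?_)
  rw [Real.norm_eq_abs]
  change |x| ≤ 1 + |x| ^ p
  rcases le_total |x| 1 with h | h
  · have : 0 ≤ |x| ^ p := by positivity
    linarith
  · have := self_le_rpow_of_one_le h hp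
    linarith

theorem stein_Wp_dim_one
    {Ω : Type*} [MeasurableSpace Ω] (P : Measure Ω) [IsProbabilityMeasure P]
    (p : ℝ) (hp : 1 ≤ p)
    (ν : Measure ℝ) [IsProbabilityMeasure ν]
    (hmom : Integrable (fun x => |x| ^ p) ν)
    (X : ℝ → Ω → ℝ)
    (hXmeas : ∀ t, 0 ≤ t → Measurable (X t))
    (hXlaw : ∀ t, 0 ≤ t → P.map (X t) = ν)
    (hcond : ∀ ε : ℝ, 0 < ε → ∃ ξ : ℝ, 0 < ξ ∧ ∃ M : ℝ, 0 < M ∧ ∀ t ∈ Set.Icc ε ε⁻¹,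
      (∫⁻ ω, ENNReal.ofReal (Real.exp (p * (1 + ξ) * max 1 (p - 1) * |X t ω - X 0 ω| ^ 2 /
          (2 * (Real.exp (2 * t) - 1)))) ∂P) ≤ ENNReal.ofReal M)
    (s : ℝ) (hs : 0 < s) :
    wassersteinDist p ν (gaussianReal 0 1) ≤
      ∫⁻ t in Set.Ioi (0 : ℝ),
        ENNReal.ofReal (Real.exp (-t)) *
          (∫⁻ ω,
            (ENNReal.ofReal (((P[fun ω' => (X t ω' - X 0 ω') / s + X 0 ω' |
                MeasurableSpace.comap (X 0) inferInstance]) ω) ^ 2)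
            + ENNReal.ofReal (max 1 (p - 1) / (Real.exp (2 * t) - 1) *
                ((P[fun ω' => (X t ω' - X 0 ω') ^ 2 / (2 * s) - 1 |
                  MeasurableSpace.comap (X 0) inferInstance]) ω) ^ 2)
            + ∑' k : ℕ, if 3 ≤ k then
                ENNReal.ofReal ((max 1 (p - 1)) ^ (k - 1) /
                    (s ^ 2 * k * k.factorial * (Real.exp (2 * t) - 1) ^ (k - 1)) *
                  ((P[fun ω' => (X t ω' - X 0 ω') ^ k |
                    MeasurableSpace.comap (X 0) inferInstance]) ω) ^ 2)
              else 0) ^ (p / 2) ∂P) ^ (1 / p) := by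
  have hp0 : 0 < p := by linarith
  have hν := integrable_id_of_integrable_rpow hp hmom
  have hX0 := hXmeas 0 le_rfl
  have hX0i : Integrable (X 0) P := by
    rw [← hXlaw 0 le_rfl] at hν
    exact hν.comp_measurable hX0
  refine (wassersteinDist_gaussianReal_le ν hν hp).trans
    (setLIntegral_mono' measurableSet_Ioi fun t ht => ?_)
  have ht0 : 0 < t := ht
  have hE : 0 < exp (2 * t) - 1 := sub_pos.2 (one_lt_exp_iff.2 (by linarith))
  obtain ⟨ξ, hξ, M, -, hM⟩ := hcond (min t t⁻¹) (lt_min ht0 (inv_pos.2 ht0))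
  have hM' := hM t ⟨min_le_left _ _,
    le_inv_of_le_inv₀ (lt_min ht0 (inv_pos.2 ht0)) (min_le_right _ _)⟩
  have hexp : ∫⁻ ω, ENNReal.ofReal
      (exp ((1 + ξ) * (ouRatio t * (X t ω - X 0 ω)) ^ 2 / 2)) ∂P ≠ ∞ := by
    refine ne_top_of_le_ne_top ENNReal.ofReal_ne_top (le_trans (lintegral_mono fun ω => ?_) hM')
    refine ENNReal.ofReal_le_ofReal (exp_le_exp.2 ?_)
    have hpq : 1 ≤ p * max 1 (p - 1) := one_le_mul_of_one_le_of_one_le hp (le_max_left _ _)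
    rw [mul_pow, ouRatio_sq ht0, sq_abs]
    calc (1 + ξ) * (1 / (exp (2 * t) - 1) * (X t ω - X 0 ω) ^ 2) / 2 =
        1 * ((1 + ξ) * (X t ω - X 0 ω) ^ 2 / (2 * (exp (2 * t) - 1))) := by field_simp
      _ ≤ (p * max 1 (p - 1)) * ((1 + ξ) * (X t ω - X 0 ω) ^ 2 / (2 * (exp (2 * t) - 1))) := by
        gcongr
      _ = _ := by ring
  have hmain := lintegral_flowVel_rpow_le P hX0 (hXmeas t ht0.le) hX0i
    ((hXlaw t ht0.le).trans (hXlaw 0 le_rfl).symm) ht0 hξ hs hp hexp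
    (fun N => ae_ofReal_sum_velCoeff_le P ht0 hs p N)
  rw [hXlaw 0 le_rfl] at hmain
  refine (ENNReal.rpow_le_rpow hmain (by positivity)).trans_eq ?_
  rw [ENNReal.mul_rpow_of_nonneg _ _ (by positivity), ← ENNReal.rpow_mul,
    mul_one_div_cancel hp0.ne', ENNReal.rpow_one]

end
end
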